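/- arXiv:2302.13308 — 2 statements merged into one kernel-verified Lean document; each statement's English description precedes it below -/
import Mathlib

section
/- Let d ≥ 2, ξ ∈ ℝ^d, M0 ∈ SL(d,ℝ), η, r > 0, and let λ be a Borel probability measure on S^{d−1} with continuous density. Assume one of: (B1) η < d; (B2) η < d+1 and, if d = 2, Σ_{l=1}^∞ 2^{(η−2)l} ζ(ξ,2^{l−1})^{−2} < ∞, while if d ≥ 3, Σ_{l=1}^∞ l^{d−1} 2^{(η−d)l} ζ(ξ,2^{l−1})^{−1} < ∞. Then lim_{R→∞} limsup_{t→∞} | ∫_{S^{d−1}_+} F_{R,η,r}( Γ' (1,ξ)(M0 k(υ) Φ_t, 0) ) dλ(υ) | = 0, where S^{d−1}_+ := {υ ∈ S^{d−1} : υ_1 ≥ 0}. -/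
open MeasureTheory Filter Matrix
open scoped Topology Classical

noncomputable section

/-- Distance from `x : ℝ` to the nearest integer. -/
def distToInt (x : ℝ) : ℝ := |x - round x|

/-- ζ(ξ,T) from the paper. -/
def zetaDio {d : ℕ} (ξ : Fin d → ℝ) (T : ℝ) : ℕ :=
  sInf {N : ℕ | ∃ m : Fin d → ℤ, m ≠ 0 ∧ (∀ i, |m i| ≤ (N : ℤ)) ∧
    distToInt (∑ i, ξ i * (m i : ℝ)) ≤ 1 / T}

/-- Euclidean norm on row vectors. -/
def enorm' {d : ℕ} (x : Fin d → ℝ) : ℝ := Real.sqrt (∑ i, (x i) ^ 2)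

/-- π₁ : ℝ^d → ℝ, the first coordinate. -/
def head' {d : ℕ} (x : Fin d → ℝ) : ℝ := if h : 0 < d then x ⟨0, h⟩ else 0

/-- The upper triangular unipotent matrix n(u). -/
def nMat (d : ℕ) (u : Fin d → Fin d → ℝ) : Matrix (Fin d) (Fin d) ℝ :=
  Matrix.of fun i j => if i = j then 1 else if i < j then u i j else 0

/-- The constant c_d = d (2/√3)^d. -/
def cd' (d : ℕ) : ℝ := d * (2 / Real.sqrt 3) ^ d

/-- The constant δ_d = d·4^d. -/
def deltad (d : ℕ) : ℝ := d * 4 ^ d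

/-- Siegel conditions on the diagonal part v. -/
def SiegelV (d : ℕ) (v : Fin d → ℝ) : Prop :=
  (∀ i, 0 < v i) ∧ (∏ i, v i = 1) ∧
  ∀ i j : Fin d, (i : ℕ) + 1 = (j : ℕ) → v j ≤ 2 / Real.sqrt 3 * v i

/-- s_r(g): the largest index 1 ≤ i ≤ d−1 (1-based) with v_i > 2 c_d r, or 0. -/
def sVal (d : ℕ) (r : ℝ) (v : Fin d → ℝ) : ℕ :=
  sSup {s : ℕ | 1 ≤ s ∧ s ≤ d - 1 ∧ ∃ i : Fin d, (i : ℕ) + 1 = s ∧ 2 * cd' d * r < v i}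

/-- The function F_{R,η,r} expressed in the Siegel coordinates (v, b). -/
def Ffun (d : ℕ) (R η r : ℝ) (v b : Fin d → ℝ) : ℝ :=
  (if R ≤ ∏ i ∈ Finset.univ.filter (fun i : Fin d => (i : ℕ) < sVal d r v), v i
    then 1 else 0) *
  ∏ i ∈ Finset.univ.filter (fun i : Fin d => (i : ℕ) < sVal d r v),
    (v i ^ η * if |v i * b i| ≤ cd' d * r then 1 else 0)

/-- g' = (γ,m)·g for some (γ,m) ∈ Γ' = SL(d,ℤ) ⋉ ℤ^d, where group elements of
G' = SL(d,ℝ) ⋉ ℝ^d are represented as pairs (M,b) with (M,b)(M',b') = (MM', bM'+b'). -/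
def gammaRel (d : ℕ) (g g' : Matrix (Fin d) (Fin d) ℝ × (Fin d → ℝ)) : Prop :=
  ∃ (γ : Matrix (Fin d) (Fin d) ℤ) (m : Fin d → ℤ), γ.det = 1 ∧
    g'.1 = (γ.map fun x => (x : ℝ)) * g.1 ∧
    g'.2 = Matrix.vecMul (fun i => (m i : ℝ)) g.1 + g.2

/-- A measurable section of Γ'\G' into the Siegel set 𝒮', recorded through its
Iwasawa coordinates: `vc g` and `bc g` are the v- and b-coordinates of the Siegel
representative of Γ'g, for every g ∈ G'. -/
def IsSiegelSection (d : ℕ)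
    (vc bc : (Matrix (Fin d) (Fin d) ℝ × (Fin d → ℝ)) → (Fin d → ℝ)) : Prop :=
  Measurable (fun g : (Fin d → Fin d → ℝ) × (Fin d → ℝ) => vc (Matrix.of g.1, g.2)) ∧
  Measurable (fun g : (Fin d → Fin d → ℝ) × (Fin d → ℝ) => bc (Matrix.of g.1, g.2)) ∧
  ∀ g : Matrix (Fin d) (Fin d) ℝ × (Fin d → ℝ), g.1.det = 1 →
    SiegelV d (vc g) ∧ (∀ i, |bc g i| ≤ 1 / 2) ∧
    ∃ (u : Fin d → Fin d → ℝ) (k : Matrix (Fin d) (Fin d) ℝ),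
      (∀ i j : Fin d, i < j → |u i j| ≤ 1 / 2) ∧ k * kᵀ = 1 ∧ k.det = 1 ∧
      gammaRel d g
        (nMat d u * Matrix.diagonal (vc g) * k,
         Matrix.vecMul (bc g) (nMat d u * Matrix.diagonal (vc g) * k))

/-- The matrix ñ(y), with ones on the diagonal and first row (1, y). -/
def ntilde (d : ℕ) (y : Fin (d - 1) → ℝ) : Matrix (Fin d) (Fin d) ℝ :=
  Matrix.of fun i j =>
    if i = j then 1
    else if h : (i : ℕ) = 0 ∧ 1 ≤ (j : ℕ) then
      y ⟨(j : ℕ) - 1, by have := j.isLt; omega⟩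
    else 0

/-- The diagonal flow Φ_t. -/
def Phi (d : ℕ) (t : ℝ) : Matrix (Fin d) (Fin d) ℝ :=
  Matrix.diagonal fun i : Fin d =>
    if (i : ℕ) = 0 then Real.exp (-((d : ℝ) - 1) * t / d) else Real.exp (t / d)

/-- The element Γ'(1,ξ)(M₀ ñ(y) Φ_t, 0) represented in G' as a pair. -/
def gElt (d : ℕ) (ξ : Fin d → ℝ) (M0 : Matrix (Fin d) (Fin d) ℝ)
    (y : Fin (d - 1) → ℝ) (t : ℝ) : Matrix (Fin d) (Fin d) ℝ × (Fin d → ℝ) :=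
  (M0 * ntilde d y * Phi d t, Matrix.vecMul ξ (M0 * ntilde d y * Phi d t))

/-- π' : ℝ^d → ℝ^{d-1}, dropping the first coordinate. -/
def tail' {d : ℕ} (x : Fin d → ℝ) : Fin (d - 1) → ℝ :=
  fun i => x ⟨(i : ℕ) + 1, by have := i.isLt; omega⟩

/-- The lattice Λ = ℤ^d (M₀^{-1})ᵀ. -/
def Lam (d : ℕ) (M0 : Matrix (Fin d) (Fin d) ℝ) : Set (Fin d → ℝ) :=
  {x | ∃ m : Fin d → ℤ, x = Matrix.vecMul (fun i => (m i : ℝ)) (M0⁻¹)ᵀ}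

/-- Λ_k = ℛ_k ∩ Λ. Here `‖tail' x‖` is the sup norm |π'x|. -/
def LamK (d : ℕ) (M0 : Matrix (Fin d) (Fin d) ℝ) (k : ℤ) : Set (Fin d → ℝ) :=
  {x ∈ Lam d M0 | |head' x| < (2:ℝ) ^ (k + 2) ∧ (2:ℝ) ^ k ≤ ‖tail' x‖ ∧ ‖tail' x‖ < (2:ℝ) ^ (k + 1)}

/-- Norm of the wedge product via the Gram determinant. -/
def wedgeNorm {d n : ℕ} (x : Fin n → Fin d → ℝ) : ℝ :=
  Real.sqrt (Matrix.det (Matrix.of fun i j : Fin n => ∑ t, x i t * x j t))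

/-- Norm of the wedge of the first j vectors (empty wedge has norm 1). -/
def prefixWedge {d s : ℕ} (x : Fin s → Fin d → ℝ) (j : ℕ) : ℝ :=
  wedgeNorm fun i : Fin (min j s) => x ⟨(i : ℕ), by have := i.isLt; omega⟩

/-- The set Λ_k(p). -/
def LamKP (d s : ℕ) (M0 : Matrix (Fin d) (Fin d) ℝ) (k : Fin s → ℤ) (p : Fin s → ℕ) :
    Set (Fin s → Fin d → ℝ) :=
  {x | (∀ j, x j ∈ LamK d M0 (k j)) ∧
    ∀ j : Fin s,
      (2:ℝ) ^ (-(p j : ℤ) - 1) * enorm' (x j) * prefixWedge x (j : ℕ) < prefixWedge x ((j : ℕ) + 1) ∧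
      prefixWedge x ((j : ℕ) + 1) ≤ (2:ℝ) ^ (-(p j : ℤ)) * enorm' (x j) * prefixWedge x (j : ℕ)}

/-- Operator norm ‖M₀‖ of a matrix acting on Euclidean space. -/
def opNorm {d : ℕ} (M : Matrix (Fin d) (Fin d) ℝ) : ℝ :=
  ‖LinearMap.toContinuousLinearMap (Matrix.toEuclideanLin M)‖

/-- K₀ is the largest integer such that
{x ∈ Λ : |π₁x| < 2^{k+1}, |π'x| < 2^k} = ∅ for all k ≤ K₀. -/
def IsK0 (d : ℕ) (M0 : Matrix (Fin d) (Fin d) ℝ) (K0 : ℤ) : Prop :=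
  (∀ k : ℤ, k ≤ K0 → ¬ ∃ x ∈ Lam d M0, |head' x| < (2:ℝ) ^ (k + 1) ∧ ‖tail' x‖ < (2:ℝ) ^ k) ∧
  (∀ K' : ℤ, (∀ k : ℤ, k ≤ K' → ¬ ∃ x ∈ Lam d M0, |head' x| < (2:ℝ) ^ (k + 1) ∧ ‖tail' x‖ < (2:ℝ) ^ k) → K' ≤ K0)


open scoped RealInnerProductSpace

abbrev Ed (d : ℕ) := EuclideanSpace ℝ (Fin d)

/-- Surface measure on the unit sphere S^{d-1} ⊂ ℝ^d. -/
def sphSurf (d : ℕ) : Measure (Ed d) :=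
  (μH[(d : ℝ) - 1]).restrict (Metric.sphere (0 : Ed d) 1)

/-- λ has a continuous density with respect to the surface measure. -/
def HasContinuousDensity (d : ℕ) (lam : Measure (Ed d)) : Prop :=
  ∃ f : Ed d → ℝ, Continuous f ∧ (∀ x, 0 ≤ f x) ∧
    lam = (sphSurf d).withDensity (fun x => ENNReal.ofReal (f x))

/-- Matrix exponential (as the usual power series). -/
def matExp {d : ℕ} (B : Matrix (Fin d) (Fin d) ℝ) : Matrix (Fin d) (Fin d) ℝ :=
  ∑' n : ℕ, ((n.factorial : ℝ))⁻¹ • B ^ n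

/-- The vector y(υ) ∈ ℝ^{d-1} (stored in coordinates 1,…,d-1; y(±e₁) := 0). -/
def yMap (d : ℕ) (υ : Ed d) : Fin d → ℝ := fun i =>
  if (i : ℕ) = 0 then 0
  else if h : 0 < d then
    (if υ ⟨0, h⟩ = 1 ∨ υ ⟨0, h⟩ = -1 then 0
     else Real.arccos (υ ⟨0, h⟩) / Real.sqrt (1 - (υ ⟨0, h⟩) ^ 2) * υ i)
  else 0

/-- The rotation k(υ) = exp [[0, -y(υ)], [y(υ)ᵀ, 0]]. -/
def kMap (d : ℕ) (υ : Ed d) : Matrix (Fin d) (Fin d) ℝ :=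
  matExp (Matrix.of fun i j : Fin d =>
    if (i : ℕ) = 0 ∧ (j : ℕ) ≠ 0 then -(yMap d υ j)
    else if (i : ℕ) ≠ 0 ∧ (j : ℕ) = 0 then yMap d υ i
    else 0)

/-- The element Γ'(1,ξ)(M₀ k(υ) Φ_t, 0) represented in G' as a pair. -/
def gEltSph (d : ℕ) (ξ : Fin d → ℝ) (M0 : Matrix (Fin d) (Fin d) ℝ)
    (υ : Ed d) (t : ℝ) : Matrix (Fin d) (Fin d) ℝ × (Fin d → ℝ) :=
  (M0 * kMap d υ * Phi d t, Matrix.vecMul ξ (M0 * kMap d υ * Phi d t))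

/-- Proposition: no escape of mass for spherical averages:
lim_{R→∞} limsup_{t→∞} |∫_{S^{d-1}_+} F_{R,η,r}(Γ'(1,ξ)(M₀k(υ)Φ_t,0)) dλ(υ)| = 0
under (B1) or (B2). -/

lemma card_cramer {s : ℕ} (A : Matrix (Fin s) (Fin s) ℤ) (hA : A.det ≠ 0)
    (T : Finset (Fin s → ℤ))
    (hT : ∀ c ∈ T, ∀ j, |(A.updateCol j c).det| ≤ |A.det|) :
    T.card ≤ 3 ^ s * A.det.natAbs := by
  have hinj : Function.Injective (Matrix.mulVecLin A) := by
    rw [Matrix.coe_mulVecLin]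
    exact Matrix.mulVec_injective_of_det_ne_zero hA
  let Nn := LinearMap.range (Matrix.mulVecLin A)
  let e : (Fin s → ℤ) ≃ₗ[ℤ] Nn := LinearEquiv.ofInjective _ hinj
  have hidx := Submodule.natAbs_det_equiv Nn e
  have hdet : (LinearMap.det (Nn.subtype ∘ₗ AddMonoidHom.toIntLinearMap (e : (Fin s → ℤ) →+ Nn))) = A.det := by
    have : (Nn.subtype ∘ₗ AddMonoidHom.toIntLinearMap (e : (Fin s → ℤ) →+ Nn)) = Matrix.toLin' A := by
      ext x; rfl
    rw [this, LinearMap.det_toLin']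
  rw [hdet] at hidx
  have hpos : 0 < Nat.card ((Fin s → ℤ) ⧸ Nn) := by
    rw [← hidx]; exact Int.natAbs_pos.mpr hA
  have : Finite ((Fin s → ℤ) ⧸ Nn) := Nat.finite_of_card_ne_zero hpos.ne'
  let _ : Fintype ((Fin s → ℤ) ⧸ Nn) := Fintype.ofFinite _
  have hD : 0 < |A.det| := abs_pos.mpr hA
  let F : (Fin s → ℤ) → (Fin s → ℤ) × ((Fin s → ℤ) ⧸ Nn) :=
    fun c => (fun j => (A.updateCol j c).det / |A.det|, Submodule.Quotient.mk c)
  let U : Finset ((Fin s → ℤ) × ((Fin s → ℤ) ⧸ Nn)) :=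
    (Fintype.piFinset fun _ => Finset.Icc (-1 : ℤ) 1) ×ˢ Finset.univ
  have hcard : U.card = 3 ^ s * A.det.natAbs := by
    rw [Finset.card_product, Fintype.card_piFinset, Finset.card_univ, hidx,
      Nat.card_eq_fintype_card]
    simp
  rw [← hcard]
  refine Finset.card_le_card_of_injOn F ?_ ?_
  · intro c hc
    simp only [U, F, Finset.coe_product, Set.mem_prod, Finset.mem_coe, Fintype.mem_piFinset,
      Finset.mem_univ, and_true, Finset.mem_Icc]
    intro j
    have h := abs_le.mp (hT c hc j)
    constructor
    · rw [Int.le_ediv_iff_mul_le hD]; linarith [h.1]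
    · have : (A.updateCol j c).det / |A.det| ≤ |A.det| / |A.det| :=
        Int.ediv_le_ediv hD h.2
      rwa [Int.ediv_self hD.ne'] at this
  · intro c hc c' hc' hcc
    simp only [F, Prod.mk.injEq] at hcc
    obtain ⟨h1, h2⟩ := hcc
    rw [Submodule.Quotient.eq] at h2
    obtain ⟨n, hn⟩ := h2
    have hcr : ∀ j, (A.updateCol j c).det - (A.updateCol j c').det = A.det * n j := by
      intro j
      have e1 : A.cramer (c - c') = A.det • n := by
        rw [← hn, Matrix.mulVecLin_apply, Matrix.cramer_eq_adjugate_mulVec, Matrix.mulVec_mulVec,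
          Matrix.adjugate_mul, Matrix.smul_mulVec, Matrix.one_mulVec]
      have := congrFun e1 j
      rw [map_sub] at this
      simpa [Matrix.cramer_apply] using this
    have hn0 : n = 0 := by
      funext j
      have h3 := congrFun h1 j
      have a1 := Int.emod_add_mul_ediv (A.updateCol j c).det |A.det|
      have a2 := Int.emod_add_mul_ediv (A.updateCol j c').det |A.det|
      have b1 := Int.emod_nonneg (A.updateCol j c).det hD.ne'
      have b2 := Int.emod_nonneg (A.updateCol j c').det hD.ne'
      have b3 := Int.emod_lt_of_pos (A.updateCol j c).det hD
      have b4 := Int.emod_lt_of_pos (A.updateCol j c').det hD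
      rw [h3] at a1
      have h5 : |A.det * n j| < |A.det| := by
        rw [← hcr j, abs_lt]; constructor <;> linarith
      rw [abs_mul] at h5
      have h6 : |n j| < 1 := by
        by_contra hh
        push Not at hh
        nlinarith
      exact Int.abs_lt_one_iff.mp h6
    rw [hn0] at hn
    simp at hn
    exact (sub_eq_zero.mp hn.symm)

lemma sum_le_sigma {α β γ : Type*} (S : Finset α) (S' : Finset β) (T : β → Finset γ)
    (g : α → β) (h : α → γ) (hg : ∀ a ∈ S, g a ∈ S') (hh : ∀ a ∈ S, h a ∈ T (g a))
    (hinj : ∀ a ∈ S, ∀ b ∈ S, g a = g b → h a = h b → a = b)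
    (F : β → γ → ℝ) (hF : ∀ b c, 0 ≤ F b c) :
    ∑ a ∈ S, F (g a) (h a) ≤ ∑ b ∈ S', ∑ c ∈ T b, F b c := by
  rw [Finset.sum_sigma']
  have h1 : ∑ a ∈ S, F (g a) (h a) =
      ∑ x ∈ S.image (fun a => (⟨g a, h a⟩ : (_ : β) × γ)), F x.1 x.2 := by
    rw [Finset.sum_image]
    intro a ha b hb hab
    simp only [Sigma.mk.injEq, heq_eq_eq] at hab
    exact hinj a ha b hb hab.1 hab.2
  rw [h1]
  refine Finset.sum_le_sum_of_subset_of_nonneg ?_ (fun _ _ _ => hF _ _)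
  intro x hx
  obtain ⟨a, ha, rfl⟩ := Finset.mem_image.mp hx
  exact Finset.mem_sigma.mpr ⟨hg a ha, hh a ha⟩

lemma sum_sqrt_inv (N : ℕ) : ∑ n ∈ Finset.range N, ((n : ℝ) + 1) ^ (-(1/2) : ℝ) ≤ 2 * (N : ℝ) ^ (1/2 : ℝ) := by
  induction N with
  | zero => simp
  | succ k ih =>
    rw [Finset.sum_range_succ]
    have e1 : ((k : ℝ) + 1) ^ (-(1/2) : ℝ) = (Real.sqrt ((k : ℝ) + 1))⁻¹ := by
      rw [Real.rpow_neg (by positivity), ← Real.sqrt_eq_rpow]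
    rw [← Real.sqrt_eq_rpow] at ih ⊢
    rw [e1]
    push_cast
    have h1 : 0 < Real.sqrt ((k : ℝ) + 1) := Real.sqrt_pos.mpr (by positivity)
    have h2 : 0 ≤ Real.sqrt (k : ℝ) := Real.sqrt_nonneg _
    have s1 := Real.sq_sqrt (show (0:ℝ) ≤ (k : ℝ) + 1 by positivity)
    have s2 := Real.sq_sqrt (show (0:ℝ) ≤ (k : ℝ) by positivity)
    have : (Real.sqrt ((k : ℝ) + 1))⁻¹ ≤ 2 * Real.sqrt ((k : ℝ) + 1) - 2 * Real.sqrt k := by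
      rw [inv_le_iff_one_le_mul₀ h1]
      nlinarith [sq_nonneg (Real.sqrt ((k : ℝ) + 1) - Real.sqrt k)]
    linarith

lemma sum_rpow_inv (α : ℝ) (h0 : 0 ≤ α) (h1 : α ≤ 1/2) (N : ℕ) (hN : 1 ≤ N) :
    ∑ n ∈ Finset.range N, ((n : ℝ) + 1) ^ (-α) ≤ 2 * (N : ℝ) ^ (1 - α) := by
  have hNp : (0:ℝ) < N := by exact_mod_cast hN
  have : ∀ n ∈ Finset.range N, ((n : ℝ) + 1) ^ (-α) ≤
      (N : ℝ) ^ (1/2 - α) * ((n : ℝ) + 1) ^ (-(1/2) : ℝ) := by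
    intro n hn
    have hn' : (n : ℝ) + 1 ≤ N := by exact_mod_cast Finset.mem_range.mp hn
    have e : ((n : ℝ) + 1) ^ (-α) = ((n : ℝ) + 1) ^ (1/2 - α) * ((n : ℝ) + 1) ^ (-(1/2) : ℝ) := by
      rw [← Real.rpow_add (by positivity)]; congr 1; ring
    rw [e]
    gcongr
  refine (Finset.sum_le_sum this).trans ?_
  rw [← Finset.mul_sum]
  calc _ ≤ (N : ℝ) ^ (1/2 - α) * (2 * (N : ℝ) ^ (1/2 : ℝ)) := by
        gcongr; exact sum_sqrt_inv N
    _ = 2 * ((N : ℝ) ^ (1/2 - α) * (N : ℝ) ^ (1/2 : ℝ)) := by ring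
    _ = _ := by rw [← Real.rpow_add hNp]; congr 2; ring


lemma sum_int_rpow (α : ℝ) (h0 : 0 ≤ α) (h1 : α ≤ 1/2) (N : ℕ) (hN : 1 ≤ N) :
    ∑ b ∈ (Finset.Icc (-(N:ℤ)) N).filter (fun b => b ≠ 0), |(b : ℝ)| ^ (-α) ≤ 4 * (N : ℝ) ^ (1 - α) := by
  have h := sum_le_sigma ((Finset.Icc (-(N:ℤ)) N).filter (fun b => b ≠ 0)) (Finset.univ : Finset Bool)
    (fun _ => Finset.range N) (fun b => decide (0 < b)) (fun b => b.natAbs - 1)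
    (fun _ _ => Finset.mem_univ _)
    (by
      intro a ha
      simp only [Finset.mem_filter, Finset.mem_Icc] at ha
      simp only [Finset.mem_range]
      omega)
    (by
      intro a ha b hb h2 h3
      simp only [Finset.mem_filter, Finset.mem_Icc] at ha hb
      simp only [decide_eq_decide] at h2
      omega)
    (fun _ n => ((n : ℝ) + 1) ^ (-α)) (fun _ _ => by positivity)
  have e : ∑ b ∈ (Finset.Icc (-(N:ℤ)) N).filter (fun b => b ≠ 0), |(b : ℝ)| ^ (-α) =
      ∑ b ∈ (Finset.Icc (-(N:ℤ)) N).filter (fun b => b ≠ 0), (((b.natAbs - 1 : ℕ) : ℝ) + 1) ^ (-α) := by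
    refine Finset.sum_congr rfl fun b hb => ?_
    simp only [Finset.mem_filter] at hb
    congr 1
    have : 1 ≤ b.natAbs := Int.natAbs_pos.mpr hb.2
    rw [Nat.cast_sub this, Nat.cast_natAbs]
    push_cast; ring
  rw [e]
  refine h.trans ?_
  have := sum_rpow_inv α h0 h1 N hN
  simp only [Fintype.sum_bool]
  linarith

lemma sum_affine (α : ℝ) (h0 : 0 ≤ α) (h1 : α ≤ 1/2) (N : ℕ) (hN : 1 ≤ N) (ν β : ℤ) (hν : ν ≠ 0) :
    ∑ a ∈ (Finset.Icc (-(N:ℤ)) N).filter (fun a => ν * a + β ≠ 0), |((ν * a + β : ℤ) : ℝ)| ^ (-α) ≤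
      1 + 14 * (|(ν:ℝ)| ^ (-α) * (N : ℝ) ^ (1 - α)) := by
  have hNp : (0:ℝ) < N := by exact_mod_cast hN
  have hνp : (0:ℝ) < |(ν:ℝ)| := abs_pos.mpr (by exact_mod_cast hν)
  set a0 : ℤ := round (-(β:ℝ) / ν) with ha0
  have key : ∀ a : ℤ, ν * a + β ≠ 0 → |((ν * a + β : ℤ) : ℝ)| ^ (-α) ≤
      (if a = a0 then 1 else 0) + 2 * |(ν:ℝ)| ^ (-α) * ((N:ℝ) ^ (-α) +
        if (a - a0 ∈ (Finset.Icc (-(N:ℤ)) N).filter (fun b => b ≠ 0)) then |((a - a0 : ℤ) : ℝ)| ^ (-α) else 0) := by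
    intro a ha
    have hge1 : (1:ℝ) ≤ |((ν * a + β : ℤ) : ℝ)| := by
      exact_mod_cast Int.one_le_abs ha
    by_cases haa : a = a0
    · rw [if_pos haa]
      have : |((ν * a + β : ℤ) : ℝ)| ^ (-α) ≤ 1 := Real.rpow_le_one_of_one_le_of_nonpos hge1 (by linarith)
      refine this.trans ?_
      have : (0:ℝ) ≤ 2 * |(ν:ℝ)| ^ (-α) * ((N:ℝ) ^ (-α) +
        if (a - a0 ∈ (Finset.Icc (-(N:ℤ)) N).filter (fun b => b ≠ 0)) then |((a - a0 : ℤ) : ℝ)| ^ (-α) else 0) := by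
        split_ifs <;> positivity
      linarith
    · rw [if_neg haa, zero_add]
      have hb1 : (1:ℝ) ≤ |((a - a0 : ℤ) : ℝ)| := by exact_mod_cast Int.one_le_abs (sub_ne_zero.mpr haa)
      have hr := abs_sub_round (-(β:ℝ) / ν)
      rw [← ha0] at hr
      have hν' : (ν:ℝ) ≠ 0 := by exact_mod_cast hν
      have hbig : |(ν:ℝ)| * (|((a - a0 : ℤ) : ℝ)| / 2) ≤ |((ν * a + β : ℤ) : ℝ)| := by
        have e : ((ν * a + β : ℤ) : ℝ) = ν * (((a - a0 : ℤ) : ℝ) - (-(β:ℝ)/ν - a0)) := by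
          push_cast; field_simp; ring
        rw [e, abs_mul]
        gcongr
        have := abs_sub_abs_le_abs_sub (((a - a0 : ℤ) : ℝ)) (-(β:ℝ)/ν - a0)
        linarith
      have h2 : |((ν * a + β : ℤ) : ℝ)| ^ (-α) ≤ 2 * |(ν:ℝ)| ^ (-α) * |((a - a0 : ℤ) : ℝ)| ^ (-α) := by
        calc _ ≤ (|(ν:ℝ)| * (|((a - a0 : ℤ) : ℝ)| / 2)) ^ (-α) :=
              Real.rpow_le_rpow_of_nonpos (by positivity) hbig (by linarith)
          _ = |(ν:ℝ)| ^ (-α) * (|((a - a0 : ℤ) : ℝ)| ^ (-α) * (2:ℝ)^α) := by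
              rw [Real.mul_rpow (by positivity) (by positivity), Real.div_rpow (by positivity) (by positivity),
                Real.rpow_neg (by norm_num : (0:ℝ) ≤ 2)]
              field_simp
          _ ≤ |(ν:ℝ)| ^ (-α) * (|((a - a0 : ℤ) : ℝ)| ^ (-α) * 2) := by
              gcongr
              calc (2:ℝ)^α ≤ 2 ^ (1:ℝ) := Real.rpow_le_rpow_of_exponent_le (by norm_num) (by linarith)
                _ = 2 := by simp
          _ = _ := by ring
      refine h2.trans ?_
      gcongr
      split_ifs with hin
      · have : (0:ℝ) ≤ (N:ℝ)^(-α) := by positivity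
        linarith
      · rw [add_zero]
        apply Real.rpow_le_rpow_of_nonpos hNp _ (by linarith)
        simp only [Finset.mem_filter, Finset.mem_Icc, not_and_or, not_not] at hin
        have : (N:ℤ) ≤ |a - a0| := by
          rcases hin with (h | h) | h
          · rw [le_abs]; right; omega
          · rw [le_abs]; left; omega
          · omega
        exact_mod_cast this
  refine (Finset.sum_le_sum (fun a ha => key a (Finset.mem_filter.mp ha).2)).trans ?_
  have hsub : ∀ a ∈ Finset.Icc (-(N:ℤ)) N, (0:ℝ) ≤ (if a = a0 then 1 else 0) + 2 * |(ν:ℝ)| ^ (-α) * ((N:ℝ) ^ (-α) +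
        if (a - a0 ∈ (Finset.Icc (-(N:ℤ)) N).filter (fun b => b ≠ 0)) then |((a - a0 : ℤ) : ℝ)| ^ (-α) else 0) := by
    intro a _
    split_ifs <;> positivity
  refine (Finset.sum_le_sum_of_subset_of_nonneg (Finset.filter_subset _ _) (fun a ha _ => hsub a ha)).trans ?_
  rw [Finset.sum_add_distrib, ← Finset.mul_sum, Finset.sum_add_distrib]
  have p1 : ∑ a ∈ Finset.Icc (-(N:ℤ)) N, (if a = a0 then (1:ℝ) else 0) ≤ 1 := by
    rw [Finset.sum_ite_eq']; split_ifs <;> norm_num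
  have p2 : ∑ a ∈ Finset.Icc (-(N:ℤ)) N, (N:ℝ) ^ (-α) ≤ 3 * (N:ℝ) ^ (1 - α) := by
    rw [Finset.sum_const, nsmul_eq_mul]
    have : ((Finset.Icc (-(N:ℤ)) N).card : ℝ) ≤ 3 * N := by
      rw [Int.card_Icc]
      have : ((N:ℤ) + 1 - -(N:ℤ)).toNat ≤ 3 * N := by omega
      exact_mod_cast this
    have e : (N:ℝ) ^ (1 - α) = N * (N:ℝ)^(-α) := by
      rw [sub_eq_add_neg, Real.rpow_add hNp, Real.rpow_one]
    rw [e]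
    nlinarith [Real.rpow_nonneg hNp.le (-α)]
  have p3 : ∑ a ∈ Finset.Icc (-(N:ℤ)) N, (if (a - a0 ∈ (Finset.Icc (-(N:ℤ)) N).filter (fun b => b ≠ 0)) then |((a - a0 : ℤ) : ℝ)| ^ (-α) else 0) ≤ 4 * (N : ℝ) ^ (1 - α) := by
    rw [← Finset.sum_filter]
    refine le_trans ?_ (sum_int_rpow α h0 h1 N hN)
    rw [← Finset.sum_image (f := fun b : ℤ => |(b:ℝ)| ^ (-α)) (g := fun a => a - a0)]
    · refine Finset.sum_le_sum_of_subset_of_nonneg ?_ (fun _ _ _ => by positivity)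
      intro x hx
      obtain ⟨a, ha, rfl⟩ := Finset.mem_image.mp hx
      exact (Finset.mem_filter.mp ha).2
    · intro a _ b _ h; simpa using h
  have hνn : 0 ≤ |(ν:ℝ)| ^ (-α) := by positivity
  nlinarith [mul_le_mul_of_nonneg_left (add_le_add p2 p3) hνn]


noncomputable def qbox {s : ℕ} (ι : Type) [Fintype ι] [DecidableEq ι] (N : Fin s → ℕ) : Finset (Fin s → ι → ℤ) :=
  Fintype.piFinset fun i => Fintype.piFinset fun _ => Finset.Icc (-(N i : ℤ)) (N i)

lemma sum_biUnion_le' {α β : Type*} [DecidableEq β] (S : Finset α) (t : α → Finset β) (f : β → ℝ) (hf : ∀ x, 0 ≤ f x) :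
    ∑ x ∈ S.biUnion t, f x ≤ ∑ i ∈ S, ∑ x ∈ t i, f x := by
  induction S using Finset.induction_on with
  | empty => simp
  | insert a S ha ih =>
    rw [Finset.biUnion_insert, Finset.sum_insert ha]
    have := Finset.sum_union_inter (s₁ := t a) (s₂ := S.biUnion t) (f := f)
    have h2 : 0 ≤ ∑ x ∈ t a ∩ S.biUnion t, f x := Finset.sum_nonneg fun x _ => hf x
    linarith

lemma mem_qbox {s : ℕ} {ι : Type} [Fintype ι] [DecidableEq ι] {N : Fin s → ℕ} {q : Fin s → ι → ℤ} :
    q ∈ qbox ι N ↔ ∀ i j, |q i j| ≤ N i := by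
  simp [qbox, Fintype.mem_piFinset, abs_le]

lemma card_Icc_le (N : ℕ) (hN : 1 ≤ N) : ((Finset.Icc (-(N:ℤ)) N).card : ℝ) ≤ 3 * N := by
  rw [Int.card_Icc]
  have : ((N:ℤ) + 1 - -(N:ℤ)).toNat ≤ 3 * N := by omega
  exact_mod_cast this

lemma card_qbox {s : ℕ} (ι : Type) [Fintype ι] [DecidableEq ι] (N : Fin s → ℕ) (hN : ∀ i, 1 ≤ N i) :
    ((qbox ι N).card : ℝ) ≤ (3:ℝ) ^ (Fintype.card ι * s) * ∏ i, (N i : ℝ) ^ (Fintype.card ι) := by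
  rw [qbox, Fintype.card_piFinset]
  push_cast
  calc _ ≤ ∏ i : Fin s, (3 * (N i:ℝ)) ^ (Fintype.card ι) := by
        refine Finset.prod_le_prod (fun _ _ => by positivity) fun i _ => ?_
        rw [Fintype.card_piFinset, Finset.prod_const, Finset.card_univ]
        push_cast
        exact pow_le_pow_left₀ (by positivity) (card_Icc_le _ (hN i)) _
    _ = _ := by
        simp_rw [mul_pow]
        rw [Finset.prod_mul_distrib, Finset.prod_const, Finset.card_univ, Fintype.card_fin, pow_mul]

/-- rebuild a matrix -/
def recM {s : ℕ} (l : Fin (s+1)) (b : (Fin s → Fin s → ℤ) × (Fin s → ℤ) × (Fin s → ℤ)) (a : ℤ) :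
    Matrix (Fin (s+1)) (Fin (s+1)) ℤ :=
  Matrix.of (Fin.snoc (α := fun _ => Fin (s+1) → ℤ) (fun i => Fin.insertNth (α := fun _ => ℤ) l (b.2.1 i) (b.1 i))
    (Fin.insertNth (α := fun _ => ℤ) l a b.2.2))

lemma det_recM {s : ℕ} (l : Fin (s+1)) (b : (Fin s → Fin s → ℤ) × (Fin s → ℤ) × (Fin s → ℤ)) :
    ∃ ν β : ℤ, |ν| = |(Matrix.of b.1).det| ∧ ∀ a, (recM l b a).det = ν * a + β := by
  refine ⟨(-1) ^ ((Fin.last s : ℕ) + (l : ℕ)) * (Matrix.of b.1).det,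
    ∑ j : Fin s, (-1) ^ ((Fin.last s : ℕ) + (l.succAbove j : ℕ)) * b.2.2 j *
      ((recM l b 0).submatrix (Fin.last s).succAbove (l.succAbove j).succAbove).det, ?_, ?_⟩
  · rw [abs_mul, abs_pow]; simp
  · intro a
    rw [Matrix.det_succ_row _ (Fin.last s), Fin.sum_univ_succAbove _ l]
    congr 1
    · have e1 : recM l b a (Fin.last s) l = a := by simp [recM]
      have e2 : (recM l b a).submatrix (Fin.last s).succAbove l.succAbove = Matrix.of b.1 := by
        ext i j; simp [recM]
      rw [e1, e2]; ring
    · refine Finset.sum_congr rfl fun j _ => ?_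
      have e1 : recM l b a (Fin.last s) (l.succAbove j) = b.2.2 j := by simp [recM]
      have e2 : (recM l b a).submatrix (Fin.last s).succAbove (l.succAbove j).succAbove =
        (recM l b 0).submatrix (Fin.last s).succAbove (l.succAbove j).succAbove := by
        ext i j; simp [recM]
      rw [e1, e2]

def splitM {s : ℕ} (l : Fin (s+1)) (A : Fin (s+1) → Fin (s+1) → ℤ) :
    (Fin s → Fin s → ℤ) × (Fin s → ℤ) × (Fin s → ℤ) :=
  (fun i j => A i.castSucc (l.succAbove j), fun i => A i.castSucc l, fun j => A (Fin.last s) (l.succAbove j))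

lemma rec_split {s : ℕ} (l : Fin (s+1)) (A : Fin (s+1) → Fin (s+1) → ℤ) :
    recM l (splitM l A) (A (Fin.last s) l) = Matrix.of A := by
  ext i j
  refine Fin.lastCases ?_ (fun i => ?_) i
  · rcases Fin.eq_self_or_eq_succAbove l j with rfl | ⟨j, rfl⟩ <;> simp [recM, splitM]
  · rcases Fin.eq_self_or_eq_succAbove l j with rfl | ⟨j, rfl⟩ <;> simp [recM, splitM]

set_option maxHeartbeats 800000 in
lemma momentD (α : ℝ) (h0 : 0 ≤ α) (h1 : α ≤ 1/2) (K : ℝ) (hK : 1 ≤ K) (s : ℕ) (hs : α * s ≤ 1) :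
    ∃ C : ℝ, 0 ≤ C ∧ ∀ N : Fin s → ℕ, (∀ i, 1 ≤ N i) → (∀ i j, i ≤ j → (N i : ℝ) ≤ K * N j) →
      ∑ A ∈ (qbox (Fin s) N).filter (fun A => (Matrix.of A).det ≠ 0), |((Matrix.of A).det : ℝ)| ^ (-α) ≤
        C * ∏ i, (N i : ℝ) ^ ((s : ℝ) - α) := by
  induction s with
  | zero =>
    refine ⟨1, by norm_num, fun N _ _ => ?_⟩
    refine (Finset.sum_le_sum_of_subset_of_nonneg (Finset.filter_subset _ _) (fun _ _ _ => by positivity)).trans ?_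
    simp [qbox]
  | succ s ih =>
    obtain ⟨C, hC, hind⟩ := ih (by push_cast at hs; nlinarith)
    refine ⟨(s+1) * ((3:ℝ)^s * 3^s * (3^(s*s) * K + 14 * C)), by positivity, fun N hN hNK => ?_⟩
    set P : ℝ := ∏ i : Fin s, (N i.castSucc : ℝ) with hP
    set X : ℝ := (N (Fin.last s) : ℝ) with hX
    have hXp : 1 ≤ X := by rw [hX]; exact_mod_cast hN _
    have hPp : 0 < P := Finset.prod_pos fun i _ => by exact_mod_cast hN _
    have hprod : ∏ i, (N i : ℝ) ^ (((s+1:ℕ) : ℝ) - α) = P ^ ((s:ℝ) + 1 - α) * X ^ ((s:ℝ) + 1 - α) := by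
      rw [Fin.prod_univ_castSucc, Real.finsetProd_rpow _ _ (fun _ _ => by positivity)]
      push_cast; rfl
    rw [hprod]
    -- each l
    have hl : ∀ l : Fin (s+1), ∑ A ∈ (qbox (Fin (s+1)) N).filter (fun A => (Matrix.of A).det ≠ 0 ∧
          (Matrix.of (splitM l A).1).det ≠ 0), |((Matrix.of A).det : ℝ)| ^ (-α) ≤
        ((3:ℝ)^s * 3^s * (3^(s*s) * K + 14 * C)) * (P ^ ((s:ℝ) + 1 - α) * X ^ ((s:ℝ) + 1 - α)) := by
      intro l
      let colS : Finset (Fin s → ℤ) := Fintype.piFinset fun i : Fin s => Finset.Icc (-(N i.castSucc : ℤ)) (N i.castSucc)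
      let rowS : Finset (Fin s → ℤ) := Fintype.piFinset fun i : Fin s => Finset.Icc (-(N (Fin.last s) : ℤ)) (N (Fin.last s))
      let BS := (qbox (Fin s) (fun i => N i.castSucc)).filter (fun A => (Matrix.of A).det ≠ 0)
      have hs1 := sum_le_sigma ((qbox (Fin (s+1)) N).filter (fun A => (Matrix.of A).det ≠ 0 ∧
          (Matrix.of (splitM l A).1).det ≠ 0)) (BS ×ˢ colS ×ˢ rowS)
        (fun b => (Finset.Icc (-(N (Fin.last s):ℤ)) (N (Fin.last s))).filter (fun a => (recM l b a).det ≠ 0))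
        (splitM l) (fun A => A (Fin.last s) l)
        (by
          intro A hA
          simp only [Finset.mem_filter, mem_qbox] at hA
          simp only [Finset.mem_product, BS, colS, rowS, Finset.mem_filter, mem_qbox, Fintype.mem_piFinset,
            Finset.mem_Icc, ← abs_le]
          exact ⟨⟨fun i j => hA.1 _ _, hA.2.2⟩, fun i => hA.1 _ _, fun i => hA.1 _ _⟩)
        (by
          intro A hA
          simp only [Finset.mem_filter, mem_qbox] at hA
          simp only [Finset.mem_filter, Finset.mem_Icc, ← abs_le]
          rw [rec_split]
          exact ⟨hA.1 _ _, hA.2.1⟩)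
        (by
          intro A _ B _ h2 h3
          have e1 := rec_split l A
          rw [h2, h3, rec_split] at e1
          exact (Matrix.of.injective e1).symm)
        (fun b a => |((recM l b a).det : ℝ)| ^ (-α)) (fun _ _ => by positivity)
      simp only [rec_split] at hs1
      refine hs1.trans ?_
      have hin : ∀ b ∈ BS ×ˢ colS ×ˢ rowS, ∑ a ∈ (Finset.Icc (-(N (Fin.last s):ℤ)) (N (Fin.last s))).filter
          (fun a => (recM l b a).det ≠ 0), |((recM l b a).det : ℝ)| ^ (-α) ≤
          1 + 14 * (|((Matrix.of b.1).det : ℝ)| ^ (-α) * X ^ (1 - α)) := by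
        intro b hb
        obtain ⟨ν, β, hν, hab⟩ := det_recM l b
        simp only [hab]
        have hdet : (Matrix.of b.1).det ≠ 0 := (Finset.mem_filter.mp (Finset.mem_product.mp hb).1).2
        have hν0 : ν ≠ 0 := by rw [← abs_pos, hν, abs_pos]; exact hdet
        have := sum_affine α h0 h1 (N (Fin.last s)) (hN _) ν β hν0
        have hνr : |(ν:ℝ)| = |((Matrix.of b.1).det : ℝ)| := by exact_mod_cast hν
        rw [hνr] at this
        exact this
      refine (Finset.sum_le_sum hin).trans ?_
      rw [Finset.sum_product]
      simp only [Finset.sum_const, nsmul_eq_mul]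
      rw [← Finset.mul_sum, Finset.sum_add_distrib, ← Finset.mul_sum, ← Finset.sum_mul]
      have hcol : ((colS ×ˢ rowS).card : ℝ) ≤ (3^s * P) * (3^s * X^s) := by
        rw [Finset.card_product]
        push_cast
        gcongr
        · rw [Fintype.card_piFinset]
          push_cast
          rw [hP]
          calc _ ≤ ∏ i : Fin s, (3 * (N i.castSucc : ℝ)) :=
                Finset.prod_le_prod (fun _ _ => by positivity) fun i _ => card_Icc_le _ (hN _)
            _ = _ := by simp [Finset.prod_mul_distrib]
        · rw [Fintype.card_piFinset, Finset.prod_const, Finset.card_univ, Fintype.card_fin]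
          push_cast
          rw [← mul_pow]
          exact pow_le_pow_left₀ (by positivity) (card_Icc_le _ (hN _)) _
      have hB1 : ∑ b ∈ BS, (1:ℝ) ≤ 3^(s*s) * P^s := by
        rw [Finset.sum_const, nsmul_eq_mul, mul_one]
        calc ((BS.card : ℕ) : ℝ) ≤ ((qbox (Fin s) (fun i => N i.castSucc)).card : ℝ) := by
              exact_mod_cast Finset.card_filter_le _ _
          _ ≤ _ := card_qbox _ _ (fun i => hN _)
          _ = _ := by rw [Fintype.card_fin, hP, Finset.prod_pow]
      have hB2 : ∑ b ∈ BS, |((Matrix.of b).det : ℝ)| ^ (-α) ≤ C * P ^ ((s:ℝ) - α) := by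
        have := hind (fun i => N i.castSucc) (fun i => hN _) (fun i j hij => hNK _ _ (by simpa using hij))
        rwa [Real.finsetProd_rpow _ _ (fun _ _ => by positivity)] at this
      have hkey : P ^ α * X ^ α ≤ K * X := by
        have hPX : P * X ≤ (K * X) ^ (s+1) := by
          rw [pow_succ]
          gcongr
          · rw [hP]
            calc _ ≤ ∏ i : Fin s, (K * X) := Finset.prod_le_prod (fun _ _ => by positivity)
                  fun i _ => hNK _ _ (Fin.le_last _)
              _ = _ := by simp
          · nlinarith
        rw [← Real.mul_rpow hPp.le (by positivity)]
        calc (P * X) ^ α ≤ ((K * X) ^ (s+1)) ^ α := Real.rpow_le_rpow (by positivity) hPX h0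
          _ = (K * X) ^ (((s+1:ℕ):ℝ) * α) := by rw [← Real.rpow_natCast, ← Real.rpow_mul (by positivity)]
          _ ≤ (K * X) ^ (1:ℝ) := Real.rpow_le_rpow_of_exponent_le (by nlinarith) (by linarith)
          _ = K * X := by simp
      have eP : P ^ ((s:ℝ) + 1 - α) * P ^ α = P ^ s * P := by
        rw [← Real.rpow_add hPp, ← pow_succ, ← Real.rpow_natCast]; congr 1; push_cast; ring
      have eX : X ^ ((s:ℝ) + 1 - α) * X ^ α = X ^ s * X := by
        rw [← Real.rpow_add (by positivity), ← pow_succ, ← Real.rpow_natCast]; congr 1; push_cast; ring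
      have eP2 : P ^ ((s:ℝ) + 1 - α) = P ^ ((s:ℝ) - α) * P := by
        rw [← Real.rpow_add_one hPp.ne']; congr 1; ring
      have eX2 : X ^ ((s:ℝ) + 1 - α) = X ^ (1 - α) * X ^ s := by
        rw [← Real.rpow_natCast, ← Real.rpow_add (by positivity)]; congr 1; ring
      have hfirst : P ^ s * P * X ^ s ≤ K * (P ^ ((s:ℝ) + 1 - α) * X ^ ((s:ℝ) + 1 - α)) := by
        have hpos : 0 < P ^ α * X ^ α := by positivity
        have : P ^ s * P * X ^ s * X ≤ K * (P ^ ((s:ℝ) + 1 - α) * X ^ ((s:ℝ) + 1 - α)) * X := by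
          calc P ^ s * P * X ^ s * X = (P ^ ((s:ℝ) + 1 - α) * X ^ ((s:ℝ) + 1 - α)) * (P ^ α * X ^ α) := by
                rw [mul_mul_mul_comm, eP, eX]; ring
            _ ≤ (P ^ ((s:ℝ) + 1 - α) * X ^ ((s:ℝ) + 1 - α)) * (K * X) := by gcongr
            _ = _ := by ring
        exact le_of_mul_le_mul_right this (by positivity)
      calc _ ≤ ((3^s * P) * (3^s * X^s)) * (3^(s*s) * P^s + 14 * (C * P ^ ((s:ℝ) - α) * X ^ (1 - α))) := by
            gcongr
        _ = 3^s * 3^s * (3^(s*s) * (P ^ s * P * X ^ s) + 14 * C * ((P ^ ((s:ℝ) - α) * P) * (X ^ (1 - α) * X ^ s))) := by ring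
        _ = 3^s * 3^s * (3^(s*s) * (P ^ s * P * X ^ s) + 14 * C * (P ^ ((s:ℝ) + 1 - α) * X ^ ((s:ℝ) + 1 - α))) := by
            rw [← eP2, ← eX2]
        _ ≤ 3^s * 3^s * (3^(s*s) * (K * (P ^ ((s:ℝ) + 1 - α) * X ^ ((s:ℝ) + 1 - α))) + 14 * C * (P ^ ((s:ℝ) + 1 - α) * X ^ ((s:ℝ) + 1 - α))) := by
            gcongr
        _ = _ := by ring
    -- combine
    have hcov : (qbox (Fin (s+1)) N).filter (fun A => (Matrix.of A).det ≠ 0) ⊆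
        Finset.univ.biUnion (fun l : Fin (s+1) => (qbox (Fin (s+1)) N).filter (fun A => (Matrix.of A).det ≠ 0 ∧
          (Matrix.of (splitM l A).1).det ≠ 0)) := by
      intro A hA
      simp only [Finset.mem_filter] at hA
      simp only [Finset.mem_biUnion, Finset.mem_filter, Finset.mem_univ, true_and]
      by_contra hcon
      push Not at hcon
      apply hA.2
      rw [Matrix.det_succ_row _ (Fin.last s)]
      refine Finset.sum_eq_zero fun l _ => ?_
      have := hcon l hA.1 hA.2
      have e2 : (Matrix.of A).submatrix (Fin.last s).succAbove l.succAbove = Matrix.of (splitM l A).1 := by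
        ext i j; simp [splitM]
      rw [e2, this, mul_zero]
    refine (Finset.sum_le_sum_of_subset_of_nonneg hcov (fun _ _ _ => Real.rpow_nonneg (abs_nonneg _) _)).trans ?_
    refine (sum_biUnion_le' _ _ _ (fun _ => Real.rpow_nonneg (abs_nonneg _) _)).trans ?_
    refine (Finset.sum_le_sum fun l _ => hl l).trans ?_
    rw [Finset.sum_const, Finset.card_univ, Fintype.card_fin, nsmul_eq_mul]
    push_cast
    exact le_of_eq (by ring)


def mJ {s d : ℕ} (q : Fin s → Fin d → ℤ) (J : Fin s → Fin d) : Matrix (Fin s) (Fin s) ℤ :=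
  Matrix.of (fun i j => q i (J j))

def Dq {s d : ℕ} (q : Fin s → Fin d → ℤ) : ℕ :=
  (Finset.univ : Finset (Fin s → Fin d)).sup (fun J => (mJ q J).det.natAbs)

lemma le_Dq {s d : ℕ} (q : Fin s → Fin d → ℤ) (J : Fin s → Fin d) : (mJ q J).det.natAbs ≤ Dq q :=
  Finset.le_sup (f := fun J => (mJ q J).det.natAbs) (Finset.mem_univ J)

lemma exists_Dq {s d : ℕ} (q : Fin s → Fin d → ℤ) (h : Dq q ≠ 0) :
    ∃ J : Fin s → Fin d, (mJ q J).det.natAbs = Dq q := by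
  have hne : (Finset.univ : Finset (Fin s → Fin d)).Nonempty := by
    by_contra hc
    rw [Finset.not_nonempty_iff_eq_empty] at hc
    apply h
    rw [Dq, hc, Finset.sup_empty]; rfl
  obtain ⟨J, _, hJ⟩ := Finset.exists_mem_eq_sup _ hne (fun J => (mJ q J).det.natAbs)
  exact ⟨J, hJ.symm⟩

lemma mJ_inj {s d : ℕ} (q : Fin s → Fin d → ℤ) (J : Fin s → Fin d) (h : (mJ q J).det ≠ 0) :
    Function.Injective J := by
  intro a b hab
  by_contra hne
  apply h
  exact Matrix.det_zero_of_column_eq hne (fun k => by simp [mJ, hab])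

set_option maxHeartbeats 800000 in
lemma moment_Jl (d s : ℕ) (hsd : s < d) (α : ℝ) (N : Fin s → ℕ) (hN : ∀ i, 1 ≤ N i)
    (J : Fin s → Fin d) (hJ : Function.Injective J) (l : Fin d) (hl : ∀ i, J i ≠ l) (C : ℝ) (hC : 0 ≤ C)
    (hmom : ∑ A ∈ (qbox (Fin s) N).filter (fun A => (Matrix.of A).det ≠ 0), |((Matrix.of A).det : ℝ)| ^ (-α) ≤
        C * ∏ i, (N i : ℝ) ^ ((s : ℝ) - α)) :
    ∑ q ∈ (qbox (Fin d) N).filter (fun q => Dq q ≠ 0 ∧ (mJ q J).det.natAbs = Dq q), (Dq q : ℝ) ^ (-1-α) ≤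
      (3^s * 3^((d-s-1) * s) * C) * ∏ i, (N i : ℝ) ^ ((d : ℝ) - 1 - α) := by
  let U : Finset (Fin d) := insert l (Finset.univ.image J)
  have hlU : l ∉ Finset.univ.image J := by simpa using hl
  have hUc : Uᶜ.card = d - s - 1 := by
    rw [Finset.card_compl, Finset.card_insert_of_notMem hlU, Finset.card_image_of_injective _ hJ]
    simp; omega
  let ι : Type := {j : Fin d // j ∈ Uᶜ}
  have hcι : Fintype.card ι = d - s - 1 := by rw [← hUc]; exact Fintype.card_coe _
  have hmem : ∀ j : Fin d, j ∈ Uᶜ ∨ j = l ∨ ∃ i, J i = j := by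
    intro j
    by_cases h : j ∈ U
    · right; simpa [U] using h
    · left; simpa using h
  let BS := (qbox (Fin s) N).filter (fun A => (Matrix.of A).det ≠ 0)
  let T : (Fin s → Fin s → ℤ) × (Fin s → ι → ℤ) → Finset (Fin s → ℤ) := fun b =>
    (Fintype.piFinset fun i => Finset.Icc (-(N i : ℤ)) (N i)).filter
      (fun c => ∀ j, |((Matrix.of b.1).updateCol j c).det| ≤ |(Matrix.of b.1).det|)
  have h1 := sum_le_sigma ((qbox (Fin d) N).filter (fun q => Dq q ≠ 0 ∧ (mJ q J).det.natAbs = Dq q))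
    (BS ×ˢ qbox ι N) T (fun q => (fun i j => q i (J j), fun i j => q i j.1)) (fun q i => q i l)
    (by
      intro q hq
      simp only [Finset.mem_filter, mem_qbox] at hq
      simp only [Finset.mem_product, BS, Finset.mem_filter, mem_qbox]
      refine ⟨⟨fun i j => hq.1 _ _, ?_⟩, fun i j => hq.1 _ _⟩
      have h2 : (mJ q J).det.natAbs ≠ 0 := by rw [hq.2.2]; exact hq.2.1
      exact Int.natAbs_ne_zero.mp h2)
    (by
      intro q hq
      simp only [Finset.mem_filter, mem_qbox] at hq
      simp only [T, Finset.mem_filter, Fintype.mem_piFinset, Finset.mem_Icc, ← abs_le]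
      refine ⟨fun i => hq.1 _ _, fun j => ?_⟩
      have e : (Matrix.of fun i j => q i (J j)).updateCol j (fun i => q i l) = mJ q (Function.update J j l) := by
        ext i k
        by_cases hk : k = j
        · subst hk; simp [mJ]
        · simp [mJ, hk]
      rw [e, Int.abs_eq_natAbs, Int.abs_eq_natAbs]
      have := le_Dq q (Function.update J j l)
      rw [← hq.2.2] at this
      exact_mod_cast this)
    (by
      intro a _ b _ h2 h3
      simp only [Prod.mk.injEq] at h2
      ext i j
      rcases hmem j with hj | rfl | ⟨k, rfl⟩
      · exact congrFun (congrFun h2.2 i) ⟨j, hj⟩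
      · exact congrFun h3 i
      · exact congrFun (congrFun h2.1 i) k)
    (fun b _ => |((Matrix.of b.1).det : ℝ)| ^ (-1-α)) (fun _ _ => Real.rpow_nonneg (abs_nonneg _) _)
  have h0 : ∑ q ∈ (qbox (Fin d) N).filter (fun q => Dq q ≠ 0 ∧ (mJ q J).det.natAbs = Dq q), (Dq q : ℝ) ^ (-1-α)
      = ∑ q ∈ (qbox (Fin d) N).filter (fun q => Dq q ≠ 0 ∧ (mJ q J).det.natAbs = Dq q),
        |((Matrix.of (fun i j => q i (J j))).det : ℝ)| ^ (-1-α) := by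
    refine Finset.sum_congr rfl fun q hq => ?_
    rw [← (Finset.mem_filter.mp hq).2.2, Nat.cast_natAbs, Int.cast_abs]
    rfl
  rw [h0]
  refine h1.trans ?_
  have h2 : ∀ b ∈ BS ×ˢ qbox ι N, ∑ c ∈ T b, |((Matrix.of b.1).det : ℝ)| ^ (-1-α) ≤
      3^s * |((Matrix.of b.1).det : ℝ)| ^ (-α) := by
    intro b hb
    have hdet : (Matrix.of b.1).det ≠ 0 := (Finset.mem_filter.mp (Finset.mem_product.mp hb).1).2
    have hpos : 0 < |((Matrix.of b.1).det : ℝ)| := abs_pos.mpr (by exact_mod_cast hdet)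
    rw [Finset.sum_const, nsmul_eq_mul]
    have hc := card_cramer (Matrix.of b.1) hdet (T b) (fun c hc => (Finset.mem_filter.mp hc).2)
    have hc' : ((T b).card : ℝ) ≤ 3^s * |((Matrix.of b.1).det : ℝ)| := by
      have : ((T b).card : ℝ) ≤ ((3^s * (Matrix.of b.1).det.natAbs : ℕ) : ℝ) := by exact_mod_cast hc
      rwa [Nat.cast_mul, Nat.cast_natAbs, Int.cast_abs, Nat.cast_pow, Nat.cast_ofNat] at this
    have e : |((Matrix.of b.1).det : ℝ)| ^ (-α) = |((Matrix.of b.1).det : ℝ)| * |((Matrix.of b.1).det : ℝ)| ^ (-1-α) := by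
      nth_rewrite 2 [← Real.rpow_one (|((Matrix.of b.1).det : ℝ)|)]
      rw [← Real.rpow_add hpos]; congr 1; ring
    rw [e, ← mul_assoc]
    exact mul_le_mul_of_nonneg_right hc' (Real.rpow_nonneg (abs_nonneg _) _)
  refine (Finset.sum_le_sum h2).trans ?_
  rw [Finset.sum_product]
  simp only [Finset.sum_const, nsmul_eq_mul]
  rw [← Finset.mul_sum, ← Finset.mul_sum]
  have h3 := card_qbox ι N hN
  rw [hcι] at h3
  have hpr : (∏ i, (N i : ℝ) ^ (d - s - 1)) * ∏ i, (N i : ℝ) ^ ((s : ℝ) - α) = ∏ i, (N i : ℝ) ^ ((d : ℝ) - 1 - α) := by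
    rw [← Finset.prod_mul_distrib]
    refine Finset.prod_congr rfl fun i _ => ?_
    have : (0:ℝ) < N i := by exact_mod_cast hN i
    rw [← Real.rpow_natCast, ← Real.rpow_add this]
    congr 1
    have : d - s - 1 = d - (s+1) := by omega
    rw [this, Nat.cast_sub (by omega)]
    push_cast; ring
  calc _ ≤ ((3:ℝ) ^ ((d-s-1) * s) * ∏ i, (N i : ℝ) ^ (d-s-1)) * (3^s * (C * ∏ i, (N i : ℝ) ^ ((s : ℝ) - α))) := by
        gcongr
    _ = (3^s * 3^((d-s-1) * s) * C) * ((∏ i, (N i : ℝ) ^ (d - s - 1)) * ∏ i, (N i : ℝ) ^ ((s : ℝ) - α)) := by ring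
    _ = _ := by rw [hpr]

lemma moment2 (d s : ℕ) (hsd : s < d) (α : ℝ) (h0 : 0 ≤ α) (h1 : α ≤ 1/2) (K : ℝ) (hK : 1 ≤ K) (hs : α * s ≤ 1) :
    ∃ C : ℝ, 0 ≤ C ∧ ∀ N : Fin s → ℕ, (∀ i, 1 ≤ N i) → (∀ i j, i ≤ j → (N i : ℝ) ≤ K * N j) →
      ∑ q ∈ (qbox (Fin d) N).filter (fun q => Dq q ≠ 0), (Dq q : ℝ) ^ (-1-α) ≤
        C * ∏ i, (N i : ℝ) ^ ((d : ℝ) - 1 - α) := by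
  obtain ⟨C, hC, hm⟩ := momentD α h0 h1 K hK s hs
  refine ⟨(Fintype.card (Fin s → Fin d)) * (3^s * 3^((d-s-1) * s) * C), by positivity, fun N hN hNK => ?_⟩
  have hcov : (qbox (Fin d) N).filter (fun q => Dq q ≠ 0) ⊆
      ((Finset.univ : Finset (Fin s → Fin d))).biUnion
        (fun J => (qbox (Fin d) N).filter (fun q => Dq q ≠ 0 ∧ (mJ q J).det.natAbs = Dq q)) := by
    intro q hq
    simp only [Finset.mem_filter] at hq
    obtain ⟨J, hJ⟩ := exists_Dq q hq.2
    simp only [Finset.mem_biUnion, Finset.mem_filter, Finset.mem_univ, true_and]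
    exact ⟨J, hq.1, hq.2, hJ⟩
  refine (Finset.sum_le_sum_of_subset_of_nonneg hcov (fun _ _ _ => Real.rpow_nonneg (Nat.cast_nonneg _) _)).trans ?_
  refine (sum_biUnion_le' _ _ _ (fun _ => Real.rpow_nonneg (Nat.cast_nonneg _) _)).trans ?_
  have hb : ∀ J ∈ (Finset.univ : Finset (Fin s → Fin d)),
      ∑ q ∈ (qbox (Fin d) N).filter (fun q => Dq q ≠ 0 ∧ (mJ q J).det.natAbs = Dq q), (Dq q : ℝ) ^ (-1-α) ≤
      (3^s * 3^((d-s-1) * s) * C) * ∏ i, (N i : ℝ) ^ ((d : ℝ) - 1 - α) := by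
    intro J _
    by_cases hJ : Function.Injective J
    · have : ∃ l, ∀ i, J i ≠ l := by
        by_contra hcon
        push Not at hcon
        have hsur : Function.Surjective J := hcon
        have := Fintype.card_le_of_surjective J hsur
        simp at this; omega
      obtain ⟨l, hl⟩ := this
      exact moment_Jl d s hsd α N hN J hJ l hl C hC (hm N hN hNK)
    · rw [Finset.filter_false_of_mem]
      · simp only [Finset.sum_empty]; positivity
      · rintro q _ ⟨h1, h2⟩
        apply hJ
        apply mJ_inj q J
        rw [← h2] at h1
        exact Int.natAbs_ne_zero.mp h1
  refine (Finset.sum_le_sum hb).trans ?_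
  rw [Finset.sum_const, Finset.card_univ, nsmul_eq_mul]
  exact le_of_eq (by ring)

/-- cell counting of separated sets -/
lemma card_sep {d : ℕ} (N Z : ℕ) (hZ : 1 ≤ Z) (hZN : Z ≤ N) (Q : Finset (Fin d → ℤ))
    (hQ : ∀ q ∈ Q, ∀ j, |q j| ≤ N)
    (hsep : ∀ q ∈ Q, ∀ q' ∈ Q, q ≠ q' → ∃ j, (Z : ℤ) ≤ |q j - q' j|) :
    (Q.card : ℝ) ≤ 4 ^ d * ((N : ℝ) / Z) ^ d := by
  have hZp : (0:ℤ) < Z := by exact_mod_cast hZ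
  let B : Finset (Fin d → ℤ) := Fintype.piFinset fun _ => Finset.Icc (-((N / Z : ℕ):ℤ) - 1) ((N / Z : ℕ):ℤ)
  have hc : Q.card ≤ B.card := by
    refine Finset.card_le_card_of_injOn (fun q j => q j / Z) ?_ ?_
    · intro q hq
      simp only [B, Finset.mem_coe, Fintype.mem_piFinset, Finset.mem_Icc]
      intro j
      have := abs_le.mp (hQ q hq j)
      push_cast
      refine ⟨?_, Int.ediv_le_ediv hZp this.2⟩
      rw [Int.le_ediv_iff_mul_le hZp]
      have h4 : (N:ℤ) < ((N:ℤ) / Z + 1) * Z := Int.lt_ediv_add_one_mul_self _ hZp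
      nlinarith
    · intro q hq q' hq' heq
      by_contra hne
      obtain ⟨j, hj⟩ := hsep q hq q' hq' hne
      have h5 : q j / Z = q' j / Z := congrFun heq j
      have h1 := Int.emod_add_mul_ediv (q j) Z
      have h2 := Int.emod_add_mul_ediv (q' j) Z
      have h3 := Int.emod_nonneg (q j) hZp.ne'
      have h4 := Int.emod_lt_of_pos (q j) hZp
      have h6 := Int.emod_nonneg (q' j) hZp.ne'
      have h7 := Int.emod_lt_of_pos (q' j) hZp
      rw [h5] at h1
      have : |q j - q' j| < Z := by
        rw [abs_lt]; constructor <;> linarith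
      linarith
  have hB : (B.card : ℝ) ≤ (4 * ((N : ℝ) / Z)) ^ d := by
    simp only [B]
    rw [Fintype.card_piFinset, Finset.prod_const, Finset.card_univ, Fintype.card_fin]
    push_cast
    refine pow_le_pow_left₀ (by positivity) ?_ _
    rw [Int.card_Icc]
    have h1 : 1 ≤ N / Z := Nat.div_pos hZN (by omega)
    have h2 : (((N / Z : ℕ):ℤ) + 1 - (-((N / Z : ℕ):ℤ) - 1)).toNat ≤ 4 * (N / Z) := by omega
    have h3 : ((N / Z : ℕ) : ℝ) ≤ (N:ℝ) / Z := Nat.cast_div_le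
    calc _ ≤ ((4 * (N / Z) : ℕ) : ℝ) := by exact_mod_cast h2
      _ ≤ _ := by push_cast; linarith
  rw [← mul_pow]
  exact le_trans (by exact_mod_cast hc) hB

lemma lemS (d s : ℕ) (hd : 3 ≤ d) (hsd : s < d) (K : ℝ) (hK : 1 ≤ K) :
    ∃ C : ℝ, 0 ≤ C ∧ ∀ (N Z : Fin s → ℕ) (Q : Fin s → Finset (Fin d → ℤ)), (∀ i, 1 ≤ Z i) → (∀ i, Z i ≤ N i) →
      (∀ i j, i ≤ j → (N i : ℝ) ≤ K * N j) → (∀ i, ∀ q ∈ Q i, ∀ j, |q j| ≤ N i) →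
      (∀ i, ∀ q ∈ Q i, ∀ q' ∈ Q i, q ≠ q' → ∃ j, (Z i : ℤ) ≤ |q j - q' j|) →
      ∑ q ∈ (Fintype.piFinset Q).filter (fun q => Dq q ≠ 0), (Dq q : ℝ)⁻¹ ≤
        C * ∏ i, ((N i : ℝ) ^ (d-1) * (Z i : ℝ)⁻¹) := by
  have hd1 : (2:ℝ) ≤ (d:ℝ) - 1 := by
    have : (3:ℝ) ≤ d := by exact_mod_cast hd
    linarith
  set α : ℝ := 1 / ((d:ℝ) - 1) with hα
  have h0 : 0 ≤ α := by positivity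
  have h1 : α ≤ 1/2 := one_div_le_one_div_of_le (by norm_num) hd1
  have hs : α * s ≤ 1 := by
    rw [hα, div_mul_eq_mul_div, one_mul, div_le_one (by linarith)]
    have : (s:ℝ) + 1 ≤ d := by exact_mod_cast hsd
    linarith
  obtain ⟨C, hC, hm⟩ := moment2 d s hsd α h0 h1 K hK hs
  refine ⟨(4^d)^s + C, by positivity, fun N Z Q hZ hZN hNK hQ hsep => ?_⟩
  have hN : ∀ i, 1 ≤ N i := fun i => (hZ i).trans (hZN i)
  have hNr : ∀ i, (0:ℝ) < N i := fun i => by exact_mod_cast hN i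
  have hZr : ∀ i, (0:ℝ) < Z i := fun i => by exact_mod_cast hZ i
  set θ : ℝ := ∏ i, ((N i : ℝ) / (Z i : ℝ) ^ (d-1)) with hθ
  have hθp : 0 < θ := Finset.prod_pos fun i _ => div_pos (hNr i) (pow_pos (hZr i) _)
  have hpt : ∀ q ∈ (Fintype.piFinset Q).filter (fun q => Dq q ≠ 0), (Dq q : ℝ)⁻¹ ≤
      θ⁻¹ + θ ^ α * (Dq q : ℝ) ^ (-1-α) := by
    intro q hq
    have hD : (0:ℝ) < Dq q := by
      have := (Finset.mem_filter.mp hq).2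
      exact_mod_cast Nat.pos_of_ne_zero this
    have hx : 0 ≤ θ ^ α * (Dq q : ℝ) ^ (-1-α) := by positivity
    rcases le_total θ (Dq q) with h | h
    · have := inv_anti₀ hθp h
      linarith
    · have e : (Dq q : ℝ)⁻¹ = (Dq q : ℝ) ^ α * (Dq q : ℝ) ^ (-1-α) := by
        rw [← Real.rpow_add hD, ← Real.rpow_neg_one]; congr 1; ring
      have : (Dq q : ℝ) ^ α ≤ θ ^ α := Real.rpow_le_rpow hD.le h h0
      have h3 : (Dq q : ℝ) ^ α * (Dq q : ℝ) ^ (-1-α) ≤ θ ^ α * (Dq q : ℝ) ^ (-1-α) := by gcongr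
      have : 0 < θ⁻¹ := by positivity
      linarith
  refine (Finset.sum_le_sum hpt).trans ?_
  rw [Finset.sum_add_distrib, add_mul]
  refine add_le_add ?_ ?_
  · rw [Finset.sum_const, nsmul_eq_mul]
    have hc : ((((Fintype.piFinset Q).filter (fun q => Dq q ≠ 0)).card : ℕ) : ℝ) ≤
        ∏ i : Fin s, (4 ^ d * ((N i : ℝ) / Z i) ^ d) := by
      calc _ ≤ ((Fintype.piFinset Q).card : ℝ) := by exact_mod_cast Finset.card_filter_le _ _
        _ = ∏ i, ((Q i).card : ℝ) := by rw [Fintype.card_piFinset]; push_cast; rfl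
        _ ≤ _ := Finset.prod_le_prod (fun _ _ => by positivity)
            fun i _ => card_sep (N i) (Z i) (hZ i) (hZN i) (Q i) (hQ i) (hsep i)
    refine (mul_le_mul_of_nonneg_right hc (by positivity)).trans (le_of_eq ?_)
    rw [hθ, ← Finset.prod_inv_distrib, Finset.prod_mul_distrib, Finset.prod_const, Finset.card_univ,
      Fintype.card_fin, mul_assoc, ← Finset.prod_mul_distrib]
    congr 1
    refine Finset.prod_congr rfl fun i _ => ?_
    obtain ⟨e, rfl⟩ : ∃ e, d = e + 1 := ⟨d - 1, by omega⟩
    have := (hNr i).ne'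
    have := (hZr i).ne'
    simp only [Nat.add_sub_cancel]
    rw [div_pow, pow_succ, pow_succ]
    field_simp
  · rw [← Finset.mul_sum]
    have hsub : (Fintype.piFinset Q).filter (fun q => Dq q ≠ 0) ⊆ (qbox (Fin d) N).filter (fun q => Dq q ≠ 0) := by
      intro q hq
      simp only [Finset.mem_filter, Fintype.mem_piFinset] at hq
      simp only [Finset.mem_filter, mem_qbox]
      exact ⟨fun i j => hQ i _ (hq.1 i) j, hq.2⟩
    have h3 := (Finset.sum_le_sum_of_subset_of_nonneg hsub (f := fun q => (Dq q : ℝ) ^ (-1-α))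
      (fun _ _ _ => Real.rpow_nonneg (Nat.cast_nonneg _) _)).trans (hm N hN hNK)
    refine (mul_le_mul_of_nonneg_left h3 (by positivity)).trans (le_of_eq ?_)
    rw [mul_left_comm]
    congr 1
    rw [hθ, ← Real.finsetProd_rpow _ _ (fun i _ => by positivity), ← Finset.prod_mul_distrib]
    refine Finset.prod_congr rfl fun i _ => ?_
    rw [Real.div_rpow (hNr i).le (by positivity), div_mul_eq_mul_div, ← Real.rpow_add (hNr i),
      ← Real.rpow_natCast, ← Real.rpow_mul (hZr i).le, ← Real.rpow_natCast]
    have e1 : ((d - 1 : ℕ) : ℝ) = (d:ℝ) - 1 := by rw [Nat.cast_sub (by omega)]; simp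
    rw [e1, hα, mul_one_div_cancel (by linarith), Real.rpow_one, div_eq_mul_inv]
    congr 2; ring


lemma sum_g (M : ℕ) (hM : 1 ≤ M) :
    ∑ a ∈ Finset.Icc (-(2*M:ℤ)) (2*M), (max 1 |(a:ℝ)|) ^ (-(1/2) : ℝ) ≤ 9 * (M:ℝ) ^ (1/2 : ℝ) := by
  have h := sum_int_rpow (1/2) (by norm_num) le_rfl (2*M) (by omega)
  push_cast at h
  rw [← Finset.sum_filter_add_sum_filter_not _ (fun a : ℤ => a ≠ 0)]
  have h1 : ∑ a ∈ (Finset.Icc (-(2*M:ℤ)) (2*M)).filter (fun a : ℤ => a ≠ 0), (max 1 |(a:ℝ)|) ^ (-(1/2) : ℝ) =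
      ∑ a ∈ (Finset.Icc (-(2*M:ℤ)) (2*M)).filter (fun a : ℤ => a ≠ 0), |(a:ℝ)| ^ (-(1/2) : ℝ) := by
    refine Finset.sum_congr rfl fun a ha => ?_
    have : 1 ≤ |a| := Int.one_le_abs (Finset.mem_filter.mp ha).2
    rw [max_eq_right (by exact_mod_cast this)]
  have h2 : ∑ a ∈ (Finset.Icc (-(2*M:ℤ)) (2*M)).filter (fun a : ℤ => ¬ a ≠ 0), (max 1 |(a:ℝ)|) ^ (-(1/2) : ℝ) ≤ 1 := by
    have : (Finset.Icc (-(2*M:ℤ)) (2*M)).filter (fun a : ℤ => ¬ a ≠ 0) ⊆ {0} := by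
      intro a ha
      simpa using (Finset.mem_filter.mp ha).2
    refine (Finset.sum_le_sum_of_subset_of_nonneg this (fun _ _ _ => by positivity)).trans ?_
    simp
  rw [h1]
  have h3 : ((2:ℝ) * M) ^ (1 - 1/2 : ℝ) ≤ 2 * (M:ℝ) ^ (1/2 : ℝ) := by
    rw [Real.mul_rpow (by norm_num) (by positivity)]
    have : (2:ℝ) ^ (1 - 1/2 : ℝ) ≤ 2 ^ (1:ℝ) := Real.rpow_le_rpow_of_exponent_le (by norm_num) (by norm_num)
    rw [Real.rpow_one] at this
    norm_num at this ⊢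
    gcongr
  have h4 : 1 ≤ (M:ℝ) ^ (1/2 : ℝ) := Real.one_le_rpow (by exact_mod_cast hM) (by norm_num)
  linarith

lemma lemS2 (N Z : Fin 1 → ℕ) (Q : Fin 1 → Finset (Fin 2 → ℤ)) (hZ : ∀ i, 1 ≤ Z i) (hZN : ∀ i, Z i ≤ N i)
    (hQ : ∀ i, ∀ q ∈ Q i, ∀ j, |q j| ≤ N i)
    (hsep : ∀ i, ∀ q ∈ Q i, ∀ q' ∈ Q i, q ≠ q' → ∃ j, (Z i : ℤ) ≤ |q j - q' j|)
    (hnz : ∀ i, ∀ q ∈ Q i, q ≠ 0 → ∃ j, (Z i : ℤ) ≤ |q j|) :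
    ∑ q ∈ (Fintype.piFinset Q).filter (fun q => Dq q ≠ 0), (Dq q : ℝ)⁻¹ ≤
        162 * ∏ i, ((N i : ℝ) ^ (2-1) * ((Z i : ℝ)⁻¹) ^ 2) := by
  have hZp : (0:ℤ) < Z 0 := by exact_mod_cast hZ 0
  have hZr : (0:ℝ) < Z 0 := by exact_mod_cast hZ 0
  have hZ1 : (1:ℝ) ≤ Z 0 := by exact_mod_cast hZ 0
  set M : ℕ := N 0 / Z 0 with hMdef
  have hM : 1 ≤ M := Nat.div_pos (hZN 0) (by have := hZ 0; omega)
  let I := Finset.Icc (-(2*M:ℤ)) (2*M)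
  let g : ℤ → ℝ := fun a => (max 1 |(a:ℝ)|) ^ (-(1/2) : ℝ)
  have hg : ∀ a, 0 ≤ g a := fun a => by positivity
  have hdet : ∀ (q : Fin 1 → Fin 2 → ℤ) (J : Fin 1 → Fin 2), (mJ q J).det = q 0 (J 0) := by
    intro q J; simp [mJ]
  have hDge : ∀ (q : Fin 1 → Fin 2 → ℤ) j, |(q 0 j : ℝ)| ≤ Dq q := by
    intro q j
    have := le_Dq q (fun _ => j)
    rw [hdet] at this
    rw [← Int.cast_abs, Int.abs_eq_natAbs]
    exact_mod_cast this
  have hmemI : ∀ q ∈ Fintype.piFinset Q, ∀ j, q 0 j / (Z 0 : ℤ) ∈ I := by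
    intro q hq j
    have := abs_le.mp (hQ 0 (q 0) (Fintype.mem_piFinset.mp hq 0) j)
    have hM1 : (1:ℤ) ≤ M := by exact_mod_cast hM
    have e : (M:ℤ) = (N 0 : ℤ) / Z 0 := by rw [hMdef]; push_cast; rfl
    simp only [I, Finset.mem_Icc]
    constructor
    · rw [Int.le_ediv_iff_mul_le hZp]
      have h4 : (N 0:ℤ) < ((N 0:ℤ) / Z 0 + 1) * Z 0 := Int.lt_ediv_add_one_mul_self _ hZp
      rw [← e] at h4
      nlinarith
    · have := Int.ediv_le_ediv hZp this.2
      rw [← e] at this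
      linarith
  have hpt : ∀ q ∈ (Fintype.piFinset Q).filter (fun q => Dq q ≠ 0), (Dq q : ℝ)⁻¹ ≤
      2 / (Z 0 : ℝ) * (g (q 0 0 / (Z 0 : ℤ)) * g (q 0 1 / (Z 0 : ℤ))) := by
    intro q hq
    obtain ⟨hq1, hq2⟩ := Finset.mem_filter.mp hq
    have hq0 : q 0 ≠ 0 := by
      intro h0
      obtain ⟨J, hJ⟩ := exists_Dq q hq2
      rw [hdet, h0] at hJ
      simp at hJ
      exact hq2 hJ.symm
    have hDZ : (Z 0 : ℝ) ≤ Dq q := by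
      obtain ⟨j, hj⟩ := hnz 0 (q 0) (Fintype.mem_piFinset.mp hq1 0) hq0
      refine le_trans ?_ (hDge q j)
      exact_mod_cast hj
    have hDp : (0:ℝ) < Dq q := by linarith
    set X : ℝ := 2 * Dq q / Z 0 with hX
    have hXp : 0 < X := by positivity
    have hb : ∀ j, max 1 |((q 0 j / (Z 0 : ℤ) : ℤ) : ℝ)| ≤ X := by
      intro j
      have h1 : 1 ≤ (Dq q : ℝ) / Z 0 := by rwa [le_div_iff₀ hZr, one_mul]
      have e : X = (Dq q : ℝ) / Z 0 + Dq q / Z 0 := by rw [hX]; ring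
      have h2 := abs_le.mp (hDge q j)
      have h3 : ((q 0 j / (Z 0 : ℤ) : ℤ) : ℝ) * Z 0 ≤ q 0 j := by exact_mod_cast Int.ediv_mul_le _ hZp.ne'
      have h4 : (q 0 j : ℝ) < (((q 0 j / (Z 0 : ℤ) : ℤ) : ℝ) + 1) * Z 0 := by
        exact_mod_cast Int.lt_ediv_add_one_mul_self (q 0 j) hZp
      refine max_le (by linarith) (abs_le.mpr ⟨?_, ?_⟩)
      · have : -((Dq q : ℝ) / Z 0) ≤ ((q 0 j / (Z 0 : ℤ) : ℤ) : ℝ) + 1 := by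
          rw [← neg_div, div_le_iff₀ hZr]; linarith
        linarith
      · have : ((q 0 j / (Z 0 : ℤ) : ℤ) : ℝ) ≤ (Dq q : ℝ) / Z 0 := by
          rw [le_div_iff₀ hZr]; linarith
        linarith
    have hgb : ∀ j, X ^ (-(1/2) : ℝ) ≤ g (q 0 j / (Z 0 : ℤ)) := fun j =>
      Real.rpow_le_rpow_of_nonpos (by positivity) (hb j) (by norm_num)
    have e : (Dq q : ℝ)⁻¹ = 2 / (Z 0 : ℝ) * (X ^ (-(1/2) : ℝ) * X ^ (-(1/2) : ℝ)) := by
      rw [← Real.rpow_add hXp]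
      norm_num
      rw [Real.rpow_neg_one, hX]
      field_simp
    rw [e]
    have h5 : 0 ≤ X ^ (-(1/2) : ℝ) := by positivity
    have := mul_le_mul (hgb 0) (hgb 1) h5 (hg _)
    gcongr
  refine (Finset.sum_le_sum hpt).trans ?_
  have h1 := sum_le_sigma ((Fintype.piFinset Q).filter (fun q => Dq q ≠ 0)) I (fun _ => I)
    (fun q => q 0 0 / (Z 0 : ℤ)) (fun q => q 0 1 / (Z 0 : ℤ))
    (fun q hq => hmemI q (Finset.mem_filter.mp hq).1 0) (fun q hq => hmemI q (Finset.mem_filter.mp hq).1 1)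
    (by
      intro a ha b hb h2 h3
      have ha1 := Fintype.mem_piFinset.mp (Finset.mem_filter.mp ha).1 0
      have hb1 := Fintype.mem_piFinset.mp (Finset.mem_filter.mp hb).1 0
      by_contra hne
      have hne' : a 0 ≠ b 0 := by
        intro h; apply hne; funext i; rw [Subsingleton.elim i 0, h]
      obtain ⟨j, hj⟩ := hsep 0 _ ha1 _ hb1 hne'
      have h5 : a 0 j / (Z 0:ℤ) = b 0 j / (Z 0:ℤ) := by fin_cases j; exacts [h2, h3]
      have e1 := Int.emod_add_mul_ediv (a 0 j) (Z 0)
      have e2 := Int.emod_add_mul_ediv (b 0 j) (Z 0)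
      have e3 := Int.emod_nonneg (a 0 j) hZp.ne'
      have e4 := Int.emod_lt_of_pos (a 0 j) hZp
      have e6 := Int.emod_nonneg (b 0 j) hZp.ne'
      have e7 := Int.emod_lt_of_pos (b 0 j) hZp
      rw [h5] at e1
      have : |a 0 j - b 0 j| < Z 0 := by
        rw [abs_lt]; constructor <;> linarith
      linarith)
    (fun a b => 2 / (Z 0 : ℝ) * (g a * g b)) (fun a b => mul_nonneg (by positivity) (mul_nonneg (hg a) (hg b)))
  refine h1.trans ?_
  simp_rw [← Finset.mul_sum]
  rw [← Finset.sum_mul]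
  have h2 : ∑ a ∈ I, g a ≤ 9 * (M:ℝ) ^ (1/2 : ℝ) := sum_g M hM
  have h3 : (∑ a ∈ I, g a) * (∑ a ∈ I, g a) ≤ (9 * (M:ℝ) ^ (1/2 : ℝ)) * (9 * (M:ℝ) ^ (1/2 : ℝ)) :=
    mul_le_mul h2 h2 (Finset.sum_nonneg fun a _ => hg a) (by positivity)
  have h4 : (M:ℝ) ^ (1/2 : ℝ) * (M:ℝ) ^ (1/2 : ℝ) = M := by
    rw [← Real.sqrt_eq_rpow]; exact Real.mul_self_sqrt (by positivity)
  have h5 : (M:ℝ) ≤ N 0 / Z 0 := Nat.cast_div_le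
  have h6 : (∑ a ∈ I, g a) * (∑ a ∈ I, g a) ≤ 81 * ((N 0:ℝ) / Z 0) := by nlinarith
  simp only [Finset.univ_unique, Fin.default_eq_zero, Finset.prod_singleton, Nat.add_one_sub_one, pow_one]
  calc _ ≤ 2 / (Z 0 : ℝ) * (81 * ((N 0:ℝ) / Z 0)) := by gcongr
    _ = _ := by field_simp; ring

def eExp (d : ℕ) : ℕ := if d = 2 then 2 else 1

lemma lemCount (d s : ℕ) (hd : 2 ≤ d) (hs1 : 1 ≤ s) (hsd : s < d) (K : ℝ) (hK : 1 ≤ K) :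
    ∃ C : ℝ, 0 ≤ C ∧ ∀ (N Z : Fin s → ℕ) (Q : Fin s → Finset (Fin d → ℤ)), (∀ i, 1 ≤ Z i) → (∀ i, Z i ≤ N i) →
      (∀ i j, i ≤ j → (N i : ℝ) ≤ K * N j) → (∀ i, ∀ q ∈ Q i, ∀ j, |q j| ≤ N i) →
      (∀ i, ∀ q ∈ Q i, ∀ q' ∈ Q i, q ≠ q' → ∃ j, (Z i : ℤ) ≤ |q j - q' j|) →
      (∀ i, ∀ q ∈ Q i, q ≠ 0 → ∃ j, (Z i : ℤ) ≤ |q j|) →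
      ∑ q ∈ (Fintype.piFinset Q).filter (fun q => Dq q ≠ 0), (Dq q : ℝ)⁻¹ ≤
        C * ∏ i, ((N i : ℝ) ^ (d-1) * ((Z i : ℝ)⁻¹) ^ eExp d) := by
  rcases eq_or_lt_of_le hd with h | h
  · subst h
    obtain rfl : s = 1 := by omega
    refine ⟨162, by norm_num, fun N Z Q hZ hZN _ hQ hsep hnz => ?_⟩
    simpa [eExp] using lemS2 N Z Q hZ hZN hQ hsep hnz
  · obtain ⟨C, hC, hm⟩ := lemS d s h hsd K hK
    refine ⟨C, hC, fun N Z Q hZ hZN hNK hQ hsep _ => ?_⟩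
    have e : eExp d = 1 := by rw [eExp, if_neg]; omega
    rw [e]
    simpa using hm N Z Q hZ hZN hNK hQ hsep


noncomputable def ell {d : ℕ} (M : Matrix (Fin d) (Fin d) ℝ) (q : Fin d → ℤ) (x : Fin d → ℝ) : ℝ :=
  ∑ j, (q j : ℝ) * (M *ᵥ x) j

lemma ell_smul {d : ℕ} (M : Matrix (Fin d) (Fin d) ℝ) (q : Fin d → ℤ) (c : ℝ) (x : Fin d → ℝ) :
    ell M q (c • x) = c * ell M q x := by
  simp only [ell, Matrix.mulVec_smul, Pi.smul_apply, smul_eq_mul, Finset.mul_sum]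
  exact Finset.sum_congr rfl fun _ _ => by ring

lemma continuous_ell {d : ℕ} (M : Matrix (Fin d) (Fin d) ℝ) (q : Fin d → ℤ) : Continuous (ell M q) := by
  unfold ell; fun_prop

noncomputable def mSum {d : ℕ} (M : Matrix (Fin d) (Fin d) ℝ) : ℝ := 1 + ∑ i, ∑ j, |M i j|

lemma one_le_mSum {d : ℕ} (M : Matrix (Fin d) (Fin d) ℝ) : 1 ≤ mSum M := by
  have : 0 ≤ ∑ i, ∑ j, |M i j| := by positivity
  rw [mSum]; linarith

lemma mulVec_le {d : ℕ} (M : Matrix (Fin d) (Fin d) ℝ) (x : Fin d → ℝ) (ρ : ℝ) (hρ : 0 ≤ ρ) (hx : ∀ i, |x i| ≤ ρ)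
    (a : Fin d) : |(M *ᵥ x) a| ≤ mSum M * ρ := by
  rw [Matrix.mulVec, dotProduct]
  calc _ ≤ ∑ j, |M a j * x j| := Finset.abs_sum_le_sum_abs _ _
    _ ≤ ∑ j, |M a j| * ρ := Finset.sum_le_sum fun j _ => by rw [abs_mul]; gcongr; exact hx j
    _ = (∑ j, |M a j|) * ρ := by rw [Finset.sum_mul]
    _ ≤ _ := by
      gcongr
      have := Finset.single_le_sum (f := fun i => ∑ j, |M i j|) (fun i _ => by positivity) (Finset.mem_univ a)
      rw [mSum]; linarith

lemma vol_box {d s : ℕ} (M : Matrix (Fin d) (Fin d) ℝ) (hM : M.det = 1) (q : Fin s → Fin d → ℤ)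
    (J : Fin s → Fin d) (hJ : (mJ q J).det ≠ 0) (δ : Fin s → ℝ) (hδ : ∀ i, 0 ≤ δ i) :
    volume {x : Fin d → ℝ | (∀ j, |x j| ≤ 2) ∧ ∀ i, |ell M (q i) x| ≤ δ i} ≤
      ENNReal.ofReal ((4 * mSum M) ^ d * 2 ^ s * ((∏ i, δ i) / |((mJ q J).det : ℝ)|)) := by
  have hinj := mJ_inj q J hJ
  let A : Matrix (Fin d) (Fin d) ℝ := Matrix.of fun a =>
    if h : ∃ i, J i = a then fun b => (q h.choose b : ℝ) else fun b => if a = b then 1 else 0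
  let β : Fin d → ℝ := fun a => if h : ∃ i, J i = a then δ h.choose else 2 * mSum M
  have hch : ∀ i (h : ∃ k, J k = J i), h.choose = i := fun i h => hinj h.choose_spec
  have hAJ : ∀ i b, A (J i) b = q i b := by
    intro i b
    have h : ∃ k, J k = J i := ⟨i, rfl⟩
    simp only [A, Matrix.of_apply, dif_pos h, hch i h]
  have hβJ : ∀ i, β (J i) = δ i := by
    intro i
    have h : ∃ k, J k = J i := ⟨i, rfl⟩
    simp only [β, dif_pos h, hch i h]
  have hAn : ∀ a, a ∉ Set.range J → ∀ b, A a b = if a = b then 1 else 0 := by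
    intro a ha b
    have h : ¬ ∃ k, J k = a := ha
    simp only [A, Matrix.of_apply, dif_neg h]
  have hβn : ∀ a, a ∉ Set.range J → β a = 2 * mSum M := by
    intro a ha
    have h : ¬ ∃ k, J k = a := ha
    simp only [β, dif_neg h]
  let e : Fin s ⊕ ↥(Set.range J)ᶜ ≃ Fin d :=
    ((Equiv.ofInjective J hinj).sumCongr (Equiv.refl _)).trans (Equiv.Set.sumCompl (Set.range J))
  have el : ∀ i, e (Sum.inl i) = J i := fun i => by simp [e]
  have er : ∀ i, e (Sum.inr i) = i.1 := fun i => by simp [e]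
  have hdetA : A.det = ((mJ q J).det : ℝ) := by
    rw [← Matrix.det_submatrix_equiv_self e A, ← Matrix.fromBlocks_toBlocks (A.submatrix e e)]
    have h21 : (A.submatrix e e).toBlocks₂₁ = 0 := by
      ext i j
      simp only [Matrix.toBlocks₂₁, Matrix.of_apply, Matrix.submatrix_apply, el, er, Matrix.zero_apply]
      rw [hAn _ i.2, if_neg]
      intro h; exact i.2 ⟨j, h.symm⟩
    have h22 : (A.submatrix e e).toBlocks₂₂ = 1 := by
      ext i j
      simp only [Matrix.toBlocks₂₂, Matrix.of_apply, Matrix.submatrix_apply, er]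
      rw [hAn _ i.2, Matrix.one_apply]
      simp only [Subtype.ext_iff]
    have h11 : (A.submatrix e e).toBlocks₁₁ = (mJ q J).map (Int.castRingHom ℝ) := by
      ext i j
      simp only [Matrix.toBlocks₁₁, Matrix.of_apply, Matrix.submatrix_apply, el, hAJ, mJ, Matrix.map_apply]
      rfl
    rw [h21, Matrix.det_fromBlocks_zero₂₁, h22, h11, Matrix.det_one, mul_one]
    exact (Int.castRingHom ℝ).map_det (mJ q J) |>.symm
  have hAM : (A * M).det = ((mJ q J).det : ℝ) := by rw [Matrix.det_mul, hM, mul_one, hdetA]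
  have hne : LinearMap.det (Matrix.toLin' (A * M)) ≠ 0 := by
    rw [LinearMap.det_toLin', hAM]; exact_mod_cast hJ
  have hsub : {x : Fin d → ℝ | (∀ j, |x j| ≤ 2) ∧ ∀ i, |ell M (q i) x| ≤ δ i} ⊆
      Matrix.toLin' (A * M) ⁻¹' (Set.Icc (fun a => - β a) β) := by
    rintro x ⟨hx1, hx2⟩
    have key : ∀ a, |((A * M) *ᵥ x) a| ≤ β a := by
      intro a
      rw [← Matrix.mulVec_mulVec]
      by_cases ha : a ∈ Set.range J
      · obtain ⟨i, rfl⟩ := ha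
        rw [hβJ]
        have : (A *ᵥ (M *ᵥ x)) (J i) = ell M (q i) x := by
          simp only [ell]
          rw [Matrix.mulVec, dotProduct]
          exact Finset.sum_congr rfl fun j _ => by rw [hAJ]
        rw [this]; exact hx2 i
      · rw [hβn a ha]
        have : (A *ᵥ (M *ᵥ x)) a = (M *ᵥ x) a := by
          rw [Matrix.mulVec, dotProduct]
          simp [hAn a ha]
        rw [this, mul_comm]
        exact mulVec_le M x 2 (by norm_num) hx1 a
    rw [Set.mem_preimage, Matrix.toLin'_apply]
    exact ⟨fun a => (abs_le.mp (key a)).1, fun a => (abs_le.mp (key a)).2⟩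
  refine (measure_mono hsub).trans ?_
  rw [Measure.addHaar_preimage_linearMap _ hne, Real.volume_Icc_pi, LinearMap.det_toLin', hAM,
    ← ENNReal.ofReal_prod_of_nonneg, ← ENNReal.ofReal_mul (abs_nonneg _)]
  · apply ENNReal.ofReal_le_ofReal
    have hp : ∏ a, (β a - - β a) = (2 ^ s * ∏ i, δ i) * (4 * mSum M) ^ (Fintype.card ↥(Set.range J)ᶜ) := by
      rw [← e.prod_comp, Fintype.prod_sum_type]
      congr 1
      · simp only [el, hβJ]
        have e2 : ∏ x : Fin s, (2 * δ x) = 2 ^ s * ∏ i, δ i := by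
          rw [Finset.prod_mul_distrib]; simp
        rw [← e2]
        exact Finset.prod_congr rfl fun _ _ => by ring
      · simp only [er]
        rw [← Finset.card_univ, ← Finset.prod_const]
        exact Finset.prod_congr rfl fun i _ => by rw [hβn _ i.2]; ring
    rw [hp, abs_inv]
    have hc : (4 * mSum M) ^ (Fintype.card ↥(Set.range J)ᶜ) ≤ (4 * mSum M) ^ d := by
      apply pow_le_pow_right₀
      · have := one_le_mSum M; linarith
      · have := Fintype.card_le_of_injective (fun a : ↥(Set.range J)ᶜ => a.1) Subtype.val_injective
        rwa [Fintype.card_fin] at this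
    have h0 : 0 ≤ ∏ i, δ i := Finset.prod_nonneg fun i _ => hδ i
    calc _ ≤ |((mJ q J).det : ℝ)|⁻¹ * ((2 ^ s * ∏ i, δ i) * (4 * mSum M) ^ d) := by gcongr
      _ = _ := by rw [div_eq_mul_inv]; ring
  · intro a _
    have : 0 ≤ β a := by
      by_cases ha : a ∈ Set.range J
      · obtain ⟨i, rfl⟩ := ha; rw [hβJ]; exact hδ i
      · rw [hβn a ha]; have := one_le_mSum M; linarith
    linarith

open scoped Pointwise in
lemma vol_slice {n s : ℕ} (M : Matrix (Fin (n+1)) (Fin (n+1)) ℝ) (q : Fin s → Fin (n+1) → ℤ)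
    (j : Fin (n+1)) (δ : Fin s → ℝ) :
    volume {z : Fin n → ℝ | (∀ k, |z k| ≤ 1) ∧ ∀ i, |ell M (q i) (Fin.insertNth (α := fun _ => ℝ) j 1 z)| ≤ δ i} ≤
      volume {x : Fin (n+1) → ℝ | (∀ j, |x j| ≤ 2) ∧ ∀ i, |ell M (q i) x| ≤ 2 * δ i} := by
  set A := {z : Fin n → ℝ | (∀ k, |z k| ≤ 1) ∧ ∀ i, |ell M (q i) (Fin.insertNth (α := fun _ => ℝ) j 1 z)| ≤ δ i}
  set B := {x : Fin (n+1) → ℝ | (∀ j, |x j| ≤ 2) ∧ ∀ i, |ell M (q i) x| ≤ 2 * δ i}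
  have hB : MeasurableSet B := by
    apply IsClosed.measurableSet
    simp only [B, Set.ofPred_and, Set.ofPred_forall]
    refine IsClosed.inter (isClosed_iInter fun k => isClosed_le (by fun_prop) continuous_const)
      (isClosed_iInter fun i => isClosed_le ((continuous_ell M _).abs) continuous_const)
  let E := MeasurableEquiv.piFinSuccAbove (fun _ : Fin (n+1) => ℝ) j
  have hE := volume_preserving_piFinSuccAbove (fun _ : Fin (n+1) => ℝ) j
  have hB2 : MeasurableSet (E.symm ⁻¹' B) := E.symm.measurable hB
  have h1 : volume B = volume (E.symm ⁻¹' B) := by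
    rw [← hE.measure_preimage_equiv, ← Set.preimage_comp]
    congr 1
    ext x; simp [E]
  rw [h1, Measure.volume_eq_prod, Measure.prod_apply hB2]
  have h2 : ∀ ρ ∈ Set.Icc (1:ℝ) 2, volume A ≤ volume (Prod.mk ρ ⁻¹' (E.symm ⁻¹' B)) := by
    intro ρ hρ
    have h3 : ρ • A ⊆ Prod.mk ρ ⁻¹' (E.symm ⁻¹' B) := by
      rintro _ ⟨z, hz, rfl⟩
      have e1 : E.symm (ρ, ρ • z) = ρ • (Fin.insertNth (α := fun _ => ℝ) j 1 z) := by
        have e0 : E.symm (ρ, ρ • z) = Fin.insertNth (α := fun _ => ℝ) j ρ (ρ • z) := rfl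
        rw [e0]
        ext k
        rcases Fin.eq_self_or_eq_succAbove j k with rfl | ⟨k, rfl⟩ <;> simp
      simp only [Set.mem_preimage]
      rw [e1]
      refine ⟨fun k => ?_, fun i => ?_⟩
      · rcases Fin.eq_self_or_eq_succAbove j k with rfl | ⟨k, rfl⟩
        · simp; rw [abs_of_nonneg (by linarith [hρ.1])]; exact hρ.2
        · simp only [Pi.smul_apply, Fin.insertNth_apply_succAbove, smul_eq_mul, abs_mul]
          rw [abs_of_nonneg (by linarith [hρ.1])]
          nlinarith [hz.1 k, hρ.1, hρ.2, abs_nonneg (z k)]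
      · rw [ell_smul, abs_mul, abs_of_nonneg (by linarith [hρ.1])]
        have := hz.2 i
        have h0 := abs_nonneg (ell M (q i) (Fin.insertNth (α := fun _ => ℝ) j 1 z))
        nlinarith [hρ.1, hρ.2]
    refine le_trans ?_ (measure_mono h3)
    rw [Measure.addHaar_smul]
    have : (1:ENNReal) ≤ ENNReal.ofReal |ρ ^ Module.finrank ℝ (Fin n → ℝ)| := by
      rw [← ENNReal.ofReal_one]
      apply ENNReal.ofReal_le_ofReal
      rw [abs_pow, abs_of_nonneg (by linarith [hρ.1])]
      exact one_le_pow₀ hρ.1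
    calc volume A = 1 * volume A := by rw [one_mul]
      _ ≤ _ := by gcongr
  calc volume A = ∫⁻ ρ in Set.Icc (1:ℝ) 2, volume A := by
        rw [setLIntegral_const, Real.volume_Icc]; norm_num
    _ ≤ ∫⁻ ρ in Set.Icc (1:ℝ) 2, volume (Prod.mk ρ ⁻¹' (E.symm ⁻¹' B)) :=
        setLIntegral_mono' measurableSet_Icc h2
    _ ≤ _ := setLIntegral_le_lintegral _ _


lemma normalize_lip {E : Type*} [NormedAddCommGroup E] [NormedSpace ℝ E] (x y : E) (hx : 1 ≤ ‖x‖) (hy : 1 ≤ ‖y‖) :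
    ‖‖x‖⁻¹ • x - ‖y‖⁻¹ • y‖ ≤ 2 * ‖x - y‖ := by
  have hx0 : 0 < ‖x‖ := by linarith
  have hy0 : 0 < ‖y‖ := by linarith
  have e : ‖x‖⁻¹ • x - ‖y‖⁻¹ • y = ‖x‖⁻¹ • (x - y) + (‖x‖⁻¹ - ‖y‖⁻¹) • y := by
    rw [smul_sub, sub_smul]; abel
  rw [e]
  refine (norm_add_le _ _).trans ?_
  rw [norm_smul, norm_smul, norm_inv, norm_norm]
  have h1 : ‖x‖⁻¹ ≤ 1 := inv_le_one_of_one_le₀ hx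
  have h2 : ‖(‖x‖⁻¹ - ‖y‖⁻¹)‖ * ‖y‖ ≤ ‖x - y‖ := by
    have : ‖x‖⁻¹ - ‖y‖⁻¹ = (‖y‖ - ‖x‖) * ‖x‖⁻¹ * ‖y‖⁻¹ := by field_simp
    rw [this, norm_mul, norm_mul, norm_inv, norm_inv, norm_norm, norm_norm, mul_assoc, inv_mul_cancel₀ hy0.ne', mul_one]
    have h3 : ‖‖y‖ - ‖x‖‖ ≤ ‖x - y‖ := by
      rw [Real.norm_eq_abs, norm_sub_rev]; exact abs_norm_sub_norm_le y x
    calc _ ≤ ‖x - y‖ * 1 := by gcongr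
      _ = _ := mul_one _
  have h4 : ‖x‖⁻¹ * ‖x - y‖ ≤ 1 * ‖x - y‖ := by gcongr
  linarith

noncomputable def chart {n : ℕ} (j : Fin (n+1)) (σ : ℝ) (z : Fin n → ℝ) : Ed (n+1) :=
  σ • (‖(WithLp.toLp 2 (Fin.insertNth (α := fun _ => ℝ) j 1 z) : Ed (n+1))‖⁻¹ •
    (WithLp.toLp 2 (Fin.insertNth (α := fun _ => ℝ) j 1 z) : Ed (n+1)))

lemma chart_lip {n : ℕ} (j : Fin (n+1)) (σ : ℝ) (hσ : |σ| = 1) :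
    LipschitzWith (2 * (n+1)) (chart (n := n) j σ) := by
  apply LipschitzWith.of_dist_le_mul
  intro z w
  rw [dist_eq_norm, dist_eq_norm, chart, chart, ← smul_sub, norm_smul, Real.norm_eq_abs, hσ, one_mul]
  have h1 : ∀ z : Fin n → ℝ, 1 ≤ ‖(WithLp.toLp 2 (Fin.insertNth (α := fun _ => ℝ) j 1 z) : Ed (n+1))‖ := by
    intro z
    have := PiLp.norm_apply_le (WithLp.toLp 2 (Fin.insertNth (α := fun _ => ℝ) j 1 z) : Ed (n+1)) j
    simpa using this
  refine (normalize_lip _ _ (h1 z) (h1 w)).trans ?_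
  push_cast
  rw [mul_assoc]
  gcongr
  rw [EuclideanSpace.norm_eq]
  apply Real.sqrt_le_iff.mpr
  refine ⟨by positivity, ?_⟩
  have h2 : ∀ k, ‖((WithLp.toLp 2 (Fin.insertNth (α := fun _ => ℝ) j 1 z) : Ed (n+1)) -
      (WithLp.toLp 2 (Fin.insertNth (α := fun _ => ℝ) j 1 w) : Ed (n+1))) k‖ ^ 2 ≤ ‖z - w‖ ^ 2 := by
    intro k
    apply pow_le_pow_left₀ (norm_nonneg _)
    rcases Fin.eq_self_or_eq_succAbove j k with rfl | ⟨k, rfl⟩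
    · simp
    · have := norm_le_pi_norm (z - w) k
      simpa using this
  refine (Finset.sum_le_sum fun k _ => h2 k).trans ?_
  rw [Finset.sum_const, Finset.card_univ, Fintype.card_fin, nsmul_eq_mul]
  push_cast
  have : (0:ℝ) ≤ n := by positivity
  nlinarith [sq_nonneg ‖z - w‖, mul_nonneg this (sq_nonneg ‖z - w‖), mul_nonneg this (mul_nonneg this (sq_nonneg ‖z - w‖))]

lemma vol_sphere {n s : ℕ} (M : Matrix (Fin (n+1)) (Fin (n+1)) ℝ) (hM : M.det = 1) :
    ∃ C : ℝ, 0 ≤ C ∧ ∀ (q : Fin s → Fin (n+1) → ℤ)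
    (J : Fin s → Fin (n+1)) (_ : (mJ q J).det ≠ 0) (δ : Fin s → ℝ) (_ : ∀ i, 0 ≤ δ i),
    sphSurf (n+1) {υ : Ed (n+1) | ∀ i, |ell M (q i) υ| ≤ δ i} ≤
      ENNReal.ofReal (C * ((∏ i, δ i) / |((mJ q J).det : ℝ)|)) := by
  set c : ℝ := (n:ℝ) + 1 with hc
  have hc1 : 1 ≤ c := by rw [hc]; have : (0:ℝ) ≤ n := by positivity
                         linarith
  refine ⟨(2 * (n+1)) * ((2 * (n+1)) ^ n * ((4 * mSum M) ^ (n+1) * 2 ^ s * (2 * c) ^ s)), ?_, ?_⟩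
  · have := one_le_mSum M; positivity
  intro q J hJ δ hδ
  have hSet : ∀ j, volume {z : Fin n → ℝ | (∀ k, |z k| ≤ 1) ∧ ∀ i, |ell M (q i) (Fin.insertNth (α := fun _ => ℝ) j 1 z)| ≤ c * δ i} ≤
      ENNReal.ofReal ((4 * mSum M) ^ (n+1) * 2 ^ s * (2 * c) ^ s * ((∏ i, δ i) / |((mJ q J).det : ℝ)|)) := by
    intro j
    refine (vol_slice M q j (fun i => c * δ i)).trans ?_
    refine (vol_box M hM q J hJ (fun i => 2 * (c * δ i)) (fun i => by have := hδ i; positivity)).trans (le_of_eq ?_)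
    congr 1
    have : ∏ i : Fin s, (2 * (c * δ i)) = (2 * c) ^ s * ∏ i, δ i := by
      simp_rw [← mul_assoc]
      rw [Finset.prod_mul_distrib]; simp
    rw [this]; ring
  have hcov : {υ : Ed (n+1) | ∀ i, |ell M (q i) υ| ≤ δ i} ∩ Metric.sphere (0 : Ed (n+1)) 1 ⊆
      ⋃ p : Fin (n+1) × Bool, chart p.1 (if p.2 then 1 else -1) ''
        {z : Fin n → ℝ | (∀ k, |z k| ≤ 1) ∧ ∀ i, |ell M (q i) (Fin.insertNth (α := fun _ => ℝ) p.1 1 z)| ≤ c * δ i} := by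
    rintro υ ⟨hυ1, hυ2⟩
    have hn : ‖υ‖ = 1 := by simpa using hυ2
    obtain ⟨j, _, hj⟩ := Finset.exists_max_image (Finset.univ : Finset (Fin (n+1))) (fun k => |υ k|) Finset.univ_nonempty
    have hsq : ∑ k, υ k ^ 2 = 1 := by
      rw [← EuclideanSpace.real_norm_sq_eq, hn]; norm_num
    have hjc : 1 ≤ c * |υ j| := by
      have h1 : (1:ℝ) ≤ c * |υ j| ^ 2 := by
        rw [← hsq]
        calc _ ≤ ∑ k : Fin (n+1), |υ j| ^ 2 := Finset.sum_le_sum fun k hk => by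
              rw [← sq_abs]; exact pow_le_pow_left₀ (abs_nonneg _) (hj k hk) 2
          _ = _ := by simp [hc]
      have h2 : |υ j| ≤ 1 := by
        have := PiLp.norm_apply_le υ j
        rw [hn] at this; simpa using this
      nlinarith [abs_nonneg (υ j)]
    have hj0 : υ j ≠ 0 := by
      intro h; rw [h] at hjc; simp at hjc; linarith
    have hjp : 0 < |υ j| := abs_pos.mpr hj0
    let z : Fin n → ℝ := fun k => υ (j.succAbove k) / υ j
    have hins : υ j • Fin.insertNth (α := fun _ => ℝ) j 1 z = υ := by
      ext k
      rcases Fin.eq_self_or_eq_succAbove j k with rfl | ⟨k, rfl⟩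
      · simp
      · simp [z]; field_simp
    have hins2 : υ j • (WithLp.toLp 2 (Fin.insertNth (α := fun _ => ℝ) j 1 z) : Ed (n+1)) = υ := by
      ext k
      exact congrFun hins k
    have hnorm : ‖(WithLp.toLp 2 (Fin.insertNth (α := fun _ => ℝ) j 1 z) : Ed (n+1))‖⁻¹ = |υ j| := by
      have h3 := congrArg norm hins2
      rw [norm_smul, hn, Real.norm_eq_abs] at h3
      exact inv_eq_of_mul_eq_one_left h3
    have hz : z ∈ {z : Fin n → ℝ | (∀ k, |z k| ≤ 1) ∧ ∀ i, |ell M (q i) (Fin.insertNth (α := fun _ => ℝ) j 1 z)| ≤ c * δ i} := by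
      refine ⟨fun k => ?_, fun i => ?_⟩
      · simp only [z]
        rw [abs_div, div_le_one hjp]
        exact hj _ (Finset.mem_univ _)
      · have h4 := hυ1 i
        rw [← hins, ell_smul, abs_mul] at h4
        set X := |ell M (q i) (Fin.insertNth (α := fun _ => ℝ) j 1 z)|
        have hX : 0 ≤ X := abs_nonneg _
        calc X ≤ (c * |υ j|) * X := by nlinarith
          _ = c * (|υ j| * X) := by ring
          _ ≤ _ := by gcongr
    rw [Set.mem_iUnion]
    rcases lt_or_gt_of_ne hj0 with h | h
    · refine ⟨(j, false), z, hz, ?_⟩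
      simp only [chart]
      rw [hnorm, abs_of_neg h]
      simp only [Bool.false_eq_true, if_false]
      rw [smul_smul, neg_one_mul, neg_neg, hins2]
    · refine ⟨(j, true), z, hz, ?_⟩
      simp only [chart]
      rw [hnorm, abs_of_pos h]
      simp only [if_true, one_smul]
      exact hins2
  rw [sphSurf, Measure.restrict_apply']
  swap
  · exact Metric.isClosed_sphere.measurableSet
  refine (measure_mono hcov).trans ?_
  refine (measure_iUnion_fintype_le _ _).trans ?_
  have hb : ∀ p : Fin (n+1) × Bool, μH[((n+1 : ℕ):ℝ) - 1] (chart p.1 (if p.2 then 1 else -1) ''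
        {z : Fin n → ℝ | (∀ k, |z k| ≤ 1) ∧ ∀ i, |ell M (q i) (Fin.insertNth (α := fun _ => ℝ) p.1 1 z)| ≤ c * δ i}) ≤
      ENNReal.ofReal ((2 * (n+1)) ^ n * ((4 * mSum M) ^ (n+1) * 2 ^ s * (2 * c) ^ s * ((∏ i, δ i) / |((mJ q J).det : ℝ)|))) := by
    intro p
    have hl := (chart_lip (n := n) p.1 (if p.2 then 1 else -1) (by split_ifs <;> simp)).lipschitzOnWith (s :=
      {z : Fin n → ℝ | (∀ k, |z k| ≤ 1) ∧ ∀ i, |ell M (q i) (Fin.insertNth (α := fun _ => ℝ) p.1 1 z)| ≤ c * δ i})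
    have e : ((n+1 : ℕ):ℝ) - 1 = (Fintype.card (Fin n) : ℝ) := by simp
    rw [e]
    refine (hl.hausdorffMeasure_image_le (by positivity)).trans ?_
    rw [hausdorffMeasure_pi_real, ENNReal.ofReal_mul (by positivity)]
    refine mul_le_mul' (le_of_eq ?_) (hSet p.1)
    rw [Fintype.card_fin, ENNReal.rpow_natCast, ENNReal.ofReal_pow (by positivity)]
    congr 1
    rw [ENNReal.ofReal_mul (by norm_num), ENNReal.ofReal_add (by positivity) (by norm_num)]
    simp
  refine (Finset.sum_le_sum fun p _ => hb p).trans (le_of_eq ?_)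
  rw [Finset.sum_const, Finset.card_univ, Fintype.card_prod, Fintype.card_fin, Fintype.card_bool, nsmul_eq_mul,
    ← ENNReal.ofReal_natCast, ← ENNReal.ofReal_mul (by positivity)]
  congr 1
  push_cast; ring


lemma matExp_hasSum {d : ℕ} (B : Matrix (Fin d) (Fin d) ℝ) :
    HasSum (fun n : ℕ => ((n.factorial : ℝ))⁻¹ • B ^ n) (matExp B) := by
  letI : NormedRing (Matrix (Fin d) (Fin d) ℝ) := Matrix.linftyOpNormedRing
  letI : NormedAlgebra ℝ (Matrix (Fin d) (Fin d) ℝ) := Matrix.linftyOpNormedAlgebra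
  exact (NormedSpace.expSeries_summable' (𝕂 := ℝ) B).hasSum

lemma matExp_eq {d : ℕ} (B : Matrix (Fin d) (Fin d) ℝ) : matExp B = NormedSpace.exp B := by
  rw [NormedSpace.exp_eq_tsum ℝ]; rfl

lemma matExp_orth {d : ℕ} (B : Matrix (Fin d) (Fin d) ℝ) (hB : Bᵀ = -B) :
    matExp B * (matExp B)ᵀ = 1 ∧ (matExp B).det = 1 := by
  have h1 : ∀ A : Matrix (Fin d) (Fin d) ℝ, Aᵀ = -A → matExp A * (matExp A)ᵀ = 1 := by
    intro A hA
    rw [matExp_eq, ← Matrix.exp_transpose, hA, ← Matrix.exp_add_of_commute _ _ (Commute.neg_right (Commute.refl A)),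
      add_neg_cancel, NormedSpace.exp_zero]
  refine ⟨h1 B hB, ?_⟩
  have h2 := congrArg Matrix.det (h1 ((1/2 : ℝ) • B) (by rw [Matrix.transpose_smul, hB, smul_neg]))
  rw [Matrix.det_mul, Matrix.det_transpose, Matrix.det_one] at h2
  have h3 : matExp B = matExp ((1/2 : ℝ) • B) * matExp ((1/2 : ℝ) • B) := by
    rw [matExp_eq, matExp_eq, ← Matrix.exp_add_of_commute _ _ (Commute.refl _), ← add_smul]
    norm_num
  rw [h3, Matrix.det_mul, h2]

noncomputable def kB (d : ℕ) (υ : Ed d) : Matrix (Fin d) (Fin d) ℝ := Matrix.of fun i j : Fin d =>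
    if (i : ℕ) = 0 ∧ (j : ℕ) ≠ 0 then -(yMap d υ j)
    else if (i : ℕ) ≠ 0 ∧ (j : ℕ) = 0 then yMap d υ i
    else 0

lemma kMap_orth (d : ℕ) (υ : Ed d) : kMap d υ * (kMap d υ)ᵀ = 1 ∧ (kMap d υ).det = 1 := by
  apply matExp_orth
  ext i j
  simp only [Matrix.transpose_apply, Matrix.of_apply, Matrix.neg_apply]
  by_cases hi : (i:ℕ) = 0 <;> by_cases hj : (j:ℕ) = 0 <;> simp [hi, hj]

lemma matExp_col {n : ℕ} (B : Matrix (Fin (n+1)) (Fin (n+1)) ℝ) (θ : ℝ) (w e : Fin (n+1) → ℝ)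
    (h1 : B *ᵥ e = θ • w) (h2 : B *ᵥ w = (-θ) • e) (i : Fin (n+1)) :
    (matExp B *ᵥ e) i = Real.cos θ * e i + Real.sin θ * w i := by
  have hev : ∀ k : ℕ, (B ^ (2 * k)) *ᵥ e = ((-1) ^ k * θ ^ (2 * k)) • e := by
    intro k
    induction k with
    | zero => simp
    | succ k ih =>
      rw [mul_add, pow_add, mul_one, add_comm (2*k) 2, ← pow_add, add_comm (2*k) 2, pow_add, pow_two, ← Matrix.mulVec_mulVec, ih,
        Matrix.mulVec_smul, ← Matrix.mulVec_mulVec, h1, Matrix.mulVec_smul, h2, smul_smul, smul_smul]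
      congr 1; ring
  have hod : ∀ k : ℕ, (B ^ (2 * k + 1)) *ᵥ e = ((-1) ^ k * θ ^ (2 * k + 1)) • w := by
    intro k
    rw [pow_succ', ← Matrix.mulVec_mulVec, hev, Matrix.mulVec_smul, h1, smul_smul]
    congr 1; ring
  have hs : HasSum (fun n : ℕ => ((n.factorial : ℝ))⁻¹ * ((B ^ n) *ᵥ e) i) ((matExp B *ᵥ e) i) := by
    have := (matExp_hasSum B).map (((Matrix.mulVecBilin ℝ ℝ).flip e).toAddMonoidHom) (by
      show Continuous fun A : Matrix (Fin (n+1)) (Fin (n+1)) ℝ => A *ᵥ e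
      fun_prop)
    have h3 := (Pi.hasSum.mp this) i
    refine h3.congr_fun ?_
    intro m
    simp [Matrix.smul_mulVec]
  refine hs.unique ?_
  refine HasSum.even_add_odd ?_ ?_
  · have := (Real.hasSum_cos θ).mul_right (e i)
    refine this.congr_fun ?_
    intro k
    rw [hev]; simp only [Pi.smul_apply, smul_eq_mul]; ring
  · have := (Real.hasSum_sin θ).mul_right (w i)
    refine this.congr_fun ?_
    intro k
    rw [hod]; simp only [Pi.smul_apply, smul_eq_mul]; ring

lemma kMap_col (n : ℕ) (υ : Ed (n+1)) (hυ : ‖υ‖ = 1) (h0 : 0 ≤ υ 0) (i : Fin (n+1)) :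
    kMap (n+1) υ i 0 = υ i := by
  have hsq : ∑ k, υ k ^ 2 = 1 := by
    rw [← EuclideanSpace.real_norm_sq_eq, hυ]; norm_num
  rw [Fin.sum_univ_succ] at hsq
  have hu1 : υ 0 ≤ 1 := by
    have : 0 ≤ ∑ i : Fin n, υ i.succ ^ 2 := by positivity
    nlinarith
  have hcol : kMap (n+1) υ i 0 = (kMap (n+1) υ *ᵥ (Pi.single 0 1)) i := by simp
  rw [hcol]
  by_cases h1 : υ 0 = 1
  · have hz : ∀ k : Fin n, υ k.succ = 0 := by
      have : ∑ i : Fin n, υ i.succ ^ 2 = 0 := by rw [h1] at hsq; linarith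
      intro k
      have := (Finset.sum_eq_zero_iff_of_nonneg (fun i _ => sq_nonneg _)).mp this k (Finset.mem_univ _)
      exact pow_eq_zero_iff (two_ne_zero) |>.mp this
    have hy : ∀ k, yMap (n+1) υ k = 0 := by
      intro k; simp [yMap, h1]
    have hk := matExp_col (kB (n+1) υ) 0 0 (Pi.single 0 1) (by
        ext a; simp [kB, hy]) (by ext a; simp) i
    have : kMap (n+1) υ = matExp (kB (n+1) υ) := rfl
    rw [this, hk]
    refine Fin.cases ?_ (fun k => ?_) i
    · simp [h1]
    · simp [hz k]
  · set S := Real.sqrt (1 - υ 0 ^ 2) with hS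
    have hlt : υ 0 < 1 := lt_of_le_of_ne hu1 h1
    have hSp : 0 < S := Real.sqrt_pos.mpr (by nlinarith)
    have hS2 : S ^ 2 = 1 - υ 0 ^ 2 := Real.sq_sqrt (by nlinarith)
    let w : Fin (n+1) → ℝ := fun k => if (k:ℕ) = 0 then 0 else υ k / S
    have hy : ∀ k, yMap (n+1) υ k = Real.arccos (υ 0) * w k := by
      intro k
      have e0 : (⟨0, Nat.succ_pos n⟩ : Fin (n+1)) = 0 := rfl
      have hne : ¬ (υ 0 = 1 ∨ υ 0 = -1) := by
        rintro (h | h); exacts [h1 h, by linarith]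
      by_cases hk : (k:ℕ) = 0
      · obtain rfl : k = 0 := Fin.ext hk
        simp [yMap, w]
      · simp only [yMap, w, hk, if_false, Nat.succ_pos, dif_pos, e0, hne]
        rw [← hS]; ring
    have hk := matExp_col (kB (n+1) υ) (Real.arccos (υ 0)) w (Pi.single 0 1) (by
        ext a
        simp only [Matrix.mulVec_single_one, Matrix.col_apply, kB, Matrix.of_apply, hy, Pi.smul_apply, smul_eq_mul]
        refine Fin.cases ?_ (fun k => ?_) a <;> simp [w]) (by
        ext a
        simp only [Matrix.mulVec, dotProduct, kB, Matrix.of_apply, hy, Pi.smul_apply, smul_eq_mul]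
        refine Fin.cases ?_ (fun k => ?_) a
        · rw [Fin.sum_univ_succ]
          simp [w]
          have : ∑ x : Fin n, Real.arccos (υ 0) * (υ x.succ / S) * (υ x.succ / S) = Real.arccos (υ 0) * ((∑ x : Fin n, υ x.succ ^ 2) / S^2) := by
            rw [Finset.sum_div, Finset.mul_sum]
            exact Finset.sum_congr rfl fun x _ => by ring
          rw [this, hS2, show (∑ x : Fin n, υ x.succ ^ 2) = 1 - υ 0 ^ 2 by linarith, div_self (by nlinarith), mul_one]
        · rw [Fin.sum_univ_succ]
          simp [w]) i
    have : kMap (n+1) υ = matExp (kB (n+1) υ) := rfl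
    rw [this, hk, Real.cos_arccos (by linarith) hu1, Real.sin_arccos, ← hS]
    refine Fin.cases ?_ (fun k => ?_) i
    · simp [w]
    · simp [w]; field_simp


lemma two_div_sqrt3_le : 2 / Real.sqrt 3 ≤ 2 := by
  have h : (1:ℝ) ≤ Real.sqrt 3 := by
    rw [show (1:ℝ) = Real.sqrt 1 by simp]
    exact Real.sqrt_le_sqrt (by norm_num)
  rw [div_le_iff₀ (by linarith)]; linarith

lemma siegel_le {d : ℕ} {v : Fin d → ℝ} (hv : SiegelV d v) (n : ℕ) : ∀ i j : Fin d, (j:ℕ) + n = i →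
    v i ≤ 2 ^ n * v j := by
  induction n with
  | zero => intro i j h; have : i = j := Fin.ext (by omega); simp [this]
  | succ n ih =>
    intro i j h
    have h1 := ih ⟨j + n, by omega⟩ j rfl
    have h2 := hv.2.2 ⟨j + n, by omega⟩ i (by simp; omega)
    have h3 := hv.1 ⟨j + n, by omega⟩
    have h4 : 2 / Real.sqrt 3 * v ⟨j + n, by omega⟩ ≤ 2 * v ⟨j + n, by omega⟩ :=
      mul_le_mul_of_nonneg_right two_div_sqrt3_le h3.le
    rw [pow_succ]; linarith

lemma orth_abs_le {d : ℕ} (k : Matrix (Fin d) (Fin d) ℝ) (hk : k * kᵀ = 1) (i j : Fin d) : |k i j| ≤ 1 := by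
  have h := congrFun (congrFun hk i) i
  simp only [Matrix.mul_apply, Matrix.transpose_apply, Matrix.one_apply_eq] at h
  have : k i j * k i j ≤ ∑ x, k i x * k i x :=
    Finset.single_le_sum (f := fun x => k i x * k i x) (fun x _ => mul_self_nonneg _) (Finset.mem_univ j)
  rw [abs_le]; constructor <;> nlinarith

lemma siegel_inv {d : ℕ} (u : Fin d → Fin d → ℝ) (v : Fin d → ℝ) (k W : Matrix (Fin d) (Fin d) ℝ)
    (hv : SiegelV d v) (hu : ∀ i j : Fin d, i < j → |u i j| ≤ 1 / 2) (hk : k * kᵀ = 1)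
    (hW : (nMat d u * Matrix.diagonal v * k) * W = 1) (a : Fin d) :
    ∀ i, |W a i| ≤ 4 ^ (i:ℕ) / v i := by
  have hkk : kᵀ * k = 1 := mul_eq_one_comm.mp hk
  have hW2 : W * (nMat d u * Matrix.diagonal v * k) = 1 := mul_eq_one_comm.mp hW
  have h1 : W * nMat d u * Matrix.diagonal v = kᵀ := by
    have := congrArg (· * kᵀ) hW2
    simpa [Matrix.mul_assoc, hk] using this
  have h2 : ∀ i, (∑ j, W a j * nMat d u j i) * v i = k i a := by
    intro i
    have := congrFun (congrFun h1 a) i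
    rw [Matrix.mul_diagonal, Matrix.mul_apply] at this
    simpa using this
  have h3 : ∀ i, W a i + ∑ j ∈ Finset.univ.filter (fun j => j < i), W a j * u j i = k i a / v i := by
    intro i
    rw [eq_div_iff (hv.1 i).ne', ← h2 i]
    congr 1
    rw [← Finset.add_sum_erase _ _ (Finset.mem_univ i)]
    have : ∀ j ∈ Finset.univ.erase i, W a j * nMat d u j i = if j < i then W a j * u j i else 0 := by
      intro j hj
      have : j ≠ i := Finset.ne_of_mem_erase hj
      simp [nMat, this]
    rw [Finset.sum_congr rfl this, ← Finset.sum_filter]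
    congr 1
    · simp [nMat]
    · refine Finset.sum_congr ?_ fun _ _ => rfl
      ext j; simp; intro h; exact h.ne
  intro i
  induction hn : (i:ℕ) using Nat.strong_induction_on generalizing i with
  | _ n ih =>
  have hvi := hv.1 i
  have hb : ∀ j ∈ Finset.univ.filter (fun j => j < i), |W a j * u j i| ≤ (1/2) * ((4^(j:ℕ) * 2 ^ (n - j)) / v i) := by
    intro j hj
    have hji : j < i := (Finset.mem_filter.mp hj).2
    have hjn : (j:ℕ) < n := by rw [← hn]; exact hji
    rw [abs_mul, mul_comm]
    refine mul_le_mul (hu j i hji) ?_ (abs_nonneg _) (by norm_num)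
    refine (ih j hjn j rfl).trans ?_
    rw [div_le_div_iff₀ (hv.1 j) hvi, mul_assoc]
    exact mul_le_mul_of_nonneg_left (siegel_le hv _ i j (by omega)) (by positivity)
  have hsum : ∑ j ∈ Finset.univ.filter (fun j : Fin d => j < i), ((4:ℝ)^(j:ℕ) * 2 ^ (n - j)) = 2^n * (2^n - 1) := by
    have e1 : ∑ j ∈ Finset.univ.filter (fun j : Fin d => j < i), ((4:ℝ)^(j:ℕ) * 2 ^ (n - j)) = ∑ j ∈ Finset.range n, ((4:ℝ)^j * 2 ^ (n - j)) := by
      refine Finset.sum_bij (fun j _ => (j:ℕ)) ?_ ?_ ?_ ?_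
      · intro j hj; have := (Finset.mem_filter.mp hj).2; simp; omega
      · intro j _ j' _ h; exact Fin.ext h
      · intro m hm; have := Finset.mem_range.mp hm
        exact ⟨⟨m, by omega⟩, Finset.mem_filter.mpr ⟨Finset.mem_univ _, Fin.lt_def.mpr (by simp only []; omega)⟩, rfl⟩
      · intro j _; rfl
    have e2 : ∀ j ∈ Finset.range n, ((4:ℝ)^j * 2 ^ (n - j)) = 2^n * 2^j := by
      intro j hj; have := Finset.mem_range.mp hj
      rw [show (4:ℝ) = 2 * 2 by norm_num, mul_pow, mul_assoc, ← pow_add, show j + (n - j) = n by omega, mul_comm]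
    rw [e1, Finset.sum_congr rfl e2, ← Finset.mul_sum, geom_sum_eq (by norm_num)]
    norm_num
  have h5 : |∑ j ∈ Finset.univ.filter (fun j => j < i), W a j * u j i| ≤ (1/2) * ((2^n * (2^n - 1)) / v i) := by
    refine (Finset.abs_sum_le_sum_abs _ _).trans ((Finset.sum_le_sum hb).trans (le_of_eq ?_))
    rw [← Finset.mul_sum, ← Finset.sum_div, hsum]
  have h6 : W a i = k i a / v i - ∑ j ∈ Finset.univ.filter (fun j => j < i), W a j * u j i := by
    rw [← h3 i]; ring
  have h7 : |k i a / v i| ≤ 1 / v i := by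
    rw [abs_div, abs_of_pos hvi]
    exact div_le_div_of_nonneg_right (orth_abs_le k hk i a) hvi.le
  rw [h6]
  refine (abs_sub _ _).trans ((add_le_add h7 h5).trans ?_)
  have e4 : (4:ℝ)^n = 2^n * 2^n := by rw [← mul_pow]; norm_num
  rw [e4, mul_div_assoc', ← add_div]
  refine div_le_div_of_nonneg_right ?_ hvi.le
  have : (1:ℝ) ≤ 2^n := one_le_pow₀ (by norm_num)
  nlinarith

lemma distToInt_le (x : ℝ) (z : ℤ) : distToInt x ≤ |x - z| := round_le x z

lemma reduction {n : ℕ} (ξ : Fin (n+1) → ℝ) (M0 : Matrix (Fin (n+1)) (Fin (n+1)) ℝ) (hM0 : M0.det = 1)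
    (vc bc : (Matrix (Fin (n+1)) (Fin (n+1)) ℝ × (Fin (n+1) → ℝ)) → (Fin (n+1) → ℝ))
    (hsec : IsSiegelSection (n+1) vc bc) (υ : Ed (n+1)) (hυ : ‖υ‖ = 1) (h0 : 0 ≤ υ 0) (t : ℝ) (ht : 0 ≤ t) :
    SiegelV (n+1) (vc (gEltSph (n+1) ξ M0 υ t)) ∧
    ∃ q : Fin (n+1) → Fin (n+1) → ℤ, (Matrix.of q).det = 1 ∧
      (∀ i, distToInt (∑ j, ξ j * (q i j : ℝ)) ≤ |bc (gEltSph (n+1) ξ M0 υ t) i|) ∧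
      (∀ i, |ell (M0⁻¹)ᵀ (q i) υ| ≤ 4 ^ (n+1) * Real.exp (-(n * t / (n+1))) / vc (gEltSph (n+1) ξ M0 υ t) i) ∧
      (∀ i j, |(q i j : ℝ)| ≤ mSum M0 * ((n+1) * (4^(n+1) * Real.exp (t / (n+1)) / vc (gEltSph (n+1) ξ M0 υ t) i))) := by
  set g := gEltSph (n+1) ξ M0 υ t with hg
  set K := kMap (n+1) υ with hK
  obtain ⟨hKo, hKd⟩ := kMap_orth (n+1) υ
  have hPhi : (Phi (n+1) t).det = 1 := by
    rw [Phi, Matrix.det_diagonal, Fin.prod_univ_succ]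
    simp only [Fin.val_zero, if_true, Fin.val_succ, Nat.succ_ne_zero, if_false, Finset.prod_const, Finset.card_univ, Fintype.card_fin]
    rw [← Real.exp_nat_mul, ← Real.exp_add, Real.exp_eq_one_iff]
    push_cast; field_simp; ring
  have hgd : g.1.det = 1 := by
    show (M0 * K * Phi (n+1) t).det = 1
    rw [Matrix.det_mul, Matrix.det_mul, hM0, hKd, hPhi]; norm_num
  obtain ⟨hv, hb, u, k, hu, hk, hkd, γ, m, hγ, hN, hbN⟩ := hsec.2.2 g hgd
  set v := vc g with hvdef
  set b := bc g with hbdef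
  set N := nMat (n+1) u * Matrix.diagonal v * k with hNdef
  refine ⟨hv, ?_⟩
  simp only at hN hbN
  have hg1 : g.1 = M0 * K * Phi (n+1) t := rfl
  have hg2 : g.2 = Matrix.vecMul ξ g.1 := rfl
  set Mx := g.1 with hMx
  set γR : Matrix (Fin (n+1)) (Fin (n+1)) ℝ := γ.map fun x => (x:ℝ) with hγR
  set γI : Matrix (Fin (n+1)) (Fin (n+1)) ℝ := γ.adjugate.map fun x => (x:ℝ) with hγI
  have hγγ : γI * γR = 1 := by
    have : γ.adjugate * γ = 1 := by rw [Matrix.adjugate_mul, hγ, one_smul]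
    have h2 := congrArg (fun A : Matrix (Fin (n+1)) (Fin (n+1)) ℤ => A.map (Int.castRingHom ℝ)) this
    simp only [Matrix.map_mul] at h2
    rw [Matrix.map_one _ (by simp) (by simp)] at h2
    exact h2
  have hdN : N.det = 1 := by
    rw [hN, Matrix.det_mul, hgd, mul_one]
    have h3 := Int.cast_det (R := ℝ) γ
    rw [hγ] at h3
    simpa using h3.symm
  set W := N⁻¹ with hW
  have hNW : N * W = 1 := Matrix.mul_nonsing_inv _ (by rw [hdN]; exact isUnit_one)
  have hMW : Mx * W = γI := by
    calc Mx * W = (γI * γR) * Mx * W := by rw [hγγ, one_mul]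
      _ = γI * (N * W) := by rw [hN]; simp only [Matrix.mul_assoc]
      _ = γI := by rw [hNW, mul_one]
  have hWb : ∀ a i, |W a i| ≤ 4^(n+1) / v i := by
    intro a i
    refine (siegel_inv u v k W hv hu hk hNW a i).trans ?_
    exact div_le_div_of_nonneg_right (pow_le_pow_right₀ (by norm_num) (by omega)) (hv.1 i).le
  have hKt : Kᵀ * K = 1 := mul_eq_one_comm.mp hKo
  have hM0i : M0⁻¹ * M0 = 1 := Matrix.nonsing_inv_mul _ (by rw [hM0]; exact isUnit_one)
  have hrow : Kᵀ * (M0⁻¹ * γI) = Phi (n+1) t * W := by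
    rw [← hMW, hg1]
    calc Kᵀ * (M0⁻¹ * (M0 * K * Phi (n+1) t * W)) = Kᵀ * ((M0⁻¹ * M0) * K) * Phi (n+1) t * W := by
          simp only [Matrix.mul_assoc]
      _ = _ := by rw [hM0i, one_mul, hKt, one_mul]
  have hcol : γI = M0 * (K * (Phi (n+1) t * W)) := by
    rw [← hMW, hg1]; simp only [Matrix.mul_assoc]
  refine ⟨fun i j => γ.adjugate j i, ?_, ?_, ?_, ?_⟩
  · have : (Matrix.of fun i j => γ.adjugate j i) = γ.adjugateᵀ := rfl
    rw [this, Matrix.det_transpose, Matrix.det_adjugate, hγ, one_pow]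
  · intro i
    have h1 : b = Matrix.vecMul ((fun i => (m i : ℝ)) + ξ) γI := by
      have : Matrix.vecMul b N = Matrix.vecMul ((fun i => (m i : ℝ)) + ξ) Mx := by
        rw [hbN, hg2, Matrix.add_vecMul]
      have h2 := congrArg (fun x => Matrix.vecMul x W) this
      simp only [Matrix.vecMul_vecMul, hNW, hMW, Matrix.vecMul_one] at h2
      exact h2
    have h2 : b i = ∑ j, ξ j * (γ.adjugate j i : ℝ) + ((∑ j, m j * γ.adjugate j i : ℤ) : ℝ) := by
      rw [h1]
      simp only [Matrix.vecMul, dotProduct, Pi.add_apply, hγI, Matrix.map_apply]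
      push_cast
      rw [← Finset.sum_add_distrib]
      exact Finset.sum_congr rfl fun j _ => by ring
    refine (distToInt_le _ (-(∑ j, m j * γ.adjugate j i))).trans (le_of_eq ?_)
    rw [h2]; push_cast; ring_nf
  · intro i
    have h1 := congrFun (congrFun hrow 0) i
    rw [Phi, Matrix.diagonal_mul] at h1
    simp only [Fin.val_zero, if_true] at h1
    have h2 : ell (M0⁻¹)ᵀ (fun j => γ.adjugate j i) υ = (Kᵀ * (M0⁻¹ * γI)) 0 i := by
      simp only [ell, Matrix.mul_apply, Matrix.mulVec, dotProduct, Matrix.transpose_apply, hγI, Matrix.map_apply]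
      simp only [Finset.mul_sum]
      rw [Finset.sum_comm]
      refine Finset.sum_congr rfl fun a _ => Finset.sum_congr rfl fun j _ => ?_
      rw [hK, kMap_col n υ hυ h0]; ring
    rw [h2, h1, abs_mul, Real.abs_exp]
    have : Real.exp (-(((n+1:ℕ):ℝ) - 1) * t / ((n+1:ℕ):ℝ)) = Real.exp (-(n * t / (n+1))) := by
      congr 1; push_cast; ring
    rw [this]
    calc _ ≤ Real.exp (-(n * t / (n+1))) * (4^(n+1) / v i) :=
          mul_le_mul_of_nonneg_left (hWb 0 i) (Real.exp_pos _).le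
      _ = _ := by ring
  · intro i j
    have hvi := hv.1 i
    have h1 : ∀ a, |(Phi (n+1) t * W) a i| ≤ 4^(n+1) * Real.exp (t / (n+1)) / v i := by
      intro a
      rw [Phi, Matrix.diagonal_mul, abs_mul]
      have hle : |if (a:ℕ) = 0 then Real.exp (-(((n+1:ℕ):ℝ) - 1) * t / ((n+1:ℕ):ℝ)) else Real.exp (t / ((n+1:ℕ):ℝ))| ≤ Real.exp (t/(n+1)) := by
        split_ifs
        · rw [Real.abs_exp, Real.exp_le_exp]
          push_cast
          refine div_le_div_of_nonneg_right ?_ (by positivity)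
          have : 0 ≤ (n:ℝ) * t := by positivity
          nlinarith
        · rw [Real.abs_exp]; push_cast; rfl
      calc _ ≤ Real.exp (t/(n+1)) * (4^(n+1) / v i) :=
            mul_le_mul hle (hWb a i) (abs_nonneg _) (Real.exp_pos _).le
        _ = _ := by ring
    have h2 : ∀ a, |(K * (Phi (n+1) t * W)) a i| ≤ (n+1) * (4^(n+1) * Real.exp (t / (n+1)) / v i) := by
      intro a
      rw [Matrix.mul_apply]
      refine (Finset.abs_sum_le_sum_abs _ _).trans ?_
      have : ∀ c ∈ (Finset.univ : Finset (Fin (n+1))), |K a c * (Phi (n+1) t * W) c i| ≤ 4^(n+1) * Real.exp (t / (n+1)) / v i := by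
        intro c _
        rw [abs_mul]
        calc _ ≤ 1 * (4^(n+1) * Real.exp (t / (n+1)) / v i) :=
              mul_le_mul (orth_abs_le K hKo a c) (h1 c) (abs_nonneg _) (by norm_num)
          _ = _ := one_mul _
      refine (Finset.sum_le_sum this).trans (le_of_eq ?_)
      simp
    have h3 : ((γ.adjugate j i : ℤ) : ℝ) = (M0 *ᵥ (fun a => (K * (Phi (n+1) t * W)) a i)) j := by
      have := congrFun (congrFun hcol j) i
      rw [hγI, Matrix.map_apply, Matrix.mul_apply] at this
      exact this
    rw [h3]
    exact mulVec_le M0 _ _ (by positivity) h2 j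


lemma zeta_pos {n : ℕ} (ξ : Fin (n+1) → ℝ) (l : ℕ) : 1 ≤ zetaDio ξ ((2:ℝ)^l) := by
  have hne : {N : ℕ | ∃ m : Fin (n+1) → ℤ, m ≠ 0 ∧ (∀ i, |m i| ≤ (N : ℤ)) ∧
    distToInt (∑ i, ξ i * (m i : ℝ)) ≤ 1 / (2:ℝ)^l}.Nonempty := by
    obtain ⟨k, hk, hkn, h⟩ := Real.exists_nat_abs_mul_sub_round_le (ξ 0) (n := 2^l) (by positivity)
    refine ⟨k, Pi.single 0 (k:ℤ), ?_, ?_, ?_⟩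
    · intro h0
      have := congrFun h0 0
      simp at this; omega
    · intro i
      refine Fin.cases ?_ (fun j => ?_) i <;> simp
    · have : ∑ i, ξ i * ((Pi.single 0 (k:ℤ) : Fin (n+1) → ℤ) i : ℝ) = k * ξ 0 := by
        rw [Fin.sum_univ_succ]; simp; ring
      rw [this]
      refine h.trans ?_
      push_cast
      exact one_div_le_one_div_of_le (by positivity) (by linarith)
  have hmem := Nat.sInf_mem hne
  rw [Nat.one_le_iff_ne_zero]
  intro h0
  obtain ⟨m, hm, hm2, -⟩ := hmem
  apply hm
  ext i
  have h1 := hm2 i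
  have h2 : (sInf {N : ℕ | ∃ m : Fin (n+1) → ℤ, m ≠ 0 ∧ (∀ i, |m i| ≤ (N : ℤ)) ∧
    distToInt (∑ i, ξ i * (m i : ℝ)) ≤ 1 / (2:ℝ)^l}) = 0 := h0
  rw [h2] at h1
  simpa using h1

lemma exists_Z {n : ℕ} (hn : 1 ≤ n) (ξ : Fin (n+1) → ℝ) (η : ℝ)
    (hyp : η < ((n+1 : ℕ) : ℝ) ∨
      (η < ((n+1 : ℕ) : ℝ) + 1 ∧
        (n+1 = 2 → Summable (fun l : ℕ =>
          (2:ℝ) ^ ((η - 2) * ((l : ℝ) + 1)) * ((zetaDio ξ ((2:ℝ) ^ l) : ℝ))⁻¹ ^ 2)) ∧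
        (3 ≤ n+1 → Summable (fun l : ℕ =>
          ((l : ℝ) + 1) ^ (((n+1:ℕ) : ℝ) - 1) * (2:ℝ) ^ ((η - ((n+1:ℕ):ℝ)) * ((l : ℝ) + 1)) *
            ((zetaDio ξ ((2:ℝ) ^ l) : ℝ))⁻¹)))) :
    ∃ Z : ℕ → ℕ, (∀ l, 1 ≤ Z l) ∧
      (∀ l, ∀ m : Fin (n+1) → ℤ, m ≠ 0 → distToInt (∑ j, ξ j * (m j : ℝ)) ≤ 2^(n+1) / 2^l → ∃ j, (Z l : ℤ) ≤ |m j|) ∧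
      Summable (fun l : ℕ => (2:ℝ) ^ ((η - ((n+1:ℕ):ℝ)) * (l:ℝ)) * (((Z l : ℕ) : ℝ)⁻¹) ^ eExp (n+1)) := by
  rcases hyp with h | ⟨-, h2, h3⟩
  · refine ⟨fun _ => 1, fun _ => le_rfl, ?_, ?_⟩
    · intro l m hm _
      obtain ⟨j, hj⟩ := Function.ne_iff.mp hm
      exact ⟨j, by simpa using Int.one_le_abs hj⟩
    · simp only [Nat.cast_one, inv_one, one_pow, mul_one]
      have : ∀ l : ℕ, (2:ℝ) ^ ((η - ((n+1:ℕ):ℝ)) * (l:ℝ)) = ((2:ℝ) ^ (η - ((n+1:ℕ):ℝ)))^l := by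
        intro l; rw [Real.rpow_mul (by norm_num), Real.rpow_natCast]
      simp only [this]
      exact summable_geometric_of_lt_one (by positivity) (Real.rpow_lt_one_of_one_lt_of_neg (by norm_num) (by linarith))
  · refine ⟨fun l => zetaDio ξ ((2:ℝ)^(l - (n+1))), fun l => zeta_pos ξ _, ?_, ?_⟩
    · intro l m hm hd
      have hd' : distToInt (∑ j, ξ j * (m j : ℝ)) ≤ 1 / (2:ℝ)^(l - (n+1)) := by
        rcases le_total (n+1) l with hl | hl
        · refine hd.trans (le_of_eq ?_)
          rw [div_eq_div_iff (by positivity) (by positivity), ← pow_add, one_mul]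
          congr 1; omega
        · rw [Nat.sub_eq_zero_of_le hl]
          refine (abs_sub_round _).trans (by norm_num)
      obtain ⟨j, -, hj⟩ := Finset.exists_max_image Finset.univ (fun j => |m j|) ⟨0, Finset.mem_univ _⟩
      refine ⟨j, ?_⟩
      have : zetaDio ξ ((2:ℝ)^(l - (n+1))) ≤ (|m j|).toNat := by
        refine Nat.sInf_le ⟨m, hm, fun i => ?_, hd'⟩
        rw [Int.toNat_of_nonneg (abs_nonneg _)]
        exact hj i (Finset.mem_univ _)
      have h4 := Int.toNat_of_nonneg (abs_nonneg (m j))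
      rw [← h4]; exact_mod_cast this
    · rw [← summable_nat_add_iff (n+1)]
      have hz : ∀ l : ℕ, (0:ℝ) ≤ ((zetaDio ξ ((2:ℝ) ^ l) : ℝ))⁻¹ := fun l => by positivity
      have hsh : ∀ l : ℕ, (2:ℝ) ^ ((η - ((n+1:ℕ):ℝ)) * ((l + (n+1) : ℕ):ℝ)) = (2:ℝ) ^ ((η - ((n+1:ℕ):ℝ)) * n) * (2:ℝ) ^ ((η - ((n+1:ℕ):ℝ)) * ((l:ℝ)+1)) := by
        intro l; rw [← Real.rpow_add (by norm_num)]; congr 1; push_cast; ring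
      simp only [Nat.add_sub_cancel, hsh, mul_assoc]
      apply Summable.mul_left
      rcases eq_or_lt_of_le hn with h1 | h1
      · subst h1
        refine (h2 rfl).congr ?_
        intro l
        simp [eExp]
      · have he : eExp (n+1) = 1 := by simp [eExp]; omega
        rw [he]
        refine Summable.of_nonneg_of_le (fun l => by positivity) (fun l => ?_) (h3 (by omega))
        rw [pow_one, mul_assoc]
        refine le_mul_of_one_le_left (by positivity) ?_
        refine Real.one_le_rpow (by linarith [(Nat.cast_nonneg l : (0:ℝ) ≤ l)]) (by push_cast; linarith [(Nat.cast_nonneg n : (0:ℝ) ≤ n)])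


lemma Dq_ne_zero {d s : ℕ} (hs : s ≤ d) (q : Fin d → Fin d → ℤ) (hq : (Matrix.of q).det = 1) :
    Dq (fun i : Fin s => q (Fin.castLE hs i)) ≠ 0 := by
  intro h0
  have hz : ∀ J, (mJ (fun i : Fin s => q (Fin.castLE hs i)) J).det = 0 := by
    intro J
    have := le_Dq (fun i : Fin s => q (Fin.castLE hs i)) J
    rw [h0] at this
    simpa using this
  let A : Matrix (Fin d) (Fin d) ℤ := Matrix.of q
  have hA : A * A.adjugate = 1 := by rw [Matrix.mul_adjugate, hq, one_smul]
  let X : Matrix (Fin s) (Fin s) ℤ := Matrix.of fun j i => ∑ a, A.adjugate a (Fin.castLE hs j) * q (Fin.castLE hs i) a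
  have hX : X = 1 := by
    ext j i
    have := congrFun (congrFun hA (Fin.castLE hs i)) (Fin.castLE hs j)
    rw [Matrix.mul_apply] at this
    simp only [X, Matrix.of_apply]
    rw [show (∑ a, A.adjugate a (Fin.castLE hs j) * q (Fin.castLE hs i) a) = ∑ a, A (Fin.castLE hs i) a * A.adjugate a (Fin.castLE hs j) from Finset.sum_congr rfl fun a _ => mul_comm _ _, this]
    simp only [Matrix.one_apply, Fin.castLE_inj]
    simp [eq_comm]
  have hdet : X.det = 0 := by
    have e1 : X = fun j => ∑ a, A.adjugate a (Fin.castLE hs j) • (fun i : Fin s => q (Fin.castLE hs i) a) := by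
      ext j i
      simp [X]
    have e2 : X.det = (Matrix.detRowAlternating : (Fin s → ℤ) [⋀^Fin s]→ₗ[ℤ] ℤ).toMultilinearMap
        (fun j => ∑ a, A.adjugate a (Fin.castLE hs j) • (fun i : Fin s => q (Fin.castLE hs i) a)) := by
      rw [← e1]; rfl
    rw [e2, MultilinearMap.map_sum]
    refine Finset.sum_eq_zero fun J _ => ?_
    rw [MultilinearMap.map_smul_univ]
    have : (Matrix.detRowAlternating : (Fin s → ℤ) [⋀^Fin s]→ₗ[ℤ] ℤ).toMultilinearMap (fun j => (fun i : Fin s => q (Fin.castLE hs i) (J j))) = 0 := by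
      have h1 := hz J
      rw [← Matrix.det_transpose] at h1
      exact h1
    rw [this, smul_zero]
  rw [hX, Matrix.det_one] at hdet
  exact one_ne_zero hdet

lemma sVal_lt {d : ℕ} (hd : 2 ≤ d) (r : ℝ) (v : Fin d → ℝ) : sVal d r v < d := by
  have : sVal d r v ≤ d - 1 := by
    unfold sVal
    rcases Set.eq_empty_or_nonempty {s : ℕ | 1 ≤ s ∧ s ≤ d - 1 ∧ ∃ i : Fin d, (i : ℕ) + 1 = s ∧ 2 * cd' d * r < v i} with h | h
    · rw [h]; simp
    · exact csSup_le h fun s hs => hs.2.1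
  omega

lemma sVal_spec {d : ℕ} (r : ℝ) (v : Fin d → ℝ) (h : sVal d r v ≠ 0) :
    ∃ i : Fin d, (i:ℕ) + 1 = sVal d r v ∧ 2 * cd' d * r < v i := by
  have hne : {s : ℕ | 1 ≤ s ∧ s ≤ d - 1 ∧ ∃ i : Fin d, (i : ℕ) + 1 = s ∧ 2 * cd' d * r < v i}.Nonempty := by
    by_contra hc
    rw [Set.not_nonempty_iff_eq_empty] at hc
    apply h; unfold sVal; rw [hc]; simp
  have := Nat.sSup_mem hne ⟨d - 1, fun s hs => hs.2.1⟩
  exact this.2.2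

lemma prod_filter_castLE {d s : ℕ} (hs : s ≤ d) (f : Fin d → ℝ) :
    ∏ i ∈ Finset.univ.filter (fun i : Fin d => (i : ℕ) < s), f i = ∏ i : Fin s, f (Fin.castLE hs i) := by
  symm
  refine Finset.prod_bij (fun i _ => Fin.castLE hs i) ?_ ?_ ?_ ?_
  · intro i _; simp
  · intro i _ j _ h; exact Fin.castLE_injective hs h
  · intro i hi; exact ⟨⟨i, (Finset.mem_filter.mp hi).2⟩, Finset.mem_univ _, rfl⟩
  · intro i _; rfl

noncomputable def c0 (d : ℕ) (r : ℝ) : ℝ := 2 * cd' d * r / 2 ^ d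

lemma c0_pos {d : ℕ} (hd : 2 ≤ d) {r : ℝ} (hr : 0 < r) : 0 < c0 d r := by
  unfold c0 cd'
  have : (0:ℝ) < d := by exact_mod_cast (by omega : 0 < d)
  positivity

lemma Ffun_nonneg (d : ℕ) (R η r : ℝ) (v b : Fin d → ℝ) (hv : SiegelV d v) : 0 ≤ Ffun d R η r v b := by
  unfold Ffun
  refine mul_nonneg (by split_ifs <;> norm_num) (Finset.prod_nonneg fun i _ => mul_nonneg (Real.rpow_nonneg (hv.1 i).le _) (by split_ifs <;> norm_num))

/-- extraction of the data from nonvanishing of F -/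
lemma Ffun_data {d : ℕ} (hd : 2 ≤ d) (R η r : ℝ) (hR : 1 < R) (hη : 0 < η) (hr : 0 < r) (v b : Fin d → ℝ) (hv : SiegelV d v)
    (hF : Ffun d R η r v b ≠ 0) : ∃ s : ℕ, 1 ≤ s ∧ ∃ hs : s < d, ∃ l : Fin s → ℕ,
      (∀ i : Fin s, c0 d r * 2 ^ l i ≤ v (Fin.castLE hs.le i) ∧ v (Fin.castLE hs.le i) < c0 d r * 2 ^ (l i + 1)) ∧
      (∀ i : Fin s, |b (Fin.castLE hs.le i)| ≤ cd' d * r / v (Fin.castLE hs.le i)) ∧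
      R ≤ ∏ i : Fin s, (c0 d r * 2 ^ (l i + 1)) ∧
      Ffun d R η r v b ≤ ∏ i : Fin s, (c0 d r * 2 ^ (l i + 1)) ^ η := by
  have hc := c0_pos hd hr
  have hsl := sVal_lt hd r v
  unfold Ffun at hF ⊢
  rw [prod_filter_castLE hsl.le, prod_filter_castLE hsl.le] at hF ⊢
  have hF1 := left_ne_zero_of_mul hF
  have hF2 := right_ne_zero_of_mul hF
  have hRv : R ≤ ∏ i : Fin (sVal d r v), v (Fin.castLE hsl.le i) := by
    by_contra hc; simp [hc] at hF1
  have hbb : ∀ i : Fin (sVal d r v), |v (Fin.castLE hsl.le i) * b (Fin.castLE hsl.le i)| ≤ cd' d * r := by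
    intro i
    have := (Finset.prod_ne_zero_iff.mp hF2) i (Finset.mem_univ _)
    by_contra hc
    rw [if_neg hc, mul_zero] at this
    exact this rfl
  have hs0 : sVal d r v ≠ 0 := by
    intro h0
    have : ∏ i : Fin (sVal d r v), v (Fin.castLE hsl.le i) = 1 := by
      haveI : IsEmpty (Fin (sVal d r v)) := by rw [h0]; infer_instance
      exact Finset.prod_of_isEmpty _
    linarith
  obtain ⟨i0, hi0, hvi0⟩ := sVal_spec r v hs0
  have hlow : ∀ i : Fin (sVal d r v), c0 d r ≤ v (Fin.castLE hsl.le i) := by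
    intro i
    have hil := i.isLt
    have h1 := siegel_le hv (i0 - i) i0 (Fin.castLE hsl.le i) (by simp; omega)
    have h2 : (2:ℝ)^((i0:ℕ) - i) ≤ 2^d := pow_le_pow_right₀ (by norm_num) (by omega)
    have h3 := hv.1 (Fin.castLE hsl.le i)
    unfold c0
    rw [div_le_iff₀ (by positivity)]
    nlinarith
  have hex : ∀ i : Fin (sVal d r v), ∃ l : ℕ, c0 d r * 2 ^ l ≤ v (Fin.castLE hsl.le i) ∧ v (Fin.castLE hsl.le i) < c0 d r * 2 ^ (l + 1) := by
    intro i
    obtain ⟨l, h1, h2⟩ := exists_nat_pow_near (x := v (Fin.castLE hsl.le i) / c0 d r) (y := (2:ℝ)) (by rw [le_div_iff₀ hc, one_mul]; exact hlow i) (by norm_num)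
    refine ⟨l, ?_, ?_⟩
    · rw [le_div_iff₀ hc] at h1; linarith
    · rw [div_lt_iff₀ hc] at h2; linarith
  choose l hl using hex
  refine ⟨sVal d r v, Nat.one_le_iff_ne_zero.mpr hs0, hsl, l, hl, ?_, ?_, ?_⟩
  · intro i
    have h3 := hv.1 (Fin.castLE hsl.le i)
    rw [le_div_iff₀ h3]
    have := hbb i
    rw [abs_mul, abs_of_pos h3] at this
    linarith
  · exact hRv.trans (Finset.prod_le_prod (fun i _ => (hv.1 _).le) fun i _ => (hl i).2.le)
  · simp only [hRv, if_true, one_mul]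
    refine Finset.prod_le_prod (fun i _ => mul_nonneg (Real.rpow_nonneg (hv.1 _).le _) (by split_ifs <;> norm_num)) fun i _ => ?_
    simp only [hbb i, if_true, mul_one]
    exact Real.rpow_le_rpow (hv.1 _).le (hl i).2.le hη.le


noncomputable def C1 {n : ℕ} (M0 : Matrix (Fin (n+1)) (Fin (n+1)) ℝ) (r : ℝ) : ℝ :=
  mSum M0 * ((n+1) * 4^(n+1)) / c0 (n+1) r

noncomputable def NN {n : ℕ} (M0 : Matrix (Fin (n+1)) (Fin (n+1)) ℝ) (r t : ℝ) (l : ℕ) : ℕ :=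
  ⌊C1 M0 r * Real.exp (t / (n+1)) / 2^l⌋₊

noncomputable def QQ {n : ℕ} (ξ : Fin (n+1) → ℝ) (N l : ℕ) : Finset (Fin (n+1) → ℤ) :=
  (Fintype.piFinset fun _ => Finset.Icc (-(N:ℤ)) N).filter
    (fun q => distToInt (∑ j, ξ j * (q j : ℝ)) ≤ 2^n / 2^l)

lemma mem_QQ {n : ℕ} {ξ : Fin (n+1) → ℝ} {N l : ℕ} {q : Fin (n+1) → ℤ} :
    q ∈ QQ ξ N l ↔ (∀ j, |q j| ≤ N) ∧ distToInt (∑ j, ξ j * (q j : ℝ)) ≤ 2^n / 2^l := by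
  simp [QQ, Fintype.mem_piFinset, abs_le]

noncomputable def dl (n : ℕ) (r t : ℝ) (l : ℕ) : ℝ :=
  4 ^ (n+1) * Real.exp (-(n * t / (n+1))) / (c0 (n+1) r * 2^l)

def EE {n s : ℕ} (M : Matrix (Fin (n+1)) (Fin (n+1)) ℝ) (r t : ℝ) (l : Fin s → ℕ) (q : Fin s → Fin (n+1) → ℤ) :
    Set (Ed (n+1)) := {υ : Ed (n+1) | ∀ i, |ell M (q i) υ| ≤ dl n r t (l i)}

def Good {n s : ℕ} (M0 : Matrix (Fin (n+1)) (Fin (n+1)) ℝ) (r t : ℝ) (Z : ℕ → ℕ) (l : Fin s → ℕ) : Prop :=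
  (∀ i, Z (l i) ≤ NN M0 r t (l i)) ∧ ∀ i j, i ≤ j → (NN M0 r t (l i) : ℝ) ≤ 2^(n+3) * NN M0 r t (l j)

lemma cover {n : ℕ} (hn : 1 ≤ n) (ξ : Fin (n+1) → ℝ) (M0 : Matrix (Fin (n+1)) (Fin (n+1)) ℝ) (hM0 : M0.det = 1)
    (η r : ℝ) (hη : 0 < η) (hr : 0 < r)
    (vc bc : (Matrix (Fin (n+1)) (Fin (n+1)) ℝ × (Fin (n+1) → ℝ)) → (Fin (n+1) → ℝ))
    (hsec : IsSiegelSection (n+1) vc bc)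
    (Z : ℕ → ℕ) (hZ1 : ∀ l, 1 ≤ Z l)
    (hZ : ∀ l, ∀ m : Fin (n+1) → ℤ, m ≠ 0 → distToInt (∑ j, ξ j * (m j : ℝ)) ≤ 2^(n+1) / 2^l → ∃ j, (Z l : ℤ) ≤ |m j|)
    (R : ℝ) (hR : 1 < R)
    (υ : Ed (n+1)) (hυ : ‖υ‖ = 1) (h0 : 0 ≤ υ 0) (t : ℝ) (ht : 0 ≤ t)
    (hF : Ffun (n+1) R η r (vc (gEltSph (n+1) ξ M0 υ t)) (bc (gEltSph (n+1) ξ M0 υ t)) ≠ 0) :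
    ∃ s : ℕ, 1 ≤ s ∧ s ≤ n ∧ ∃ l : Fin s → ℕ, Good M0 r t Z l ∧
      R ≤ ∏ i : Fin s, (c0 (n+1) r * 2 ^ (l i + 1)) ∧
      ∃ q ∈ Fintype.piFinset (fun i => QQ ξ (NN M0 r t (l i)) (l i)), Dq q ≠ 0 ∧ υ ∈ EE (M0⁻¹)ᵀ r t l q ∧
      Ffun (n+1) R η r (vc (gEltSph (n+1) ξ M0 υ t)) (bc (gEltSph (n+1) ξ M0 υ t)) ≤ ∏ i : Fin s, (c0 (n+1) r * 2 ^ (l i + 1)) ^ η := by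
  obtain ⟨hv, q, hq, hq1, hq2, hq3⟩ := reduction ξ M0 hM0 vc bc hsec υ hυ h0 t ht
  obtain ⟨s, hs1, hs, l, hl, hb, hRl, hFl⟩ := Ffun_data (by omega : 2 ≤ n+1) R η r hR hη hr _ _ hv hF
  set v := vc (gEltSph (n+1) ξ M0 υ t)
  set b := bc (gEltSph (n+1) ξ M0 υ t)
  have hc := c0_pos (by omega : 2 ≤ n+1) hr
  have hm := one_le_mSum M0
  have hE : 0 < Real.exp (t/(n+1)) := Real.exp_pos _
  have hC1 : 0 < C1 M0 r := by unfold C1; positivity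
  have hNq : ∀ (i : Fin s) j, |q (Fin.castLE hs.le i) j| ≤ NN M0 r t (l i) := by
    intro i j
    have h1 := hq3 (Fin.castLE hs.le i) j
    have h2 : mSum M0 * ((n+1) * (4^(n+1) * Real.exp (t / (n+1)) / v (Fin.castLE hs.le i))) ≤ C1 M0 r * Real.exp (t / (n+1)) / 2^(l i) := by
      have e : C1 M0 r * Real.exp (t / (n+1)) / 2^(l i) = mSum M0 * ((n+1) * (4^(n+1) * Real.exp (t / (n+1)) / (c0 (n+1) r * 2^(l i)))) := by
        unfold C1; field_simp
      rw [e]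
      have := (hl i).1
      gcongr
    have h3 := Nat.le_floor (a := C1 M0 r * Real.exp (t / (n+1)) / 2^(l i)) (n := (q (Fin.castLE hs.le i) j).natAbs) (by
      rw [Nat.cast_natAbs]; push_cast; exact h1.trans h2)
    show _ ≤ ((⌊C1 M0 r * Real.exp (t / (n+1)) / 2^(l i)⌋₊ : ℕ) : ℤ)
    rw [Int.abs_eq_natAbs]; exact_mod_cast h3
  have hdist : ∀ i : Fin s, distToInt (∑ j, ξ j * (q (Fin.castLE hs.le i) j : ℝ)) ≤ 2^n / 2^(l i) := by
    intro i
    refine (hq1 _).trans ((hb i).trans ?_)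
    have e : (2:ℝ)^n / 2^(l i) = cd' (n+1) * r / (c0 (n+1) r * 2 ^ (l i)) := by
      have hcr : 0 < cd' (n+1) * r := by
        have := hc; unfold c0 at this
        have h2 := (div_pos_iff_of_pos_right (by positivity : (0:ℝ) < 2^(n+1))).mp this
        linarith
      have hcd : cd' (n+1) ≠ 0 := (left_ne_zero_of_mul hcr.ne')
      unfold c0
      rw [pow_succ]
      field_simp
    rw [e]
    have h3 := (hl i).1
    have hcr : 0 ≤ cd' (n+1) * r := by unfold cd'; positivity
    gcongr
  have hD := Dq_ne_zero hs.le q hq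
  have hqne : ∀ i : Fin s, q (Fin.castLE hs.le i) ≠ 0 := by
    intro i h
    have : (Matrix.of q).det = 0 := Matrix.det_eq_zero_of_row_eq_zero (Fin.castLE hs.le i) (fun j => by
      have := congrFun h j; simpa using this)
    rw [hq] at this; exact one_ne_zero this
  have hZN : ∀ i, Z (l i) ≤ NN M0 r t (l i) := by
    intro i
    obtain ⟨j, hj⟩ := hZ (l i) _ (hqne i) ((hdist i).trans (by gcongr <;> norm_num))
    exact_mod_cast hj.trans (hNq i j)
  refine ⟨s, hs1, by omega, l, ⟨hZN, ?_⟩, hRl, fun i => q (Fin.castLE hs.le i), ?_, hD, ?_, hFl⟩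
  · intro i j hij
    set X := C1 M0 r * Real.exp (t / (n+1)) with hX
    have hXp : 0 < X := by positivity
    have h1 : (NN M0 r t (l i) : ℝ) ≤ X / 2^(l i) := Nat.floor_le (by positivity)
    have h2 : X / 2^(l j) < (NN M0 r t (l j) : ℝ) + 1 := Nat.lt_floor_add_one _
    have h3 : (1:ℝ) ≤ NN M0 r t (l j) := by exact_mod_cast (hZ1 _).trans (hZN j)
    have h4 := siegel_le hv (j - i) (Fin.castLE hs.le j) (Fin.castLE hs.le i) (by simp; have : (i:ℕ) ≤ j := hij; omega)
    have h5 : (2:ℝ)^((j:ℕ) - i) ≤ 2^(n+1) := pow_le_pow_right₀ (by norm_num) (by omega)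
    have h6 := (hl j).1
    have h7 := (hl i).2
    have h8 := hv.1 (Fin.castLE hs.le i)
    have h9 : c0 (n+1) r * 2 ^ l j ≤ c0 (n+1) r * (2^(n+2) * 2^(l i)) := by
      calc _ ≤ _ := h6
        _ ≤ 2^((j:ℕ) - i) * v (Fin.castLE hs.le i) := h4
        _ ≤ 2^(n+1) * (c0 (n+1) r * 2^(l i + 1)) := by gcongr
        _ = _ := by ring
    have h10 := le_of_mul_le_mul_left h9 hc
    have h11 : X / 2^(l i) ≤ 2^(n+2) * (X / 2^(l j)) := by
      rw [mul_div_assoc', div_le_div_iff₀ (by positivity) (by positivity)]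
      nlinarith
    have h12 : (2:ℝ)^(n+3) = 2^(n+2) * 2 := by ring
    have h13 : (0:ℝ) < 2^(n+2) := by positivity
    nlinarith
  · rw [Fintype.mem_piFinset]
    intro i
    exact mem_QQ.mpr ⟨hNq i, hdist i⟩
  · intro i
    refine (hq2 _).trans ?_
    have h6 := (hl i).1
    unfold dl
    gcongr

lemma sum_tail (a : ℕ → ℝ) (ha : ∀ l, 0 ≤ a l) (hs : Summable a) (s P B : ℕ) :
    ∑ l ∈ (Fintype.piFinset fun _ : Fin s => Finset.range B).filter (fun l => ∃ i, P ≤ l i), ∏ i, a (l i) ≤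
      s * ((∑' l, a l) + 1) ^ s * ∑' l, a (l + P) := by
  have hA : 0 ≤ ∑' l, a l := tsum_nonneg ha
  have hT : 0 ≤ ∑' l, a (l + P) := tsum_nonneg fun l => ha _
  have hsub : (Fintype.piFinset fun _ : Fin s => Finset.range B).filter (fun l => ∃ i, P ≤ l i) ⊆
      Finset.univ.biUnion (fun i : Fin s => Fintype.piFinset fun j : Fin s => if j = i then Finset.Ico P B else Finset.range B) := by
    intro l hl
    obtain ⟨h1, i, hi⟩ := Finset.mem_filter.mp hl
    rw [Fintype.mem_piFinset] at h1
    refine Finset.mem_biUnion.mpr ⟨i, Finset.mem_univ _, ?_⟩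
    rw [Fintype.mem_piFinset]
    intro j
    split_ifs with h
    · subst h; exact Finset.mem_Ico.mpr ⟨hi, Finset.mem_range.mp (h1 j)⟩
    · exact h1 j
  refine (Finset.sum_le_sum_of_subset_of_nonneg hsub fun l _ _ => Finset.prod_nonneg fun i _ => ha _).trans ?_
  refine (sum_biUnion_le' _ _ _ fun l => Finset.prod_nonneg fun i _ => ha _).trans ?_
  have hi : ∀ i ∈ (Finset.univ : Finset (Fin s)), ∑ l ∈ (Fintype.piFinset fun j : Fin s => if j = i then Finset.Ico P B else Finset.range B), ∏ j, a (l j) ≤ ((∑' l, a l) + 1) ^ s * ∑' l, a (l + P) := by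
    intro i _
    rw [← Finset.prod_univ_sum (fun j : Fin s => if j = i then Finset.Ico P B else Finset.range B) (fun _ x => a x)]
    rw [← Finset.mul_prod_erase _ _ (Finset.mem_univ i), mul_comm]
    refine mul_le_mul ?_ ?_ (Finset.sum_nonneg fun _ _ => ha _) (by positivity)
    · have : ∀ j ∈ Finset.univ.erase i, ∑ x ∈ (if j = i then Finset.Ico P B else Finset.range B), a x ≤ (∑' l, a l) + 1 := by
        intro j hj
        rw [if_neg (Finset.ne_of_mem_erase hj)]
        have := hs.sum_le_tsum (Finset.range B) (fun i _ => ha i)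
        linarith
      refine (Finset.prod_le_prod (fun j _ => Finset.sum_nonneg fun _ _ => ha _) this).trans ?_
      rw [Finset.prod_const]
      refine pow_le_pow_right₀ (by linarith) ?_
      exact (Finset.card_le_univ _).trans (by simp)
    · rw [if_pos rfl, Finset.sum_Ico_eq_sum_range]
      simp only [add_comm P]
      exact ((summable_nat_add_iff P).mpr hs).sum_le_tsum _ (fun i _ => ha _)
  refine (Finset.sum_le_sum hi).trans (le_of_eq ?_)
  simp; ring


lemma distToInt_sub (x y : ℝ) : distToInt (x - y) ≤ distToInt x + distToInt y := by
  refine (distToInt_le (x - y) (round x - round y)).trans ?_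
  unfold distToInt
  push_cast
  rw [show x - y - ((round x : ℝ) - round y) = (x - round x) - (y - round y) by ring]
  exact abs_sub _ _

lemma sum_part {n s : ℕ} (hs1 : 1 ≤ s) (hsn : s ≤ n) (ξ : Fin (n+1) → ℝ) (M0 : Matrix (Fin (n+1)) (Fin (n+1)) ℝ)
    (η r : ℝ) (hr : 0 < r)
    (Z : ℕ → ℕ) (hZ1 : ∀ l, 1 ≤ Z l)
    (hZ : ∀ l, ∀ m : Fin (n+1) → ℤ, m ≠ 0 → distToInt (∑ j, ξ j * (m j : ℝ)) ≤ 2^(n+1) / 2^l → ∃ j, (Z l : ℤ) ≤ |m j|)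
    (hsum : Summable (fun l : ℕ => (2:ℝ) ^ ((η - ((n+1:ℕ):ℝ)) * (l:ℝ)) * (((Z l : ℕ) : ℝ)⁻¹) ^ eExp (n+1))) :
    ∃ G : ℝ, 0 ≤ G ∧ ∀ (t : ℝ) (P B : ℕ),
      ∑ l ∈ (Fintype.piFinset fun _ : Fin s => Finset.range B).filter (fun l => Good M0 r t Z l ∧ ∃ i, P ≤ l i),
        ∑ q ∈ (Fintype.piFinset (fun i => QQ ξ (NN M0 r t (l i)) (l i))).filter (fun q => Dq q ≠ 0),
          (∏ i, (c0 (n+1) r * 2 ^ (l i + 1)) ^ η) * ((∏ i, dl n r t (l i)) / (Dq q : ℝ)) ≤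
      G * ∑' l : ℕ, (2:ℝ) ^ ((η - ((n+1:ℕ):ℝ)) * ((l + P : ℕ):ℝ)) * (((Z (l + P) : ℕ) : ℝ)⁻¹) ^ eExp (n+1) := by
  obtain ⟨C, hC, hCount⟩ := lemCount (n+1) s (by omega) hs1 (by omega) (2^(n+3)) (one_le_pow₀ (by norm_num))
  set a : ℕ → ℝ := fun l : ℕ => (2:ℝ) ^ ((η - ((n+1:ℕ):ℝ)) * (l:ℝ)) * (((Z l : ℕ) : ℝ)⁻¹) ^ eExp (n+1) with ha
  have ha0 : ∀ l, 0 ≤ a l := fun l => by simp only [ha]; positivity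
  have hc := c0_pos (by omega : 2 ≤ n+1) hr
  have hm := one_le_mSum M0
  have hC1 : 0 < C1 M0 r := by unfold C1; positivity
  set A0 : ℝ := (2 * c0 (n+1) r) ^ η * (4^(n+1) / c0 (n+1) r) * (C1 M0 r)^n with hA0
  have hA0p : 0 ≤ A0 := by positivity
  have hdl : ∀ t l, 0 ≤ dl n r t l := fun t l => by unfold dl; positivity
  have key : ∀ t l, (c0 (n+1) r * 2 ^ (l + 1)) ^ η * dl n r t l * ((NN M0 r t l : ℝ)^n * ((Z l : ℝ)⁻¹) ^ eExp (n+1)) ≤ A0 * a l := by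
    intro t l
    set E := Real.exp (t/(n+1)) with hE
    have hEp : 0 < E := Real.exp_pos _
    have h1 : (NN M0 r t l : ℝ) ≤ C1 M0 r * E / 2^l := Nat.floor_le (by positivity)
    have h2 : (c0 (n+1) r * 2 ^ (l + 1)) ^ η = (2 * c0 (n+1) r) ^ η * (2:ℝ) ^ (η * l) := by
      rw [Real.rpow_mul_natCast (by norm_num), Real.rpow_pow_comm (by norm_num), ← Real.mul_rpow (by positivity) (by positivity)]
      congr 1; ring
    have h3 : Real.exp (-(n * t / (n+1))) = (E^n)⁻¹ := by
      rw [hE, ← Real.exp_nat_mul, ← Real.exp_neg]; congr 1; ring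
    have h4 : (2:ℝ) ^ ((η - ((n+1:ℕ):ℝ)) * (l:ℝ)) = (2:ℝ) ^ (η * l) / ((2:ℝ)^l)^(n+1) := by
      rw [sub_mul, Real.rpow_sub (by norm_num), mul_comm ((n+1:ℕ):ℝ), Real.rpow_mul (by norm_num) (l:ℝ), Real.rpow_natCast, Real.rpow_natCast]
    calc _ ≤ (c0 (n+1) r * 2 ^ (l + 1)) ^ η * dl n r t l * ((C1 M0 r * E / 2^l)^n * ((Z l : ℝ)⁻¹) ^ eExp (n+1)) := by
          have := hdl t l
          gcongr
      _ = A0 * a l := by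
          simp only [ha, h4, h2, dl, h3, hA0, div_pow, mul_pow]
          generalize ((Z l : ℝ)⁻¹) ^ eExp (n+1) = z
          field_simp
          ring
  refine ⟨C * A0^s * (s * ((∑' l, a l) + 1) ^ s), by
    have : 0 ≤ ∑' l, a l := tsum_nonneg ha0
    positivity, fun t P B => ?_⟩
  have hl : ∀ l ∈ (Fintype.piFinset fun _ : Fin s => Finset.range B).filter (fun l => Good M0 r t Z l ∧ ∃ i, P ≤ l i),
      ∑ q ∈ (Fintype.piFinset (fun i => QQ ξ (NN M0 r t (l i)) (l i))).filter (fun q => Dq q ≠ 0),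
          (∏ i, (c0 (n+1) r * 2 ^ (l i + 1)) ^ η) * ((∏ i, dl n r t (l i)) / (Dq q : ℝ)) ≤ C * A0^s * ∏ i, a (l i) := by
    intro l hl
    obtain ⟨-, hg, -⟩ := Finset.mem_filter.mp hl
    have h1 := hCount (fun i => NN M0 r t (l i)) (fun i => Z (l i)) (fun i => QQ ξ (NN M0 r t (l i)) (l i))
      (fun i => hZ1 _) hg.1 hg.2 (fun i q hq => (mem_QQ.mp hq).1) (by
        intro i q hq q' hq' hne
        have := hZ (l i) (q - q') (sub_ne_zero.mpr hne) (by
          have e : ∑ j, ξ j * (((q - q') j : ℤ) : ℝ) = ∑ j, ξ j * (q j : ℝ) - ∑ j, ξ j * (q' j : ℝ) := by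
            rw [← Finset.sum_sub_distrib]
            exact Finset.sum_congr rfl fun j _ => by simp; ring
          rw [e]
          refine (distToInt_sub _ _).trans ((add_le_add (mem_QQ.mp hq).2 (mem_QQ.mp hq').2).trans (le_of_eq ?_))
          rw [pow_succ]; ring)
        simpa using this) (by
        intro i q hq hne
        refine hZ (l i) q hne ((mem_QQ.mp hq).2.trans ?_)
        gcongr
        · norm_num
        · omega)
    have e1 : ∀ q : Fin s → Fin (n+1) → ℤ, (∏ i, (c0 (n+1) r * 2 ^ (l i + 1)) ^ η) * ((∏ i, dl n r t (l i)) / (Dq q : ℝ)) =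
        ((∏ i, (c0 (n+1) r * 2 ^ (l i + 1)) ^ η) * (∏ i, dl n r t (l i))) * (Dq q : ℝ)⁻¹ := fun q => by ring
    simp only [e1]
    rw [← Finset.mul_sum, ← Finset.prod_mul_distrib]
    have hp : 0 ≤ ∏ i, ((c0 (n+1) r * 2 ^ (l i + 1)) ^ η * dl n r t (l i)) :=
      Finset.prod_nonneg fun i _ => mul_nonneg (by positivity) (hdl _ _)
    refine (mul_le_mul_of_nonneg_left h1 hp).trans ?_
    rw [mul_left_comm, ← Finset.prod_mul_distrib, mul_assoc]
    refine mul_le_mul_of_nonneg_left ?_ hC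
    have e2 : A0^s * ∏ i, a (l i) = ∏ i, (A0 * a (l i)) := by
      rw [Finset.prod_mul_distrib (f := fun _ : Fin s => A0) (g := fun i => a (l i)), Finset.prod_const, Finset.card_univ, Fintype.card_fin]
    rw [e2]
    refine Finset.prod_le_prod (fun i _ => ?_) fun i _ => key t (l i)
    have := hdl t (l i)
    positivity
  refine (Finset.sum_le_sum hl).trans ?_
  rw [← Finset.mul_sum, mul_assoc (C * A0^s)]
  refine mul_le_mul_of_nonneg_left ?_ (mul_nonneg hC (pow_nonneg hA0p s))
  refine le_trans ?_ (sum_tail a ha0 hsum s P B)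
  refine Finset.sum_le_sum_of_subset_of_nonneg ?_ fun l _ _ => Finset.prod_nonneg fun i _ => ha0 _
  intro l hl
  obtain ⟨h1, h2, h3⟩ := Finset.mem_filter.mp hl
  exact Finset.mem_filter.mpr ⟨h1, h3⟩


lemma lam_bound {d : ℕ} (lam : Measure (Ed d)) (h : HasContinuousDensity d lam) :
    (∀ᵐ υ ∂lam, ‖υ‖ = 1) ∧ ∃ K : ℝ, 0 ≤ K ∧ ∀ A, MeasurableSet A → lam A ≤ ENNReal.ofReal K * sphSurf d A := by
  obtain ⟨f, hf, hf0, rfl⟩ := h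
  have hsph : ∀ᵐ υ ∂(sphSurf d), υ ∈ Metric.sphere (0 : Ed d) 1 :=
    ae_restrict_mem Metric.isClosed_sphere.measurableSet
  refine ⟨?_, ?_⟩
  · filter_upwards [(withDensity_absolutelyContinuous _ _).ae_le hsph] with υ hυ
    simpa using hυ
  · obtain ⟨K, hK⟩ := (isCompact_sphere (0 : Ed d) 1).bddAbove_image hf.continuousOn
    refine ⟨max K 0, le_max_right _ _, fun A hA => ?_⟩
    rw [withDensity_apply _ hA, ← setLIntegral_const]
    refine lintegral_mono_ae (ae_restrict_of_ae ?_)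
    filter_upwards [hsph] with υ hυ
    exact ENNReal.ofReal_le_ofReal ((hK ⟨υ, hυ, rfl⟩).trans (le_max_left _ _))

lemma measurable_EE {n s : ℕ} (M : Matrix (Fin (n+1)) (Fin (n+1)) ℝ) (r t : ℝ) (l : Fin s → ℕ) (q : Fin s → Fin (n+1) → ℤ) :
    MeasurableSet (EE M r t l q) := by
  apply IsClosed.measurableSet
  have : EE M r t l q = ⋂ i, {υ : Ed (n+1) | |ell M (q i) υ| ≤ dl n r t (l i)} := by
    ext υ; simp [EE]
  rw [this]
  refine isClosed_iInter fun i => isClosed_le ?_ continuous_const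
  have h1 : Continuous fun υ : Ed (n+1) => (υ : Fin (n+1) → ℝ) := PiLp.continuous_ofLp 2 _
  exact ((continuous_ell M (q i)).comp h1).abs

lemma main_bound {n : ℕ} (hn : 1 ≤ n) (ξ : Fin (n+1) → ℝ) (M0 : Matrix (Fin (n+1)) (Fin (n+1)) ℝ) (hM0 : M0.det = 1)
    (η r : ℝ) (hη : 0 < η) (hr : 0 < r)
    (lam : Measure (Ed (n+1))) (hlam : HasContinuousDensity (n+1) lam)
    (vc bc : (Matrix (Fin (n+1)) (Fin (n+1)) ℝ × (Fin (n+1) → ℝ)) → (Fin (n+1) → ℝ))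
    (hsec : IsSiegelSection (n+1) vc bc)
    (Z : ℕ → ℕ) (hZ1 : ∀ l, 1 ≤ Z l)
    (hZ : ∀ l, ∀ m : Fin (n+1) → ℤ, m ≠ 0 → distToInt (∑ j, ξ j * (m j : ℝ)) ≤ 2^(n+1) / 2^l → ∃ j, (Z l : ℤ) ≤ |m j|)
    (hsum : Summable (fun l : ℕ => (2:ℝ) ^ ((η - ((n+1:ℕ):ℝ)) * (l:ℝ)) * (((Z l : ℕ) : ℝ)⁻¹) ^ eExp (n+1))) :
    ∃ G : ℝ, 0 ≤ G ∧ ∀ P : ℕ, ∃ R0 : ℝ, ∀ R ≥ R0, ∀ t : ℝ, 0 ≤ t →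
      |∫ υ in {υ : Ed (n+1) | 0 ≤ υ 0},
          Ffun (n+1) R η r (vc (gEltSph (n+1) ξ M0 υ t)) (bc (gEltSph (n+1) ξ M0 υ t)) ∂lam| ≤
      G * ∑' l : ℕ, (2:ℝ) ^ ((η - ((n+1:ℕ):ℝ)) * ((l + P : ℕ):ℝ)) * (((Z (l + P) : ℕ) : ℝ)⁻¹) ^ eExp (n+1) := by
  obtain ⟨hae, K, hK0, hK⟩ := lam_bound lam hlam
  have hdet : ((M0⁻¹)ᵀ).det = 1 := by
    rw [Matrix.det_transpose, Matrix.det_nonsing_inv, hM0]; simp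
  have hV := fun s : ℕ => vol_sphere (n := n) (s := s) (M0⁻¹)ᵀ hdet
  choose CV hCV0 hCV using hV
  have hS : ∀ s : ℕ, ∃ G : ℝ, 0 ≤ G ∧ (1 ≤ s → s ≤ n → ∀ (t : ℝ) (P B : ℕ),
      ∑ l ∈ (Fintype.piFinset fun _ : Fin s => Finset.range B).filter (fun l => Good M0 r t Z l ∧ ∃ i, P ≤ l i),
        ∑ q ∈ (Fintype.piFinset (fun i => QQ ξ (NN M0 r t (l i)) (l i))).filter (fun q => Dq q ≠ 0),
          (∏ i, (c0 (n+1) r * 2 ^ (l i + 1)) ^ η) * ((∏ i, dl n r t (l i)) / (Dq q : ℝ)) ≤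
      G * ∑' l : ℕ, (2:ℝ) ^ ((η - ((n+1:ℕ):ℝ)) * ((l + P : ℕ):ℝ)) * (((Z (l + P) : ℕ) : ℝ)⁻¹) ^ eExp (n+1)) := by
    intro s
    by_cases h : 1 ≤ s ∧ s ≤ n
    · obtain ⟨G, h1, h2⟩ := sum_part h.1 h.2 ξ M0 η r hr Z hZ1 hZ hsum
      exact ⟨G, h1, fun _ _ => h2⟩
    · exact ⟨0, le_rfl, fun h1 h2 => absurd ⟨h1, h2⟩ h⟩
  choose GS hGS0 hGS using hS
  have hc := c0_pos (by omega : 2 ≤ n+1) hr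
  have hm := one_le_mSum M0
  have hC1 : 0 < C1 M0 r := by unfold C1; positivity
  have hdl : ∀ t l, 0 ≤ dl n r t l := fun t l => by unfold dl; positivity
  refine ⟨∑ s ∈ Finset.Icc 1 n, K * CV s * GS s, Finset.sum_nonneg fun s _ => mul_nonneg (mul_nonneg hK0 (hCV0 s)) (hGS0 s), fun P => ?_⟩
  set T := ∑' l : ℕ, (2:ℝ) ^ ((η - ((n+1:ℕ):ℝ)) * ((l + P : ℕ):ℝ)) * (((Z (l + P) : ℕ) : ℝ)⁻¹) ^ eExp (n+1) with hT
  have hT0 : 0 ≤ T := tsum_nonneg fun l => by positivity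
  refine ⟨(max 1 (c0 (n+1) r * 2^P))^n + 1, fun R hR t ht => ?_⟩
  have hmax : (1:ℝ) ≤ max 1 (c0 (n+1) r * 2^P) := le_max_left _ _
  have hR1 : 1 < R := by
    have := one_le_pow₀ (n := n) hmax
    linarith
  obtain ⟨B, hB⟩ := pow_unbounded_of_one_lt (C1 M0 r * Real.exp (t/(n+1))) (one_lt_two : (1:ℝ) < 2)
  let LL : (s : ℕ) → Finset (Fin s → ℕ) := fun s => (Fintype.piFinset fun _ : Fin s => Finset.range B).filter (fun l => Good M0 r t Z l ∧ ∃ i, P ≤ l i)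
  let QL : (s : ℕ) → (Fin s → ℕ) → Finset (Fin s → Fin (n+1) → ℤ) := fun s l =>
    (Fintype.piFinset (fun i => QQ ξ (NN M0 r t (l i)) (l i))).filter (fun q => Dq q ≠ 0)
  let WW : (s : ℕ) → (Fin s → ℕ) → ℝ := fun s l => ∏ i, (c0 (n+1) r * 2 ^ (l i + 1)) ^ η
  have hWW : ∀ s l, 0 ≤ WW s l := fun s l => Finset.prod_nonneg fun i _ => by positivity
  have hint : ∫⁻ υ in {υ : Ed (n+1) | 0 ≤ υ 0}, ENNReal.ofReal ‖Ffun (n+1) R η r (vc (gEltSph (n+1) ξ M0 υ t)) (bc (gEltSph (n+1) ξ M0 υ t))‖ ∂lam ≤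
      ENNReal.ofReal ((∑ s ∈ Finset.Icc 1 n, K * CV s * GS s) * T) := by
    have hmeas : MeasurableSet {υ : Ed (n+1) | 0 ≤ υ 0} := by
      apply IsClosed.measurableSet
      exact isClosed_le continuous_const (by fun_prop)
    have hpt : ∀ᵐ υ ∂(lam.restrict {υ : Ed (n+1) | 0 ≤ υ 0}),
        ENNReal.ofReal ‖Ffun (n+1) R η r (vc (gEltSph (n+1) ξ M0 υ t)) (bc (gEltSph (n+1) ξ M0 υ t))‖ ≤
        ∑ s ∈ Finset.Icc 1 n, ∑ l ∈ LL s, ∑ q ∈ QL s l, (EE (M0⁻¹)ᵀ r t l q).indicator (fun _ => ENNReal.ofReal (WW s l)) υ := by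
      filter_upwards [ae_restrict_mem hmeas, ae_restrict_of_ae hae] with υ h0 hυ
      by_cases hF : Ffun (n+1) R η r (vc (gEltSph (n+1) ξ M0 υ t)) (bc (gEltSph (n+1) ξ M0 υ t)) = 0
      · rw [hF]; simp
      obtain ⟨s, hs1, hsn, l, hg, hRl, q, hq, hD, hE, hFl⟩ := cover hn ξ M0 hM0 η r hη hr vc bc hsec Z hZ1 hZ R hR1 υ hυ h0 t ht hF
      have hFnn := Ffun_nonneg (n+1) R η r (vc (gEltSph (n+1) ξ M0 υ t)) (bc (gEltSph (n+1) ξ M0 υ t)) (reduction ξ M0 hM0 vc bc hsec υ hυ h0 t ht).1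
      have hlB : ∀ i, l i < B := by
        intro i
        have h1 : 1 ≤ NN M0 r t (l i) := (hZ1 _).trans (hg.1 i)
        have h2 : ((1:ℕ):ℝ) ≤ C1 M0 r * Real.exp (t/(n+1)) / 2^(l i) := (Nat.le_floor_iff (by positivity)).mp h1
        rw [Nat.cast_one, le_div_iff₀ (by positivity), one_mul] at h2
        exact (pow_lt_pow_iff_right₀ (one_lt_two : (1:ℝ) < 2)).mp (h2.trans_lt hB)
      have hP : ∃ i, P ≤ l i := by
        by_contra hcon
        push Not at hcon
        have h1 : ∏ i : Fin s, (c0 (n+1) r * 2 ^ (l i + 1)) ≤ ∏ i : Fin s, max 1 (c0 (n+1) r * 2^P) := by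
          refine Finset.prod_le_prod (fun i _ => by positivity) fun i _ => le_trans ?_ (le_max_right _ _)
          have := hcon i
          gcongr
          · norm_num
          · omega
        rw [Finset.prod_const, Finset.card_univ, Fintype.card_fin] at h1
        have h2 := pow_le_pow_right₀ hmax hsn
        linarith
      have hlL : l ∈ LL s := Finset.mem_filter.mpr ⟨Fintype.mem_piFinset.mpr fun i => Finset.mem_range.mpr (hlB i), hg, hP⟩
      have hqL : q ∈ QL s l := Finset.mem_filter.mpr ⟨hq, hD⟩
      calc _ ≤ ENNReal.ofReal (WW s l) := by
            rw [Real.norm_of_nonneg hFnn]; exact ENNReal.ofReal_le_ofReal hFl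
        _ = (EE (M0⁻¹)ᵀ r t l q).indicator (fun _ => ENNReal.ofReal (WW s l)) υ := by rw [Set.indicator_of_mem hE]
        _ ≤ ∑ q ∈ QL s l, (EE (M0⁻¹)ᵀ r t l q).indicator (fun _ => ENNReal.ofReal (WW s l)) υ :=
            Finset.single_le_sum (f := fun q => (EE (M0⁻¹)ᵀ r t l q).indicator (fun _ => ENNReal.ofReal (WW s l)) υ) (fun _ _ => zero_le) hqL
        _ ≤ ∑ l ∈ LL s, ∑ q ∈ QL s l, (EE (M0⁻¹)ᵀ r t l q).indicator (fun _ => ENNReal.ofReal (WW s l)) υ :=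
            Finset.single_le_sum (f := fun l => ∑ q ∈ QL s l, (EE (M0⁻¹)ᵀ r t l q).indicator (fun _ => ENNReal.ofReal (WW s l)) υ) (fun _ _ => zero_le) hlL
        _ ≤ _ := Finset.single_le_sum (f := fun s => ∑ l ∈ LL s, ∑ q ∈ QL s l, (EE (M0⁻¹)ᵀ r t l q).indicator (fun _ => ENNReal.ofReal (WW s l)) υ) (fun _ _ => zero_le) (Finset.mem_Icc.mpr ⟨hs1, hsn⟩)
    have hmi : ∀ s (l : Fin s → ℕ) q, Measurable ((EE (M0⁻¹)ᵀ r t l q).indicator (fun _ => ENNReal.ofReal (WW s l))) :=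
      fun s l q => measurable_const.indicator (measurable_EE _ r t l q)
    refine (lintegral_mono_ae hpt).trans ?_
    rw [lintegral_finsetSum _ (fun s _ => Finset.measurable_fun_sum _ fun l _ => Finset.measurable_fun_sum _ fun q _ => hmi s l q),
      Finset.sum_mul, ENNReal.ofReal_sum_of_nonneg (fun s _ => mul_nonneg (mul_nonneg (mul_nonneg hK0 (hCV0 s)) (hGS0 s)) hT0)]
    refine Finset.sum_le_sum fun s hs => ?_
    obtain ⟨hs1, hsn⟩ := Finset.mem_Icc.mp hs
    rw [lintegral_finsetSum _ (fun l _ => Finset.measurable_fun_sum _ fun q _ => hmi s l q)]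
    have hq : ∀ l ∈ LL s, ∫⁻ υ in {υ : Ed (n+1) | 0 ≤ υ 0}, ∑ q ∈ QL s l, (EE (M0⁻¹)ᵀ r t l q).indicator (fun _ => ENNReal.ofReal (WW s l)) υ ∂lam ≤
        ENNReal.ofReal (K * CV s * ∑ q ∈ QL s l, WW s l * ((∏ i, dl n r t (l i)) / (Dq q : ℝ))) := by
      intro l _
      rw [lintegral_finsetSum _ (fun q _ => hmi s l q), Finset.mul_sum, ENNReal.ofReal_sum_of_nonneg]
      · refine Finset.sum_le_sum fun q hq => ?_
        obtain ⟨-, hD⟩ := Finset.mem_filter.mp hq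
        obtain ⟨J, hJ⟩ := exists_Dq q hD
        have hJ0 : (mJ q J).det ≠ 0 := by
          intro h; rw [h] at hJ; exact hD (by simpa using hJ.symm)
        have hJa : |((mJ q J).det : ℝ)| = (Dq q : ℝ) := by
          rw [← hJ, Nat.cast_natAbs]; push_cast; rfl
        have hv := hCV s q J hJ0 (fun i => dl n r t (l i)) (fun i => hdl _ _)
        rw [hJa] at hv
        rw [lintegral_indicator (measurable_EE _ r t l q), setLIntegral_const]
        have h1 : (lam.restrict {υ : Ed (n+1) | 0 ≤ υ 0}) (EE (M0⁻¹)ᵀ r t l q) ≤ ENNReal.ofReal K * ENNReal.ofReal (CV s * ((∏ i, dl n r t (l i)) / (Dq q : ℝ))) := by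
          refine (Measure.restrict_le_self _).trans ((hK _ (measurable_EE _ r t l q)).trans ?_)
          gcongr
          exact hv
        refine (mul_le_mul_right h1 _).trans (le_of_eq ?_)
        rw [← ENNReal.ofReal_mul hK0, ← ENNReal.ofReal_mul (hWW s l)]
        congr 1; ring
      · intro q _
        exact mul_nonneg (mul_nonneg hK0 (hCV0 s)) (mul_nonneg (hWW s l) (div_nonneg (Finset.prod_nonneg fun i _ => hdl _ _) (Nat.cast_nonneg _)))
    refine (Finset.sum_le_sum hq).trans ?_
    rw [← ENNReal.ofReal_sum_of_nonneg]
    · apply ENNReal.ofReal_le_ofReal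
      rw [← Finset.mul_sum, mul_assoc (K * CV s)]
      exact mul_le_mul_of_nonneg_left (hGS s hs1 hsn t P B) (mul_nonneg hK0 (hCV0 s))
    · intro l _
      exact mul_nonneg (mul_nonneg hK0 (hCV0 s)) (Finset.sum_nonneg fun q _ => (mul_nonneg (hWW s l) (div_nonneg (Finset.prod_nonneg fun i _ => hdl _ _) (Nat.cast_nonneg _))))
  have h1 := norm_integral_le_lintegral_norm (μ := lam.restrict {υ : Ed (n+1) | 0 ≤ υ 0}) (fun υ => Ffun (n+1) R η r (vc (gEltSph (n+1) ξ M0 υ t)) (bc (gEltSph (n+1) ξ M0 υ t)))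
  rw [Real.norm_eq_abs] at h1
  refine h1.trans (ENNReal.toReal_le_of_le_ofReal ?_ hint)
  exact mul_nonneg (Finset.sum_nonneg fun s _ => mul_nonneg (mul_nonneg hK0 (hCV0 s)) (hGS0 s)) hT0


theorem stmt13 (d : ℕ) (hd : 2 ≤ d) (ξ : Fin d → ℝ)
    (M0 : Matrix (Fin d) (Fin d) ℝ) (hM0 : M0.det = 1)
    (η r : ℝ) (hη : 0 < η) (hr : 0 < r)
    (lam : Measure (Ed d)) (hprob : IsProbabilityMeasure lam)
    (hlam : HasContinuousDensity d lam)
    (vc bc : (Matrix (Fin d) (Fin d) ℝ × (Fin d → ℝ)) → (Fin d → ℝ))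
    (hsec : IsSiegelSection d vc bc)
    (hyp : η < (d : ℝ) ∨
      (η < (d : ℝ) + 1 ∧
        (d = 2 → Summable (fun l : ℕ =>
          (2:ℝ) ^ ((η - 2) * ((l : ℝ) + 1)) * ((zetaDio ξ ((2:ℝ) ^ l) : ℝ))⁻¹ ^ 2)) ∧
        (3 ≤ d → Summable (fun l : ℕ =>
          ((l : ℝ) + 1) ^ ((d : ℝ) - 1) * (2:ℝ) ^ ((η - d) * ((l : ℝ) + 1)) *
            ((zetaDio ξ ((2:ℝ) ^ l) : ℝ))⁻¹)))) :
    Tendsto (fun R : ℝ =>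
      limsup (fun t : ℝ =>
        |∫ υ in {υ : Ed d | 0 ≤ υ ⟨0, by omega⟩},
          Ffun d R η r (vc (gEltSph d ξ M0 υ t)) (bc (gEltSph d ξ M0 υ t)) ∂lam|) atTop)
      atTop (𝓝 0) := by
  obtain ⟨n, rfl⟩ : ∃ n, d = n + 1 := ⟨d - 1, by omega⟩
  have hn : 1 ≤ n := by omega
  obtain ⟨Z, hZ1, hZ, hsum⟩ := exists_Z hn ξ η hyp
  obtain ⟨G, hG0, hG⟩ := main_bound hn ξ M0 hM0 η r hη hr lam hlam vc bc hsec Z hZ1 hZ hsum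
  have htail := tendsto_sum_nat_add (fun l : ℕ => (2:ℝ) ^ ((η - ((n+1:ℕ):ℝ)) * (l:ℝ)) * (((Z l : ℕ) : ℝ)⁻¹) ^ eExp (n+1))
  have htail2 := htail.const_mul G
  rw [mul_zero] at htail2
  rw [Metric.tendsto_atTop]
  intro ε hε
  obtain ⟨P, hP⟩ := ((tendsto_order.mp htail2).2 (ε/2) (by linarith)).exists
  obtain ⟨R0, hR0⟩ := hG P
  refine ⟨R0, fun R hR => ?_⟩
  have hle : ∀ᶠ t : ℝ in atTop, |∫ υ in {υ : Ed (n+1) | 0 ≤ υ ⟨0, by omega⟩},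
          Ffun (n+1) R η r (vc (gEltSph (n+1) ξ M0 υ t)) (bc (gEltSph (n+1) ξ M0 υ t)) ∂lam| ≤ ε/2 := by
    filter_upwards [eventually_ge_atTop 0] with t ht
    exact (hR0 R hR t ht).trans hP.le
  have hge : ∀ᶠ t : ℝ in atTop, 0 ≤ |∫ υ in {υ : Ed (n+1) | 0 ≤ υ ⟨0, by omega⟩},
          Ffun (n+1) R η r (vc (gEltSph (n+1) ξ M0 υ t)) (bc (gEltSph (n+1) ξ M0 υ t)) ∂lam| :=
    Eventually.of_forall fun t => abs_nonneg _
  have hbd := isBoundedUnder_of_eventually_le hle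
  have hcb := (isBoundedUnder_of_eventually_ge hge).isCoboundedUnder_le
  have h1 := limsup_le_of_le hcb hle
  have h2 := le_limsup_of_frequently_le hge.frequently hbd
  rw [Real.dist_eq, sub_zero, abs_of_nonneg h2]
  linarith

end
end

section
/- Let d ≥ 1, s > 0, ρ ≥ 0 and ν > 0 with s > (ρ+1)/ν. If ξ ∈ ℝ^d is an s-Brjuno vector, i.e. Σ_{n=0}^∞ 2^{−n/s} · max_{m ∈ ℤ^d, 0<|m|≤2^n} log(1/|ξ·m|_ℤ) < ∞, then Σ_{l=1}^∞ l^ρ ζ(ξ, 2^{l−1})^{−ν} < ∞. -/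
open Filter

noncomputable section

/-- an s-Brjuno vector with s > (ρ+1)/ν is (ρ,0,ν)-vaguely Diophantine,
i.e. Σ_{l≥1} l^ρ ζ(ξ,2^{l-1})^{-ν} < ∞ (the sum is re-indexed by l = l'+1). -/
theorem stmt18 (d : ℕ) (hd : 1 ≤ d) (s ρ ν : ℝ) (hs : 0 < s) (hρ : 0 ≤ ρ) (hν : 0 < ν)
    (hsρν : (ρ + 1) / ν < s) (ξ : Fin d → ℝ)
    (hnz : ∀ m : Fin d → ℤ, m ≠ 0 → distToInt (∑ i, ξ i * (m i : ℝ)) ≠ 0)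
    (hB : Summable (fun n : ℕ => (2:ℝ) ^ (-(n : ℝ) / s) *
      sSup {x : ℝ | ∃ m : Fin d → ℤ, m ≠ 0 ∧ (∀ i, |m i| ≤ (2 ^ n : ℤ)) ∧
        x = Real.log (1 / distToInt (∑ i, ξ i * (m i : ℝ)))})) :
    Summable (fun l : ℕ => ((l : ℝ) + 1) ^ ρ * (zetaDio ξ ((2:ℝ) ^ l) : ℝ) ^ (-ν)) := by
  have hlog2 : 0 < Real.log 2 := Real.log_pos (by norm_num)
  obtain ⟨C, hC⟩ := hB.tendsto_atTop_zero.bddAbove_range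
  have hC0 : ∀ n : ℕ, sSup {x : ℝ | ∃ m : Fin d → ℤ, m ≠ 0 ∧ (∀ i, |m i| ≤ (2 ^ n : ℤ)) ∧
        x = Real.log (1 / distToInt (∑ i, ξ i * (m i : ℝ)))} ≤ max C 0 * (2:ℝ) ^ ((n : ℝ) / s) := by
    intro n
    have h1 := hC (Set.mem_range_self n)
    have hp : 0 < (2:ℝ) ^ ((n : ℝ) / s) := by positivity
    simp only [neg_div, Real.rpow_neg (show (0:ℝ) ≤ 2 by norm_num)] at h1
    rw [inv_mul_le_iff₀ hp] at h1
    refine h1.trans ?_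
    rw [mul_comm]
    gcongr
    exact le_max_left _ _
  set A : ℝ := max C 0 / Real.log 2 + 1 with hA
  have hA0 : 0 < A := by positivity
  set K : ℝ := (A ^ s * 2)⁻¹ with hK
  have hK0 : 0 < K := by positivity
  have key : ∀ l : ℕ, zetaDio ξ ((2:ℝ) ^ l) = 0 ∨
      K * ((l : ℝ) + 1) ^ s ≤ (zetaDio ξ ((2:ℝ) ^ l) : ℝ) := by
    intro l
    rcases Nat.eq_zero_or_pos (zetaDio ξ ((2:ℝ) ^ l)) with h | hpos
    · exact Or.inl h
    right
    have hmem := Nat.sInf_mem (Nat.nonempty_of_pos_sInf hpos)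
    change ∃ m : Fin d → ℤ, m ≠ 0 ∧ (∀ i, |m i| ≤ ((zetaDio ξ ((2:ℝ) ^ l) : ℕ) : ℤ)) ∧
      distToInt (∑ i, ξ i * (m i : ℝ)) ≤ 1 / (2:ℝ) ^ l at hmem
    generalize zetaDio ξ ((2:ℝ) ^ l) = N at hpos hmem ⊢
    obtain ⟨m, hm0, hmN, hmd⟩ := hmem
    obtain ⟨n, hn1, hn2⟩ : ∃ n : ℕ, N ≤ 2 ^ n ∧ 2 ^ n ≤ 2 * N := by
      refine ⟨Nat.log 2 N + 1, (Nat.lt_pow_succ_log_self (by norm_num) N).le, ?_⟩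
      have := Nat.pow_log_le_self 2 hpos.ne'
      rw [pow_succ]; omega
    have hd0 : 0 < distToInt (∑ i, ξ i * (m i : ℝ)) :=
      lt_of_le_of_ne (abs_nonneg _) (Ne.symm (hnz m hm0))
    have hle : Real.log (1 / distToInt (∑ i, ξ i * (m i : ℝ))) ≤
        max C 0 * (2:ℝ) ^ ((n : ℝ) / s) := by
      refine le_trans ?_ (hC0 n)
      refine le_csSup ?_ ⟨m, hm0, fun i => (hmN i).trans (by exact_mod_cast hn1), rfl⟩
      apply Set.Finite.bddAbove
      refine ((Set.finite_Icc (fun _ : Fin d => -(2 ^ n : ℤ)) (fun _ => (2 ^ n : ℤ))).image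
        (fun m => Real.log (1 / distToInt (∑ i, ξ i * (m i : ℝ))))).subset ?_
      rintro x ⟨m, -, hm, rfl⟩
      exact ⟨m, ⟨fun i => (abs_le.mp (hm i)).1, fun i => (abs_le.mp (hm i)).2⟩, rfl⟩
    have hl : (l : ℝ) * Real.log 2 ≤ Real.log (1 / distToInt (∑ i, ξ i * (m i : ℝ))) := by
      rw [← Real.log_pow]
      apply Real.log_le_log (by positivity)
      rw [le_div_iff₀ hd0]
      rw [le_div_iff₀ (by positivity)] at hmd
      linarith
    have h1 : (1:ℝ) ≤ (2:ℝ) ^ ((n : ℝ) / s) := Real.one_le_rpow (by norm_num) (by positivity)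
    have h2 : (l : ℝ) + 1 ≤ A * (2:ℝ) ^ ((n : ℝ) / s) := by
      have : (l : ℝ) ≤ max C 0 / Real.log 2 * (2:ℝ) ^ ((n : ℝ) / s) := by
        rw [div_mul_eq_mul_div, le_div_iff₀ hlog2]
        linarith
      rw [hA, add_mul]; linarith
    have h3 : ((l : ℝ) + 1) ^ s ≤ A ^ s * (2 * N) := by
      calc ((l : ℝ) + 1) ^ s ≤ (A * (2:ℝ) ^ ((n : ℝ) / s)) ^ s :=
            Real.rpow_le_rpow (by positivity) h2 hs.le
        _ = A ^ s * (2:ℝ) ^ n := by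
            rw [Real.mul_rpow hA0.le (by positivity), ← Real.rpow_mul (by norm_num),
              div_mul_cancel₀ _ hs.ne', Real.rpow_natCast]
        _ ≤ A ^ s * (2 * N) := by
            gcongr
            exact_mod_cast hn2
    rw [hK, inv_mul_le_iff₀ (by positivity)]
    linarith
  have hsum : Summable (fun l : ℕ => K ^ (-ν) * ((l : ℝ) + 1) ^ (ρ - s * ν)) := by
    apply Summable.mul_left
    have h : ρ - s * ν < -1 := by
      rw [div_lt_iff₀ hν] at hsρν
      linarith
    have := (summable_nat_add_iff 1).mpr (Real.summable_nat_rpow.mpr h)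
    simpa using this
  refine Summable.of_nonneg_of_le (fun l => by positivity) (fun l => ?_) hsum
  have hl0 : (0:ℝ) < (l : ℝ) + 1 := by positivity
  rcases key l with h | h
  · rw [h, Nat.cast_zero, Real.zero_rpow (by linarith), mul_zero]
    positivity
  · have h4 := Real.rpow_le_rpow_of_nonpos (by positivity) h (show -ν ≤ 0 by linarith)
    calc _ ≤ ((l : ℝ) + 1) ^ ρ * (K * ((l : ℝ) + 1) ^ s) ^ (-ν) := by gcongr
      _ = K ^ (-ν) * ((l : ℝ) + 1) ^ (ρ - s * ν) := by
        rw [Real.mul_rpow hK0.le (by positivity), ← Real.rpow_mul hl0.le, sub_eq_add_neg,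
          Real.rpow_add hl0, mul_neg]
        ring

end
end
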